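/- arXiv:0902.4895 — 2 statements merged into one kernel-verified Lean document; each statement's English description precedes it below -/
import Mathlib

section
/- Let c ≥ 1 be a real number and let f be a C^∞ function defined on [x_0, ∞) for some x_0 ≥ 1, with f(x) → ∞ as x → ∞, such that for every ε > 0 and every integer j ≥ 0 there are positive constants A_{j,ε}, B_{j,ε} and a point beyond which A_{j,ε} x^{c−j−ε} ≤ |f^{(j)}(x)| ≤ B_{j,ε} x^{c−j+ε}. Then there exists s_0 ∈ ℕ such that for every integer s ≥ s_0 and every ε with 0 < ε < 1/(6s) there exist K > 0 and N_0 with the following property: for every integer N ≥ N_0, if X = N^{1/c} and X_0 < X_1 are defined by f(X_0) = N/(s+1) and f(X_1) = 2N/(s+1), then the number R_s(N) of s-tuples of integers (n_1, ..., n_s) with X_0 < n_i ≤ X_1 for all i and ⌊f(n_1)⌋ + ⌊f(n_2)⌋ + ... + ⌊f(n_s)⌋ = N satisfies R_s(N) ≥ K · X^{s − c − 2ε}. -/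
open Finset

noncomputable def ee (x : ℝ) : ℂ := Complex.exp ((2 * Real.pi * x : ℝ) * Complex.I)

lemma ee_add (x y : ℝ) : ee (x + y) = ee x * ee y := by
  unfold ee; rw [← Complex.exp_add]; congr 1; push_cast; ring

lemma ee_norm (x : ℝ) : ‖ee x‖ = 1 := by
  unfold ee; exact Complex.norm_exp_ofReal_mul_I _

lemma ee_zero : ee 0 = 1 := by simp [ee]

lemma ee_conj (x : ℝ) : (starRingEnd ℂ) (ee x) = ee (-x) := by
  unfold ee; rw [← Complex.exp_conj]; congr 1
  simp only [map_mul, Complex.conj_ofReal, Complex.conj_I]; push_cast; ring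

lemma ee_int (n : ℤ) : ee n = 1 := by
  unfold ee
  rw [Complex.exp_eq_one_iff]; exact ⟨n, by push_cast; ring⟩

lemma ee_sub_one_norm (x : ℝ) : ‖ee x - 1‖ = 2 * |Real.sin (Real.pi * x)| := by
  unfold ee
  rw [mul_comm _ Complex.I, Complex.norm_exp_I_mul_ofReal_sub_one, norm_mul]
  rw [show 2 * Real.pi * x / 2 = Real.pi * x by ring]; simp

lemma ee_sub_one_le (x : ℝ) : ‖ee x - 1‖ ≤ 2 * Real.pi * |x| := by
  rw [ee_sub_one_norm]
  have := Real.abs_sin_le_abs (x := Real.pi * x)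
  rw [abs_mul, abs_of_pos Real.pi_pos] at this
  linarith

lemma ee_sub (x y : ℝ) : ee (x - y) = ee x * ee (-y) := by rw [sub_eq_add_neg, ee_add]

lemma ee_mul_neg (x : ℝ) : ee x * ee (-x) = 1 := by rw [← ee_add]; simp [ee_zero]

lemma ee_sub_le (x y : ℝ) : ‖ee x - ee y‖ ≤ 2 * Real.pi * |x - y| := by
  have : ee x - ee y = ee y * (ee (x - y) - 1) := by
    rw [mul_sub, ← ee_add]; congr 2 <;> ring
  rw [this, norm_mul, ee_norm, one_mul]; exact ee_sub_one_le _

lemma ee_sub_one_ge (x : ℝ) (h0 : 0 ≤ x) (h1 : x ≤ 1 / 2) : 4 * x ≤ ‖ee x - 1‖ := by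
  rw [ee_sub_one_norm]
  have := Real.mul_le_sin (x := Real.pi * x) (by positivity) (by nlinarith [Real.pi_pos])
  have h2 : 2 / Real.pi * (Real.pi * x) = 2 * x := by field_simp
  rw [h2] at this
  have := le_abs_self (Real.sin (Real.pi * x)); linarith


lemma KL_raw (g : ℕ → ℝ) (L : ℕ) (lam : ℝ) (hl : 0 < lam)
    (hd : ∀ n ≤ L, lam ≤ g (n+1) - g n ∧ g (n+1) - g n ≤ 1/2) :
    ‖∑ n ∈ range (L+1), ee (g n) - ee (g (L+1)) * (ee (g (L+1) - g L) - 1)⁻¹‖ ≤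
      1 / (4 * lam) + Real.pi / 8 * ∑ n ∈ range L, |(g (n+1) - g n)⁻¹ - (g (n+2) - g (n+1))⁻¹| := by
  have key : ∀ n ≤ L, (ee (g (n+1)) - ee (g n)) * (ee (g (n+1) - g n) - 1)⁻¹ = ee (g n) ∧
      ‖(ee (g (n+1) - g n) - 1)⁻¹‖ ≤ 1 / (4 * (g (n+1) - g n)) ∧ ee (g (n+1) - g n) - 1 ≠ 0 := by
    intro n hn
    obtain ⟨h1, h2⟩ := hd n hn
    have h3 := ee_sub_one_ge (g (n+1) - g n) (by linarith) h2
    have h4 : 0 < ‖ee (g (n+1) - g n) - 1‖ := by linarith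
    have h5 : ee (g (n+1) - g n) - 1 ≠ 0 := norm_pos_iff.mp h4
    refine ⟨?_, ?_, h5⟩
    · have : ee (g (n+1)) - ee (g n) = ee (g n) * (ee (g (n+1) - g n) - 1) := by
        rw [mul_sub, ← ee_add]; congr 2 <;> ring
      rw [this, mul_assoc, mul_inv_cancel₀ h5, mul_one]
    · rw [norm_inv, ← one_div]
      apply one_div_le_one_div_of_le (by linarith) h3
  induction L with
  | zero =>
    obtain ⟨k1, k2, k3⟩ := key 0 le_rfl
    obtain ⟨h1, h2⟩ := hd 0 le_rfl
    simp only [zero_add, sum_range_one, range_zero, sum_empty, mul_zero, add_zero] at *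
    have : ee (g 0) - ee (g 1) * (ee (g 1 - g 0) - 1)⁻¹ = - ee (g 0) * (ee (g 1 - g 0) - 1)⁻¹ := by
      linear_combination -k1
    rw [this, norm_mul, norm_neg, ee_norm, one_mul]
    refine k2.trans ?_
    apply one_div_le_one_div_of_le (by linarith) (by linarith)
  | succ L ih =>
    have ih' := ih (fun n hn => hd n (by omega)) (fun n hn => key n (by omega))
    obtain ⟨k1, k2, k3⟩ := key L (by omega)
    obtain ⟨m1, m2, m3⟩ := key (L+1) le_rfl
    obtain ⟨h1, h2⟩ := hd L (by omega)
    obtain ⟨h3, h4⟩ := hd (L+1) le_rfl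
    rw [sum_range_succ _ (L+1), sum_range_succ (fun n => |(g (n+1) - g n)⁻¹ - (g (n+2) - g (n+1))⁻¹|) L]
    have e1 : ∑ n ∈ range (L+1), ee (g n) + ee (g (L+1)) - ee (g (L+1+1)) * (ee (g (L+1+1) - g (L+1)) - 1)⁻¹
       = (∑ n ∈ range (L+1), ee (g n) - ee (g (L+1)) * (ee (g (L+1) - g L) - 1)⁻¹)
        + ee (g (L+1)) * ((ee (g (L+1) - g L) - 1)⁻¹ - (ee (g (L+1+1) - g (L+1)) - 1)⁻¹) := by
      linear_combination -m1
    rw [e1]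
    refine (norm_add_le _ _).trans ?_
    have e2 : ‖ee (g (L+1)) * ((ee (g (L+1) - g L) - 1)⁻¹ - (ee (g (L+1+1) - g (L+1)) - 1)⁻¹)‖
        ≤ Real.pi / 8 * |(g (L+1) - g L)⁻¹ - (g (L+2) - g (L+1))⁻¹| := by
      rw [norm_mul, ee_norm, one_mul, inv_sub_inv k3 m3, norm_div, norm_mul]
      set a := g (L+1) - g L
      set b := g (L+1+1) - g (L+1)
      have ha : 0 < a := by linarith
      have hb : 0 < b := by linarith
      change _ ≤ Real.pi / 8 * |a⁻¹ - b⁻¹|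
      rw [inv_sub_inv ha.ne' hb.ne', abs_div, abs_of_pos (mul_pos ha hb)]
      have s1 := ee_sub_one_ge a ha.le h2
      have s2 := ee_sub_one_ge b hb.le h4
      have s3 : ‖ee b - 1 - (ee a - 1)‖ ≤ 2 * Real.pi * |b - a| := by
        have := ee_sub_le b a
        convert this using 2; ring
      calc _ ≤ (2 * Real.pi * |b - a|) / ((4 * a) * (4 * b)) := by
            gcongr
        _ = _ := by field_simp; ring
    rw [mul_add]
    linarith

lemma sum_abs_mono (w : ℕ → ℝ) (L : ℕ) (B : ℝ) (hw : ∀ n ≤ L, 0 ≤ w n ∧ w n ≤ B)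
    (hm : (∀ n < L, w n ≤ w (n+1)) ∨ (∀ n < L, w (n+1) ≤ w n)) :
    ∑ n ∈ range L, |w n - w (n+1)| ≤ B := by
  rcases hm with h | h
  · rw [sum_congr rfl (g := fun n => w (n+1) - w n)]
    · rw [sum_range_sub]; linarith [(hw 0 (by omega)).1, (hw L le_rfl).2]
    · intro n hn; rw [abs_of_nonpos] <;> linarith [h n (mem_range.mp hn)]
  · rw [sum_congr rfl (g := fun n => w n - w (n+1))]
    · rw [sum_range_sub']; linarith [(hw 0 (by omega)).2, (hw L le_rfl).1]
    · intro n hn; rw [abs_of_nonneg]; linarith [h n (mem_range.mp hn)]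

lemma KL (g : ℕ → ℝ) (L : ℕ) (lam : ℝ) (hl : 0 < lam)
    (hd : ∀ n < L, lam ≤ g (n+1) - g n ∧ g (n+1) - g n ≤ 1/2)
    (hm : (∀ n, n + 1 < L → g (n+1) - g n ≤ g (n+2) - g (n+1)) ∨
      (∀ n, n + 1 < L → g (n+2) - g (n+1) ≤ g (n+1) - g n)) :
    ‖∑ n ∈ range L, ee (g n)‖ ≤ 1 / lam := by
  rcases L with _ | L
  · simp; positivity
  have h := KL_raw g L lam hl (fun n hn => hd n (by omega))
  have hv : ∑ n ∈ range L, |(g (n+1) - g n)⁻¹ - (g (n+2) - g (n+1))⁻¹| ≤ lam⁻¹ := by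
    apply sum_abs_mono (fun n => (g (n+1) - g n)⁻¹) L
    · intro n hn
      have := hd n (by omega)
      exact ⟨inv_nonneg.mpr (by linarith), inv_anti₀ hl this.1⟩
    · rcases hm with hm | hm
      · right; intro n hn
        have := hd n (by omega)
        exact inv_anti₀ (by linarith) (hm n (by omega))
      · left; intro n hn
        have := hd (n+1) (by omega)
        exact inv_anti₀ (by simp only [add_assoc] at this; norm_num at this; linarith) (hm n (by omega))
  have hw : ‖ee (g (L+1)) * (ee (g (L+1) - g L) - 1)⁻¹‖ ≤ 1 / (4 * lam) := by
    have h1 := hd L (by omega)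
    rw [norm_mul, ee_norm, one_mul, norm_inv, ← one_div]
    apply one_div_le_one_div_of_le (by linarith)
    have := ee_sub_one_ge (g (L+1) - g L) (by linarith) h1.2
    linarith
  have := norm_le_norm_sub_add (∑ n ∈ range (L+1), ee (g n)) (ee (g (L+1)) * (ee (g (L+1) - g L) - 1)⁻¹)
  have e : 1 / (4 * lam) = lam⁻¹ / 4 := by rw [one_div, mul_inv]; ring
  rw [e] at h hw
  rw [one_div]
  have hp : Real.pi / 8 * ∑ n ∈ range L, |(g (n+1) - g n)⁻¹ - (g (n+2) - g (n+1))⁻¹| ≤ 1/2 * lam⁻¹ := by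
    apply mul_le_mul _ hv (sum_nonneg fun _ _ => abs_nonneg _) (by norm_num)
    linarith [Real.pi_lt_four]
  linarith

noncomputable def cor (z : ℕ → ℂ) (L h : ℕ) : ℂ :=
  ∑ n ∈ range (L - h), z (n + h) * (starRingEnd ℂ) (z n)

noncomputable def yy (z : ℕ → ℂ) (L j m : ℕ) : ℂ := if j ≤ m ∧ m < L + j then z (m - j) else 0

lemma yy_sum (z : ℕ → ℂ) (L H j : ℕ) (hj : j < H) :
    ∑ m ∈ range (L + H), yy z L j m = ∑ n ∈ range L, z n := by
  unfold yy
  rw [← sum_filter]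
  have : (range (L+H)).filter (fun m => j ≤ m ∧ m < L + j) = Ico j (L+j) := by
    ext m; simp only [mem_filter, mem_range, mem_Ico]; omega
  rw [this, sum_Ico_eq_sum_range]
  simp

lemma yy_cor (z : ℕ → ℂ) (L H j j' : ℕ) (hj : j ≤ j') (hj' : j' < H) :
    ∑ m ∈ range (L + H), yy z L j m * (starRingEnd ℂ) (yy z L j' m) = cor z L (j' - j) := by
  unfold yy cor
  have h1 : ∀ m, (if j ≤ m ∧ m < L + j then z (m - j) else 0) *
      (starRingEnd ℂ) (if j' ≤ m ∧ m < L + j' then z (m - j') else 0) =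
      if j' ≤ m ∧ m < L + j then z (m - j) * (starRingEnd ℂ) (z (m - j')) else 0 := by
    intro m
    by_cases h : j' ≤ m ∧ m < L + j
    · rw [if_pos h, if_pos (by omega), if_pos (by omega)]
    · rw [if_neg h]
      by_cases h2 : j ≤ m ∧ m < L + j
      · rw [if_neg (c := j' ≤ m ∧ m < L + j') (by omega)] <;> simp
      · rw [if_neg h2]; simp
  simp_rw [h1]
  rw [← sum_filter]
  have : (range (L+H)).filter (fun m => j' ≤ m ∧ m < L + j) = Ico j' (L+j) := by
    ext m; simp only [mem_filter, mem_range, mem_Ico]; omega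
  rw [this, sum_Ico_eq_sum_range]
  rw [show L + j - j' = L - (j' - j) by omega]
  apply sum_congr rfl
  intro n _
  rw [show j' + n - j = n + (j' - j) by omega, show j' + n - j' = n by omega]

lemma yy_cor_norm (z : ℕ → ℂ) (L H j j' : ℕ) (hj : j < H) (hj' : j' < H) :
    ‖∑ m ∈ range (L + H), yy z L j m * (starRingEnd ℂ) (yy z L j' m)‖
      = ‖cor z L ((j' - j) + (j - j'))‖ := by
  rcases le_total j j' with h | h
  · rw [yy_cor z L H j j' h hj']; congr 2; omega
  · have := yy_cor z L H j' j h hj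
    rw [show (j' - j) + (j - j') = j - j' by omega, ← this, ← Complex.norm_conj, map_sum]
    congr 1
    apply sum_congr rfl; intro m _
    simp [mul_comm]

lemma VDC (z : ℕ → ℂ) (L H : ℕ) :
    ‖∑ n ∈ range L, z n‖ ^ 2 * (H:ℝ) ^ 2 ≤
      (L + H) * ∑ j ∈ range H, ∑ j' ∈ range H, ‖cor z L ((j' - j) + (j - j'))‖ := by
  have h1 : (H : ℂ) * ∑ n ∈ range L, z n = ∑ m ∈ range (L+H), ∑ j ∈ range H, yy z L j m := by
    rw [sum_comm, sum_congr rfl (fun j hj => yy_sum z L H j (mem_range.mp hj))]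
    simp
  have h2 : ‖∑ n ∈ range L, z n‖ * (H:ℝ) ≤ ∑ m ∈ range (L+H), ‖∑ j ∈ range H, yy z L j m‖ := by
    have : ‖(H : ℂ) * ∑ n ∈ range L, z n‖ = ‖∑ n ∈ range L, z n‖ * (H:ℝ) := by
      rw [norm_mul]; simp [mul_comm]
    rw [← this, h1]; exact norm_sum_le _ _
  have h3 : (∑ m ∈ range (L+H), ‖∑ j ∈ range H, yy z L j m‖)^2 ≤
      (L + H) * ∑ m ∈ range (L+H), ‖∑ j ∈ range H, yy z L j m‖^2 := by
    have := sq_sum_le_card_mul_sum_sq (s := range (L+H)) (f := fun m => ‖∑ j ∈ range H, yy z L j m‖)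
    simpa using this
  have h4 : ((∑ m ∈ range (L+H), ‖∑ j ∈ range H, yy z L j m‖^2 : ℝ) : ℂ) =
      ∑ j ∈ range H, ∑ j' ∈ range H, ∑ m ∈ range (L+H), yy z L j m * (starRingEnd ℂ) (yy z L j' m) := by
    push_cast
    simp_rw [← Complex.mul_conj', map_sum, sum_mul_sum]
    rw [sum_comm]
    apply sum_congr rfl; intro j _
    rw [sum_comm]
  have h5 : ∑ m ∈ range (L+H), ‖∑ j ∈ range H, yy z L j m‖^2 ≤
      ∑ j ∈ range H, ∑ j' ∈ range H, ‖cor z L ((j' - j) + (j - j'))‖ := by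
    have h6 : ∑ m ∈ range (L+H), ‖∑ j ∈ range H, yy z L j m‖^2 =
      ‖((∑ m ∈ range (L+H), ‖∑ j ∈ range H, yy z L j m‖^2 : ℝ) : ℂ)‖ := by
      rw [Complex.norm_real, Real.norm_of_nonneg]
      exact sum_nonneg fun _ _ => by positivity
    rw [h6, h4]
    refine (norm_sum_le _ _).trans (sum_le_sum fun j hj => (norm_sum_le _ _).trans (sum_le_sum fun j' hj' => ?_))
    rw [yy_cor_norm z L H j j' (mem_range.mp hj) (mem_range.mp hj')]
  calc _ = (‖∑ n ∈ range L, z n‖ * (H:ℝ))^2 := by ring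
    _ ≤ _ := pow_le_pow_left₀ (by positivity) h2 2
    _ ≤ _ := h3
    _ ≤ _ := by gcongr

lemma VDC' (z : ℕ → ℂ) (hz : ∀ n, ‖z n‖ ≤ 1) (L H h₀ : ℕ) (B : ℝ) (hB : 0 ≤ B)
    (hC : ∀ h, h₀ ≤ h → h < H → ‖cor z L h‖ ≤ B) :
    ‖∑ n ∈ range L, z n‖ ^ 2 * (H:ℝ) ≤ (L + H) * (2 * h₀ * L + H * B) := by
  rcases Nat.eq_zero_or_pos H with rfl | hH
  · simp; positivity
  have hHr : (0:ℝ) < H := by exact_mod_cast hH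
  have h1 := VDC z L H
  have triv : ∀ h, ‖cor z L h‖ ≤ L := by
    intro h
    unfold cor
    refine (norm_sum_le _ _).trans ?_
    calc _ ≤ ∑ n ∈ range (L - h), (1:ℝ) := by
          apply sum_le_sum; intro n _
          rw [norm_mul, Complex.norm_conj]
          exact mul_le_one₀ (hz _) (norm_nonneg _) (hz _)
      _ ≤ _ := by simp
  have h2 : ∀ j ∈ range H, ∑ j' ∈ range H, ‖cor z L ((j' - j) + (j - j'))‖ ≤ 2 * h₀ * L + H * B := by
    intro j _
    calc _ ≤ ∑ j' ∈ range H, ((if (j' - j) + (j - j') < h₀ then (L:ℝ) else 0) + B) := by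
          apply sum_le_sum; intro j' hj'
          split_ifs with h
          · linarith [triv ((j' - j) + (j - j'))]
          · rw [zero_add]; apply hC <;> simp at *
            · omega
            · omega
      _ ≤ _ := by
          rw [sum_add_distrib, ← sum_filter, sum_const, sum_const, card_range, nsmul_eq_mul, nsmul_eq_mul]
          have : ((range H).filter (fun j' => (j' - j) + (j - j') < h₀)).card ≤ 2 * h₀ := by
            calc _ ≤ (Ico (j - (h₀-1)) (j + h₀)).card := by
                  apply card_le_card; intro x hx
                  simp only [mem_filter, mem_range, mem_Ico] at *; omega
              _ ≤ _ := by simp; omega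
          have : (((range H).filter (fun j' => (j' - j) + (j - j') < h₀)).card : ℝ) ≤ 2 * h₀ := by
            exact_mod_cast this
          gcongr
  have h3 := sum_le_sum h2
  rw [sum_const, card_range, nsmul_eq_mul] at h3
  have : ‖∑ n ∈ range L, z n‖ ^ 2 * (H:ℝ) * H ≤ (L + H) * (2 * h₀ * L + H * B) * H := by
    calc _ = ‖∑ n ∈ range L, z n‖ ^ 2 * (H:ℝ)^2 := by ring
      _ ≤ _ := h1
      _ ≤ (L+H) * (H * (2 * h₀ * L + H * B)) := by gcongr
      _ = _ := by ring
  exact le_of_mul_le_mul_right this hHr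

def DD (g : ℕ → ℝ) : ℕ → ℝ := fun n => g (n+1) - g n

lemma DD_iter_sum (k : ℕ) : ∀ (φ : ℕ → ℝ) (h n : ℕ),
    DD^[k] (fun n => ∑ i ∈ range h, φ (n+i)) n = ∑ i ∈ range h, DD^[k] φ (n+i) := by
  induction k with
  | zero => intros; rfl
  | succ k ih =>
    intro φ h n
    rw [Function.iterate_succ_apply, Function.iterate_succ_apply, ← ih]
    refine congrFun (congrArg _ ?_) n
    funext m
    simp only [DD]
    rw [← sum_sub_distrib]
    apply sum_congr rfl; intro i _
    rw [show m + 1 + i = m + i + 1 by ring]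

lemma DD_diff (k : ℕ) (g : ℕ → ℝ) (h n : ℕ) :
    DD^[k] (fun n => g (n+h) - g n) n = ∑ i ∈ range h, DD^[k+1] g (n+i) := by
  rw [Function.iterate_succ_apply, ← DD_iter_sum]
  refine congrFun (congrArg _ ?_) n
  funext m
  simp only [DD]
  have := sum_range_sub (fun i => g (m+i)) h
  simp only [← add_assoc, add_zero] at this
  exact this.symm

lemma DD_smul (k : ℕ) : ∀ (g : ℕ → ℝ) (b : ℝ) (n : ℕ), DD^[k] (fun n => b * g n) n = b * DD^[k] g n := by
  induction k with
  | zero => intros; rfl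
  | succ k ih =>
    intro g b n
    rw [Function.iterate_succ_apply, Function.iterate_succ_apply, ← ih]
    refine congrFun (congrArg _ ?_) n
    funext m; simp only [DD]; ring

lemma cor_ee (g : ℕ → ℝ) (L h : ℕ) :
    cor (fun n => ee (g n)) L h = ∑ n ∈ range (L - h), ee (g (n+h) - g n) := by
  unfold cor; apply sum_congr rfl; intro n _
  rw [ee_conj, ee_sub]

lemma ev_pow (C a b : ℝ) (hab : a < b) : ∃ Y : ℝ, 1 ≤ Y ∧ ∀ X, Y ≤ X → C * X ^ a ≤ X ^ b := by
  have h := (tendsto_rpow_atTop (sub_pos.mpr hab)).eventually_ge_atTop C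
  obtain ⟨Y, hY⟩ := Filter.eventually_atTop.mp h
  refine ⟨max Y 1, le_max_right _ _, fun X hX => ?_⟩
  have hX1 : 1 ≤ X := (le_max_right _ _).trans hX
  have h1 := hY X ((le_max_left _ _).trans hX)
  have hX0 : 0 < X := by linarith
  calc C * X ^ a ≤ X ^ (b - a) * X ^ a := by gcongr
    _ = X ^ b := by rw [← Real.rpow_add hX0]; congr 1; ring

def GoodK (k : ℕ) (um θ : ℝ) : Prop :=
  ∃ η : ℝ, 0 < η ∧ ∃ ε : ℝ, 0 < ε ∧ ∃ Y : ℝ, 1 ≤ Y ∧ ∀ X : ℝ, Y ≤ X → ∀ u : ℝ, θ ≤ u → u ≤ um →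
    ∀ L : ℕ, (L : ℝ) ≤ X ^ (1 + ε) → ∀ g : ℕ → ℝ,
      (∀ n < L, X ^ (-u - ε) ≤ DD^[k] g n ∧ DD^[k] g n ≤ X ^ (-u + ε)) →
      ((∀ n < L, 0 ≤ DD^[k+1] g n) ∨ (∀ n < L, DD^[k+1] g n ≤ 0)) →
      ‖∑ n ∈ range L, ee (g n)‖ ≤ X ^ (1 - η)

lemma KL_DD (g : ℕ → ℝ) (L : ℕ) (lam : ℝ) (hl : 0 < lam)
    (hd : ∀ n < L, lam ≤ DD^[1] g n ∧ DD^[1] g n ≤ 1/2)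
    (hm : (∀ n < L, 0 ≤ DD^[2] g n) ∨ (∀ n < L, DD^[2] g n ≤ 0)) :
    ‖∑ n ∈ range L, ee (g n)‖ ≤ 1 / lam := by
  apply KL g L lam hl hd
  rcases hm with hm | hm
  · left; intro n hn
    have : 0 ≤ (g (n+2) - g (n+1)) - (g (n+1) - g n) := hm n (by omega)
    linarith
  · right; intro n hn
    have : (g (n+2) - g (n+1)) - (g (n+1) - g n) ≤ 0 := hm n (by omega)
    linarith

lemma goodK_one (θ : ℝ) (hθ : 0 < θ) : GoodK 1 (15/16) θ := by
  obtain ⟨Y, hY1, hY⟩ := ev_pow 2 (-θ/2) 0 (by linarith)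
  refine ⟨1/32, by norm_num, min (1/64) (θ/2), by positivity, Y, hY1, ?_⟩
  intro X hX u hu1 hu2 L hL g hd hm
  set ε := min (1/64) (θ/2)
  have he1 : ε ≤ 1/64 := min_le_left _ _
  have he2 : ε ≤ θ/2 := min_le_right _ _
  have hX1 : 1 ≤ X := hY1.trans hX
  have hX0 : 0 < X := by linarith
  refine (KL_DD g L (X ^ (-u - ε)) (by positivity) (fun n hn => ⟨(hd n hn).1, (hd n hn).2.trans ?_⟩) hm).trans ?_
  · have h1 := hY X hX
    rw [Real.rpow_zero] at h1
    have : X ^ (-u + ε) ≤ X ^ (-θ/2) := Real.rpow_le_rpow_of_exponent_le hX1 (by linarith)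
    linarith
  · rw [one_div, ← Real.rpow_neg hX0.le]
    exact Real.rpow_le_rpow_of_exponent_le hX1 (by linarith)

lemma goodK_mono {k : ℕ} {um θ um' θ' : ℝ} (h : GoodK k um θ) (h1 : um' ≤ um) (h2 : θ ≤ θ') :
    GoodK k um' θ' := by
  obtain ⟨η, h3, ε, h4, Y, h5, h6⟩ := h
  exact ⟨η, h3, ε, h4, Y, h5, fun X hX u hu hu' => h6 X hX u (h2.trans hu) (hu'.trans h1)⟩

set_option maxHeartbeats 800000 in
lemma goodK_step (k : ℕ) (θ : ℝ) (hθ : 0 < θ) (hP : GoodK k (15/16) (θ/2)) :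
    GoodK (k+1) (9/8) θ := by
  obtain ⟨η₁, hη₁, ε₁, hε₁, Y₁, hY₁, hP⟩ := hP
  set η := min (θ/48) (η₁/8) with hη
  set ε := min ε₁ (min (θ/48) (η₁/8)) with hε
  have e1 : ε ≤ ε₁ := min_le_left _ _
  have e2 : ε ≤ θ/48 := (min_le_right _ _).trans (min_le_left _ _)
  have e3 : ε ≤ η₁/8 := (min_le_right _ _).trans (min_le_right _ _)
  have e4 : η ≤ θ/48 := (min_le_left _ _)
  have e5 : η ≤ η₁/8 := (min_le_right _ _)
  have hη0 : 0 < η := by positivity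
  have hε0 : 0 < ε := by positivity
  obtain ⟨Y₂, hY₂, hY₂'⟩ := ev_pow 32 (2 - θ/8) (2 - 2*η) (by linarith)
  obtain ⟨Y₃, hY₃, hY₃'⟩ := ev_pow 4 (2 - 7*η₁/8) (2 - 2*η) (by linarith)
  refine ⟨η, hη0, ε, hε0, max Y₁ (max Y₂ Y₃), hY₁.trans (le_max_left _ _), ?_⟩
  intro X hX u hu1 hu2 L hL g hd hm
  have hX1 : Y₁ ≤ X := (le_max_left _ _).trans hX
  have hX2 : Y₂ ≤ X := ((le_max_left _ _).trans (le_max_right _ _)).trans hX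
  have hX3 : Y₃ ≤ X := ((le_max_right _ _).trans (le_max_right _ _)).trans hX
  have hXo : 1 ≤ X := hY₁.trans hX1
  have hX0 : 0 < X := by linarith
  have hmon : ∀ {a b : ℝ}, a ≤ b → X ^ a ≤ X ^ b := fun h => Real.rpow_le_rpow_of_exponent_le hXo h
  have hu0 : 0 < u := by linarith
  set H := ⌊X ^ (u/3)⌋₊ with hH
  set h₀ := ⌈X ^ (u/6)⌉₊ with hh₀
  have a1 : 1 ≤ X ^ (u/3) := Real.one_le_rpow hXo (by positivity)
  have a2 : 1 ≤ X ^ (u/6) := Real.one_le_rpow hXo (by positivity)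
  have b1 : (H:ℝ) ≤ X ^ (u/3) := Nat.floor_le (by positivity)
  have b2 : X ^ (u/3) ≤ 2 * H := by
    have := Nat.lt_floor_add_one (X ^ (u/3))
    have h1 : 1 ≤ H := Nat.le_floor (by simpa using a1)
    have h1 : (1:ℝ) ≤ H := by exact_mod_cast h1
    linarith
  have b3 : (h₀:ℝ) ≤ 2 * X ^ (u/6) := by
    have := Nat.ceil_lt_add_one (a := X ^ (u/6)) (by positivity)
    linarith
  have b4 : X ^ (u/6) ≤ h₀ := Nat.le_ceil _
  have hC : ∀ h, h₀ ≤ h → h < H → ‖cor (fun n => ee (g n)) L h‖ ≤ X ^ (1 - η₁) := by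
    intro h hh1 hh2
    rw [cor_ee]
    have c1 : X ^ (u/6) ≤ h := b4.trans (by exact_mod_cast hh1)
    have c2 : (h:ℝ) ≤ X ^ (u/3) := le_trans (by exact_mod_cast hh2.le) b1
    have hh0 : (0:ℝ) < h := by linarith
    have hX1' : 1 < X ∨ X = 1 := by rcases hXo.lt_or_eq with h | h; exact Or.inl h; exact Or.inr h.symm
    rcases hX1' with hX1' | hX1'
    swap
    · exfalso
      rw [hX1'] at c2; simp at c2
      have := hY₂' X hX2
      rw [hX1'] at this; norm_num at this
    set v := Real.logb X h with hv
    have hXv : X ^ v = h := Real.rpow_logb hX0 hX1'.ne' hh0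
    have v1 : u/6 ≤ v := by
      rw [← hXv] at c1; exact (Real.rpow_le_rpow_left_iff hX1').mp c1
    have v2 : v ≤ u/3 := by
      rw [← hXv] at c2; exact (Real.rpow_le_rpow_left_iff hX1').mp c2
    apply hP X hX1 (u - v) (by linarith) (by linarith) (L - h) _ (fun n => g (n+h) - g n)
    · intro n hn
      rw [DD_diff]
      have hd' : ∀ i ∈ range h, X ^ (-u - ε) ≤ DD^[k+1] g (n+i) ∧ DD^[k+1] g (n+i) ≤ X ^ (-u + ε) := by
        intro i hi; apply hd; have := mem_range.mp hi; omega
      constructor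
      · calc X ^ (-(u - v) - ε₁) ≤ X ^ (v + (-u - ε)) := hmon (by linarith)
          _ = ∑ i ∈ range h, X ^ (-u - ε) := by
            rw [Real.rpow_add hX0, hXv]; simp
          _ ≤ _ := sum_le_sum fun i hi => (hd' i hi).1
      · calc _ ≤ ∑ i ∈ range h, X ^ (-u + ε) := sum_le_sum fun i hi => (hd' i hi).2
          _ = X ^ (v + (-u + ε)) := by
            rw [Real.rpow_add hX0 v, hXv]; simp
          _ ≤ _ := hmon (by linarith)
    · rcases hm with hm | hm
      · left; intro n hn
        rw [DD_diff]; apply sum_nonneg; intro i hi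
        apply hm; have := mem_range.mp hi; omega
      · right; intro n hn
        rw [DD_diff]; apply sum_nonpos; intro i hi
        apply hm; have := mem_range.mp hi; omega
    · refine le_trans ?_ (hL.trans (hmon (by linarith)))
      exact_mod_cast Nat.sub_le _ _
  have hV := VDC' (fun n => ee (g n)) (fun n => (ee_norm _).le) L H h₀ (X ^ (1 - η₁)) (by positivity) hC
  have d1 : (L:ℝ) + H ≤ 2 * X ^ (1 + ε) := by
    have : X ^ (u/3) ≤ X ^ (1 + ε) := hmon (by linarith)
    linarith
  have hHpos : (0:ℝ) < H := by linarith
  have d2 : (L + H) * (2 * h₀ * L + H * X ^ (1 - η₁)) ≤ (X ^ (2 - 2*η)) * H := by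
    have f1 : 2 * h₀ * (L:ℝ) ≤ 8 * X ^ (1 + ε - u/6) * H := by
      calc 2 * h₀ * (L:ℝ) ≤ 2 * (2 * X ^ (u/6)) * X ^ (1 + ε) := by gcongr
        _ = 4 * X ^ (1 + ε - u/6) * X ^ (u/3) := by
          rw [mul_assoc, mul_assoc, mul_assoc, ← Real.rpow_add hX0, ← Real.rpow_add hX0]; ring_nf
        _ ≤ 4 * X ^ (1 + ε - u/6) * (2 * H) := by gcongr
        _ = _ := by ring
    calc (L + H) * (2 * h₀ * L + H * X ^ (1 - η₁))
        ≤ (2 * X ^ (1 + ε)) * (8 * X ^ (1 + ε - u/6) * H + H * X ^ (1 - η₁)) := by gcongr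
      _ = (16 * X ^ ((1 + ε) + (1 + ε - u/6)) + 2 * X ^ ((1 + ε) + (1 - η₁))) * H := by
          rw [Real.rpow_add hX0 (1 + ε) (1 + ε - u/6), Real.rpow_add hX0 (1 + ε) (1 - η₁)]; ring
      _ ≤ (X ^ (2 - 2*η)) * H := by
          gcongr
          have g1 : X ^ ((1 + ε) + (1 + ε - u/6)) ≤ X ^ (2 - θ/8) := hmon (by linarith)
          have g2 : X ^ ((1 + ε) + (1 - η₁)) ≤ X ^ (2 - 7*η₁/8) := hmon (by linarith)
          linarith [hY₂' X hX2, hY₃' X hX3]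
  have hfin := le_of_mul_le_mul_right (hV.trans d2) hHpos
  have : X ^ (2 - 2*η) = (X ^ (1 - η))^2 := by
    rw [← Real.rpow_natCast, ← Real.rpow_mul hX0.le]; congr 1; push_cast; ring
  rw [this] at hfin
  exact le_of_sq_le_sq hfin (by positivity)

lemma goodK_P (k : ℕ) : ∀ θ : ℝ, 0 < θ → GoodK (k+1) (15/16) θ := by
  induction k with
  | zero => exact goodK_one
  | succ k ih =>
    intro θ hθ
    exact goodK_mono (goodK_step (k+1) θ hθ (ih _ (by positivity))) (by norm_num) le_rfl

lemma goodK_R (k : ℕ) (θ : ℝ) (hθ : 0 < θ) : GoodK (k+2) (9/8) θ :=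
  goodK_step (k+1) θ hθ (goodK_P k _ (by positivity))


lemma goodK_unif (K : ℕ) : ∃ η : ℝ, 0 < η ∧ ∃ ε : ℝ, 0 < ε ∧ ∃ Y : ℝ, 1 ≤ Y ∧ ∀ k, 2 ≤ k → k ≤ K →
    ∀ X : ℝ, Y ≤ X → ∀ u : ℝ, 1/8 ≤ u → u ≤ 9/8 →
    ∀ L : ℕ, (L : ℝ) ≤ X ^ (1 + ε) → ∀ g : ℕ → ℝ,
      (∀ n < L, X ^ (-u - ε) ≤ DD^[k] g n ∧ DD^[k] g n ≤ X ^ (-u + ε)) →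
      ((∀ n < L, 0 ≤ DD^[k+1] g n) ∨ (∀ n < L, DD^[k+1] g n ≤ 0)) →
      ‖∑ n ∈ range L, ee (g n)‖ ≤ X ^ (1 - η) := by
  induction K with
  | zero => exact ⟨1, one_pos, 1, one_pos, 1, le_rfl, fun k h1 h2 => by omega⟩
  | succ K ih =>
    obtain ⟨η, hη, ε, hε, Y, hY, ih⟩ := ih
    obtain ⟨η', hη', ε', hε', Y', hY', h'⟩ := goodK_R (K+1-2) (1/8) (by norm_num)
    refine ⟨min η η', lt_min hη hη', min ε ε', lt_min hε hε', max Y Y', hY.trans (le_max_left _ _), ?_⟩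
    intro k h1 h2 X hX u hu1 hu2 L hL g hd hm
    have hX1 : 1 ≤ X := (hY.trans (le_max_left _ _)).trans hX
    have hmon : ∀ {a b : ℝ}, a ≤ b → X ^ a ≤ X ^ b := fun h => Real.rpow_le_rpow_of_exponent_le hX1 h
    have m1 := min_le_left ε ε'
    have m2 := min_le_right ε ε'
    have m3 := min_le_left η η'
    have m4 := min_le_right η η'
    rcases Nat.lt_or_ge k (K+1) with hk | hk
    · refine (ih k h1 (by omega) X ((le_max_left _ _).trans hX) u hu1 hu2 L (hL.trans (hmon (by linarith))) g
        (fun n hn => ⟨(hmon (by linarith)).trans (hd n hn).1, (hd n hn).2.trans (hmon (by linarith))⟩) hm).trans (hmon (by linarith))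
    · have : k = K+1-2+2 := by omega
      rw [this] at hd hm
      refine (h' X ((le_max_right _ _).trans hX) u hu1 hu2 L (hL.trans (hmon (by linarith))) g
        (fun n hn => ⟨(hmon (by linarith)).trans (hd n hn).1, (hd n hn).2.trans (hmon (by linarith))⟩) hm).trans (hmon (by linarith))

lemma norm_sum_neg (g : ℕ → ℝ) (L : ℕ) : ‖∑ n ∈ range L, ee (-(g n))‖ = ‖∑ n ∈ range L, ee (g n)‖ := by
  rw [← Complex.norm_conj, map_sum]; simp [ee_conj]

lemma norm_sum_sign (g : ℕ → ℝ) (L : ℕ) (σ : ℝ) (hσ : σ = 1 ∨ σ = -1) :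
    ‖∑ n ∈ range L, ee (σ * g n)‖ = ‖∑ n ∈ range L, ee (g n)‖ := by
  rcases hσ with rfl | rfl
  · simp
  · simp only [neg_mul, one_mul]; exact norm_sum_neg g L

def Dat (c : ℝ) (J : ℕ) (ε X : ℝ) (L : ℕ) (φ : ℕ → ℝ) : Prop :=
  (L:ℝ) ≤ X ^ (1 + ε) ∧ ∀ k ≤ J, ∃ σ : ℝ, (σ = 1 ∨ σ = -1) ∧ ∀ n < L,
    X ^ (c - k - ε) ≤ σ * DD^[k] φ n ∧ σ * DD^[k] φ n ≤ X ^ (c - k + ε)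

lemma Dat_sign {c : ℝ} {J : ℕ} {ε X : ℝ} {L : ℕ} {φ : ℕ → ℝ} (hX : 0 < X) (h : Dat c J ε X L φ)
    (k : ℕ) (hk : k ≤ J) (a : ℝ) :
    (∀ n < L, 0 ≤ DD^[k] (fun n => a * φ n) n) ∨ (∀ n < L, DD^[k] (fun n => a * φ n) n ≤ 0) := by
  obtain ⟨σ, hσ, h⟩ := h.2 k hk
  have h' : ∀ n < L, 0 ≤ σ * DD^[k] φ n := fun n hn => le_trans (by positivity) (h n hn).1
  simp only [DD_smul]
  rcases hσ with rfl | rfl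
  · simp only [one_mul] at h'
    rcases le_total 0 a with ha | ha
    · left; intro n hn; exact mul_nonneg ha (h' n hn)
    · right; intro n hn; exact mul_nonpos_of_nonpos_of_nonneg ha (h' n hn)
  · simp only [neg_mul, one_mul, Left.nonneg_neg_iff] at h'
    rcases le_total 0 a with ha | ha
    · right; intro n hn; exact mul_nonpos_of_nonneg_of_nonpos ha (h' n hn)
    · left; intro n hn; exact mul_nonneg_of_nonpos_of_nonpos ha (h' n hn)

set_option maxHeartbeats 800000 in
lemma lemT (c : ℝ) (hc : 1 ≤ c) : ∃ J : ℕ, ∃ η : ℝ, 0 < η ∧ η ≤ 1 ∧ ∀ ε' : ℝ, 0 < ε' →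
    ∃ ε : ℝ, 0 < ε ∧ ε ≤ ε' ∧ ∃ Y : ℝ, 1 ≤ Y ∧ ∀ X : ℝ, Y ≤ X → ∀ (L : ℕ) (φ : ℕ → ℝ),
      Dat c J ε X L φ → ∀ r : ℝ, 1 ≤ r → r ≤ X ^ (c + 1) →
        ‖∑ n ∈ range L, ee (r / (4 * X ^ c) * φ n)‖ ≤ X ^ (1 + ε') * r ^ (-η) := by
  obtain ⟨η₁, hη₁, ε₁, hε₁, Y₁, hY₁, hG⟩ := goodK_unif (⌈c⌉₊ + 4)
  refine ⟨⌈c⌉₊ + 5, min 1 (η₁ / (c+1)), by positivity, min_le_left _ _, ?_⟩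
  intro ε' hε'
  set η := min 1 (η₁ / (c+1)) with hη
  have hη1 : η ≤ 1 := min_le_left _ _
  have hη2 : (c+1) * η ≤ η₁ := by
    have : η ≤ η₁ / (c+1) := min_le_right _ _
    rw [le_div_iff₀ (by linarith)] at this; linarith
  have hη0 : 0 < η := by positivity
  set ε := min (ε₁/2) (min (ε'/8) (1/16)) with hε
  have e1 : ε ≤ ε₁/2 := min_le_left _ _
  have e2 : ε ≤ ε'/8 := (min_le_right _ _).trans (min_le_left _ _)
  have e3 : ε ≤ 1/16 := (min_le_right _ _).trans (min_le_right _ _)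
  have hε0 : 0 < ε := by positivity
  obtain ⟨Y₂, hY₂, hY₂'⟩ := ev_pow 4 0 ε hε0
  refine ⟨ε, hε0, by linarith, max Y₁ Y₂, hY₁.trans (le_max_left _ _), ?_⟩
  intro X hX L φ hD r hr1 hr2
  have hX1 : Y₁ ≤ X := (le_max_left _ _).trans hX
  have hX2 : Y₂ ≤ X := (le_max_right _ _).trans hX
  have hXo : 1 ≤ X := hY₁.trans hX1
  have hX0 : 0 < X := by linarith
  have hr0 : 0 < r := by linarith
  have hmon : ∀ {a b : ℝ}, a ≤ b → X ^ a ≤ X ^ b := fun h => Real.rpow_le_rpow_of_exponent_le hXo h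
  have hX4 : 4 ≤ X ^ ε := by have := hY₂' X hX2; simpa using this
  have hXgt : 1 < X := by
    rcases hXo.lt_or_eq with h | h
    · exact h
    · rw [← h] at hX4; norm_num at hX4
  have hXc : 0 < X ^ c := by positivity
  have hβ : 0 < r / (4 * X ^ c) := by positivity
  rcases le_or_gt r (X ^ (7/8:ℝ)) with hr | hr
  · obtain ⟨σ, hσ, hd⟩ := hD.2 1 (by omega)
    rw [← norm_sum_sign _ L σ hσ]
    have hrw : ∀ n, σ * (r / (4 * X ^ c) * φ n) = (σ * (r / (4 * X ^ c))) * φ n := fun n => by ring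
    simp_rw [hrw]
    have hlow : 0 < r / 4 * X ^ (-1 - ε) := by positivity
    refine (KL_DD (fun n => (σ * (r / (4 * X ^ c))) * φ n) L _ hlow ?_ (Dat_sign hX0 hD 2 (by omega) _)).trans ?_
    · intro n hn
      obtain ⟨h1, h2⟩ := hd n hn
      rw [DD_smul]
      have e : σ * (r / (4 * X ^ c)) * DD^[1] φ n = (r / (4 * X ^ c)) * (σ * DD^[1] φ n) := by ring
      rw [e]
      constructor
      · calc r / 4 * X ^ (-1 - ε) = r / (4 * X ^ c) * X ^ (c - (1:ℕ) - ε) := by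
              rw [show c - (1:ℕ) - ε = c + (-1 - ε) by push_cast; ring, Real.rpow_add hX0]
              field_simp
          _ ≤ _ := by gcongr
      · calc _ ≤ r / (4 * X ^ c) * X ^ (c - (1:ℕ) + ε) := by gcongr
          _ = r * X ^ (-1 + ε) / 4 := by
              rw [show c - (1:ℕ) + ε = c + (-1 + ε) by push_cast; ring, Real.rpow_add hX0]
              field_simp
          _ ≤ X ^ (7/8:ℝ) * X ^ (-1 + ε) / 4 := by gcongr
          _ = X ^ (7/8 + (-1 + ε)) / 4 := by rw [← Real.rpow_add hX0]
          _ ≤ X ^ (0:ℝ) / 4 := by gcongr; linarith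
          _ ≤ 1/2 := by norm_num
    · have : 1 / (r / 4 * X ^ (-1 - ε)) = 4 * X ^ (1 + ε) * r ^ (-1 : ℝ) := by
        rw [show -1 - ε = -(1 + ε) by ring, Real.rpow_neg hX0.le, Real.rpow_neg_one]; field_simp
      rw [this]
      apply mul_le_mul _ _ (by positivity) (by positivity)
      · calc 4 * X ^ (1 + ε) ≤ X ^ ε * X ^ (1 + ε) := by gcongr
          _ = X ^ (ε + (1 + ε)) := by rw [← Real.rpow_add hX0]
          _ ≤ _ := hmon (by linarith)
      · exact Real.rpow_le_rpow_of_exponent_le hr1 (by linarith)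
  · set b := Real.logb X r with hb
    have hXb : X ^ b = r := Real.rpow_logb hX0 hXgt.ne' hr0
    have b1 : 7/8 < b := by rw [← hXb] at hr; exact (Real.rpow_lt_rpow_left_iff hXgt).mp hr
    have b2 : b ≤ c + 1 := by rw [← hXb] at hr2; exact (Real.rpow_le_rpow_left_iff hXgt).mp hr2
    set k := ⌈b + 1/8⌉₊ with hk
    have k1 : b + 1/8 ≤ k := Nat.le_ceil _
    have k2 : (k:ℝ) < b + 1/8 + 1 := Nat.ceil_lt_add_one (by linarith)
    have k3 : 2 ≤ k := by
      have : (1:ℝ) < k := by linarith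
      exact_mod_cast this
    have k4 : k ≤ ⌈c⌉₊ + 4 := by
      have : (k:ℝ) ≤ ⌈c⌉₊ + 4 := by linarith [Nat.le_ceil c]
      exact_mod_cast this
    obtain ⟨σ, hσ, hd⟩ := hD.2 k (by omega)
    rw [← norm_sum_sign _ L σ hσ]
    have hrw : ∀ n, σ * (r / (4 * X ^ c) * φ n) = (σ * (r / (4 * X ^ c))) * φ n := fun n => by ring
    simp_rw [hrw]
    have hfin := hG k k3 k4 X hX1 (k - b) (by linarith) (by linarith) L (hD.1.trans (hmon (by linarith)))
      (fun n => (σ * (r / (4 * X ^ c))) * φ n) ?_ (Dat_sign hX0 hD (k+1) (by omega) _)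
    · refine hfin.trans ?_
      have : X ^ (-η₁) ≤ r ^ (-η) := by
        rw [← hXb, ← Real.rpow_mul hX0.le]
        apply hmon
        nlinarith
      calc X ^ (1 - η₁) = X ^ (1:ℝ) * X ^ (-η₁) := by rw [← Real.rpow_add hX0]; rfl
        _ ≤ _ := by
          apply mul_le_mul (hmon (by linarith)) this (by positivity) (by positivity)
    · intro n hn
      obtain ⟨h1, h2⟩ := hd n hn
      rw [DD_smul]
      have e : σ * (r / (4 * X ^ c)) * DD^[k] φ n = (r / (4 * X ^ c)) * (σ * DD^[k] φ n) := by ring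
      rw [e]
      have key : ∀ t : ℝ, r / (4 * X ^ c) * X ^ (c - k + t) = X ^ (b - k + t) / 4 := by
        intro t
        rw [show c - k + t = c + (-k + t) by ring, show b - k + t = b + (-k + t) by ring,
          Real.rpow_add hX0, Real.rpow_add hX0 b, hXb]
        field_simp
      constructor
      · calc X ^ (-(k - b) - ε₁) ≤ X ^ ((b - k + -ε) - ε) := hmon (by linarith)
          _ = X ^ (b - k + -ε) / X ^ ε := by rw [Real.rpow_sub hX0]
          _ ≤ X ^ (b - k + -ε) / 4 := by gcongr
          _ = r / (4 * X ^ c) * X ^ (c - k + -ε) := (key _).symm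
          _ ≤ _ := by gcongr; exact h1
      · calc _ ≤ r / (4 * X ^ c) * X ^ (c - k + ε) := by gcongr
          _ = X ^ (b - k + ε) / 4 := key _
          _ ≤ X ^ (b - k + ε) := by
            have : 0 < X ^ (b - k + ε) := by positivity
            linarith
          _ ≤ _ := hmon (by linarith)

noncomputable def dk (M : ℕ) (t : ℝ) : ℂ := ∑ a ∈ range M, ee (a * t)

lemma dk_sq (M : ℕ) (t : ℝ) : ((‖dk M t‖ ^ 2 : ℝ) : ℂ) =
    ∑ a ∈ range M, ∑ b ∈ range M, ee (((a:ℝ) - b) * t) := by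
  push_cast
  rw [← Complex.mul_conj', dk, map_sum, sum_mul_sum]
  refine sum_congr rfl fun a _ => sum_congr rfl fun b _ => ?_
  rw [ee_conj, ← ee_add]; congr 1; ring

lemma dk_sub_int (M : ℕ) (t : ℝ) (z : ℤ) : dk M (t + z) = dk M t := by
  unfold dk; apply sum_congr rfl; intro a _
  rw [mul_add, ee_add]
  have : ee ((a:ℝ) * z) = 1 := by
    have := ee_int (a * z); push_cast at this; exact this
  rw [this, mul_one]

lemma dk_geom (M : ℕ) (t : ℝ) : dk M t * (ee t - 1) = ee (M * t) - 1 := by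
  induction M with
  | zero => simp [dk, ee_zero]
  | succ M ih =>
    have : dk (M+1) t = dk M t + ee (M * t) := by simp [dk, sum_range_succ]
    rw [this, add_mul, ih]; push_cast; rw [add_mul, ee_add]; rw [one_mul]; ring

lemma ee_neg_sub_one (t : ℝ) : ‖ee (-t) - 1‖ = ‖ee t - 1‖ := by
  rw [← ee_conj, ← Complex.norm_conj]; simp

lemma ee_far (t ρ : ℝ) (h1 : ρ ≤ |t|) (h2 : |t| ≤ 1 - ρ) : 4 * ρ ≤ ‖ee t - 1‖ := by
  rcases le_or_gt ρ 0 with hρ | hρ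
  · linarith [norm_nonneg (ee t - 1)]
  have key : ∀ s, 0 ≤ s → ρ ≤ s → s ≤ 1 - ρ → 4 * ρ ≤ ‖ee s - 1‖ := by
    intro s h0 h1 h2
    rcases le_total s (1/2) with h | h
    · have := ee_sub_one_ge s h0 h; linarith
    · have e : ee s = ee (-(1 - s)) := by
        have := ee_int 1
        rw [show s = -(1 - s) + ((1:ℤ):ℝ) by push_cast; ring, ee_add, this]; simp
      rw [e, ee_neg_sub_one]
      have := ee_sub_one_ge (1 - s) (by linarith) (by linarith)
      linarith
  rcases abs_cases t with ⟨h, h'⟩ | ⟨h, h'⟩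
  · rw [h] at h1 h2; exact key t h' h1 h2
  · rw [h] at h1 h2; rw [← ee_neg_sub_one]; exact key (-t) (by linarith) h1 h2

lemma dk_far (M : ℕ) (t ρ : ℝ) (hρ : 0 < ρ) (h1 : ρ ≤ |t|) (h2 : |t| ≤ 1 - ρ) :
    ‖dk M t‖ ≤ 1 / (2 * ρ) := by
  have h3 := ee_far t ρ h1 h2
  have h4 := congrArg norm (dk_geom M t)
  rw [norm_mul] at h4
  have h5 : ‖ee (M * t) - 1‖ ≤ 2 := by
    refine (norm_sub_le _ _).trans ?_
    rw [ee_norm, norm_one]; norm_num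
  rw [le_div_iff₀ (by positivity)]
  have : ‖dk M t‖ * (4 * ρ) ≤ 2 := by
    calc _ ≤ ‖dk M t‖ * ‖ee t - 1‖ := by gcongr
      _ ≤ 2 := by rw [h4]; exact h5
  linarith

lemma dk_near (m : ℕ) (t : ℝ) (h1 : |t| * (8 * m) ≤ 1) : (m:ℝ)/2 ≤ ‖dk m t‖ := by
  have h2 : (dk m t).re = ∑ a ∈ range m, Real.cos (2 * Real.pi * (a * t)) := by
    unfold dk; rw [Complex.re_sum]; apply sum_congr rfl; intro a _
    unfold ee; rw [Complex.exp_ofReal_mul_I_re]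
  refine le_trans ?_ (Complex.re_le_norm _)
  rw [h2]
  calc (m:ℝ)/2 = ∑ a ∈ range m, (1/2:ℝ) := by simp; ring
    _ ≤ _ := by
      apply sum_le_sum; intro a ha
      have ha' : (a:ℝ) ≤ m := by exact_mod_cast (mem_range.mp ha).le
      refine le_trans ?_ (Real.one_sub_sq_div_two_le_cos)
      have h3 : |a * t| ≤ 1/8 := by
        rw [abs_mul, abs_of_nonneg (by positivity : (0:ℝ) ≤ a)]
        have : a * |t| ≤ m * |t| := by gcongr
        linarith
      have h4 : (a * t)^2 ≤ (1/8)^2 := by rw [← sq_abs]; gcongr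
      have h5 : Real.pi ^ 2 ≤ 4^2 := by
        have := Real.pi_lt_four
        have := Real.pi_pos
        gcongr
      have : (2 * Real.pi * (a * t))^2 = 4 * (Real.pi^2 * (a*t)^2) := by ring
      rw [this]
      have : Real.pi^2 * (a*t)^2 ≤ 4^2 * (1/8)^2 := by gcongr
      linarith

lemma sum_ee_roots (M : ℕ) (a b : ℕ) (ha : a < M) (hb : b < M) :
    ∑ j ∈ range M, ee (((a:ℝ) - b) * (-(j:ℝ)/M)) = if a = b then (M:ℂ) else 0 := by
  have hM : (0:ℝ) < M := by exact_mod_cast (Nat.zero_le a).trans_lt ha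
  have e : ∑ j ∈ range M, ee (((a:ℝ) - b) * (-(j:ℝ)/M)) = dk M (((b:ℝ) - a)/M) := by
    unfold dk; apply sum_congr rfl; intro j _; congr 1; ring
  rw [e]
  split_ifs with h
  · subst h; simp [dk, ee_zero]
  · have h1 := dk_geom M (((b:ℝ) - a)/M)
    have h2 : ee (M * (((b:ℝ) - a)/M)) = 1 := by
      have := ee_int ((b:ℤ) - a)
      push_cast at this
      rw [← this]; congr 1; field_simp
    rw [h2, sub_self] at h1
    rcases mul_eq_zero.mp h1 with h3 | h3
    · exact h3
    · exfalso
      have hab : (1:ℝ) ≤ |(b:ℝ) - a| := by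
        have : (1:ℤ) ≤ |(b:ℤ) - a| := Int.one_le_abs (by omega)
        exact_mod_cast this
      have hab2 : |(b:ℝ) - a| ≤ M - 1 := by
        have : |(b:ℤ) - a| ≤ M - 1 := by rw [abs_le]; omega
        exact_mod_cast this
      have := ee_far (((b:ℝ) - a)/M) (1/M) (by rw [abs_div, abs_of_pos hM]; gcongr) (by
        rw [abs_div, abs_of_pos hM, div_le_iff₀ hM]; field_simp; linarith)
      rw [h3, norm_zero] at this
      have : 0 < 1/(M:ℝ) := by positivity
      linarith

noncomputable def ww (M j : ℕ) (y : ℝ) : ℝ := ‖dk M (y + -(j:ℝ)/M)‖ ^ 2 / M ^ 2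

lemma ww_sum (M : ℕ) (hM : 0 < M) (y : ℝ) : ∑ j ∈ range M, ww M j y = 1 := by
  have h : ((∑ j ∈ range M, ‖dk M (y + -(j:ℝ)/M)‖ ^ 2 : ℝ) : ℂ) = ((M:ℝ)^2 : ℝ) := by
    rw [Complex.ofReal_sum]
    simp_rw [dk_sq, mul_add, ee_add]
    rw [sum_comm]
    calc _ = ∑ a ∈ range M, ∑ b ∈ range M, ee (((a:ℝ) - b) * y) * (if a = b then (M:ℂ) else 0) := by
          refine sum_congr rfl fun a ha => ?_
          rw [sum_comm]
          refine sum_congr rfl fun b hb => ?_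
          rw [← mul_sum, sum_ee_roots M a b (mem_range.mp ha) (mem_range.mp hb)]
      _ = ∑ a ∈ range M, (M:ℂ) := by
          refine sum_congr rfl fun a ha => ?_
          simp only [mul_ite, mul_zero, sum_ite_eq, ha, if_true, sub_self, zero_mul, ee_zero, one_mul]
      _ = _ := by simp [sq]
  have h' := Complex.ofReal_injective h
  unfold ww
  rw [← sum_div, h']
  field_simp

lemma point_err (m : ℕ) (hm : 0 < m) (α : ℝ) (hα : |α| ≤ 1/2) (y : ℝ) :
    ‖ee (-(α * Int.fract y)) - ∑ j ∈ range (m^3), (ww (m^3) j y : ℂ) * ee (-(α * ((j:ℝ)/(m^3:ℕ))))‖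
      ≤ 33 / m + 8 * ‖dk m y‖^2 / m^2 := by
  have hM : 0 < m^3 := by positivity
  have hmr : (0:ℝ) < m := by exact_mod_cast hm
  have hm1 : (1:ℝ) ≤ m := by exact_mod_cast hm
  set M := m^3 with hMdef
  have hMr : (M:ℝ) = (m:ℝ)^3 := by rw [hMdef]; push_cast; ring
  have hMpos : (0:ℝ) < M := by exact_mod_cast hM
  set x := Int.fract y with hx
  have hx0 : 0 ≤ x := Int.fract_nonneg y
  have hx1 : x < 1 := Int.fract_lt_one y
  have hyx : y = x + ⌊y⌋ := (Int.fract_add_floor y).symm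
  have hw0 : ∀ j, 0 ≤ ww M j y := fun j => by unfold ww; positivity
  have s1 : ee (-(α * x)) = ∑ j ∈ range M, (ww M j y : ℂ) * ee (-(α * x)) := by
    rw [← sum_mul, ← Complex.ofReal_sum, ww_sum M hM]; simp
  have s2 : ‖ee (-(α * x)) - ∑ j ∈ range M, (ww M j y : ℂ) * ee (-(α * ((j:ℝ)/M)))‖ ≤
      ∑ j ∈ range M, ww M j y * ‖ee (-(α * x)) - ee (-(α * ((j:ℝ)/M)))‖ := by
    rw [s1, ← sum_sub_distrib]
    refine (norm_sum_le _ _).trans (sum_le_sum fun j _ => ?_)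
    rw [← mul_sub, norm_mul, Complex.norm_real, Real.norm_of_nonneg (hw0 j), ← s1]
  have n2 : ∀ j : ℕ, ‖ee (-(α * x)) - ee (-(α * ((j:ℝ)/M)))‖ ≤ 2 := by
    intro j; refine (norm_sub_le _ _).trans ?_; rw [ee_norm, ee_norm]; norm_num
  refine s2.trans ?_
  by_cases hg : 1/(8*m:ℝ) ≤ x ∧ x ≤ 1 - 1/(8*m:ℝ)
  · obtain ⟨g1, g2⟩ := hg
    set ρ := 1/(8*m:ℝ) with hρ
    have hρ0 : 0 < ρ := by positivity
    have hterm : ∀ j ∈ range M, ww M j y * ‖ee (-(α * x)) - ee (-(α * ((j:ℝ)/M)))‖ ≤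
        ww M j y * (Real.pi * ρ) + 2 * ((1/(2*ρ))^2 / M^2) := by
      intro j hj
      have hj' : (j:ℝ) < M := by exact_mod_cast mem_range.mp hj
      have j0 : 0 ≤ (j:ℝ)/M := by positivity
      have j1 : (j:ℝ)/M < 1 := by rw [div_lt_one hMpos]; exact hj'
      rcases le_or_gt |x - (j:ℝ)/M| ρ with h | h
      · have : ‖ee (-(α * x)) - ee (-(α * ((j:ℝ)/M)))‖ ≤ Real.pi * ρ := by
          refine (ee_sub_le _ _).trans ?_
          rw [show -(α * x) - -(α * ((j:ℝ)/M)) = -(α * (x - (j:ℝ)/M)) by ring, abs_neg, abs_mul]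
          have : |α| * |x - (j:ℝ)/M| ≤ 1/2 * ρ := by gcongr
          nlinarith [Real.pi_pos]
        have := mul_le_mul_of_nonneg_left this (hw0 j)
        have : 0 ≤ 2 * ((1/(2*ρ))^2 / (M:ℝ)^2) := by positivity
        linarith
      · have hw : ww M j y ≤ (1/(2*ρ))^2 / M^2 := by
          unfold ww
          have e : y + -(j:ℝ)/M = (x - (j:ℝ)/M) + (⌊y⌋ : ℤ) := by
            nth_rewrite 1 [hyx]; ring
          rw [e, dk_sub_int]
          have := dk_far M (x - (j:ℝ)/M) ρ hρ0 h.le (by rw [abs_le]; constructor <;> linarith)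
          gcongr
        have := mul_le_mul hw (n2 j) (norm_nonneg _) (by positivity)
        have h0 : 0 ≤ ww M j y * (Real.pi * ρ) := mul_nonneg (hw0 j) (by positivity)
        linarith
    refine (sum_le_sum hterm).trans ?_
    rw [sum_add_distrib, ← sum_mul, ww_sum M hM, one_mul, sum_const, card_range, nsmul_eq_mul]
    have e : (M:ℝ) * (2 * ((1/(2*ρ))^2 / M^2)) = 32 / m := by
      rw [hρ, hMr]; field_simp; norm_num
    rw [e, hρ]
    have e2 : Real.pi * (1/(8*m)) ≤ 1/m := by
      rw [mul_one_div, div_le_div_iff₀ (by positivity) hmr]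
      nlinarith [Real.pi_lt_four]
    have : 0 ≤ 8 * ‖dk m y‖^2 / m^2 := by positivity
    have : (33:ℝ)/m = 1/m + 32/m := by ring
    linarith
  · have hnear : (m:ℝ)/2 ≤ ‖dk m y‖ := by
      rw [not_and_or] at hg
      rcases hg with hg | hg
      · push Not at hg
        rw [hyx, dk_sub_int]
        apply dk_near
        rw [abs_of_nonneg hx0]
        rw [lt_div_iff₀ (by positivity)] at hg; exact hg.le
      · push Not at hg
        have e : y = (x - 1) + ((⌊y⌋ + 1 : ℤ) : ℝ) := by push_cast; linarith
        rw [e, dk_sub_int]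
        apply dk_near
        rw [abs_of_nonpos (by linarith)]
        have : 1 - x < 1/(8*m:ℝ) := by linarith
        rw [lt_div_iff₀ (by positivity)] at this; linarith
    have h2 : ∑ j ∈ range M, ww M j y * ‖ee (-(α * x)) - ee (-(α * ((j:ℝ)/M)))‖ ≤ 2 := by
      calc _ ≤ ∑ j ∈ range M, ww M j y * 2 := sum_le_sum fun j _ => mul_le_mul_of_nonneg_left (n2 j) (hw0 j)
        _ = 2 := by rw [← sum_mul, ww_sum M hM]; norm_num
    refine h2.trans ?_
    have h3 : (2:ℝ) ≤ 8 * ‖dk m y‖^2 / m^2 := by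
      rw [le_div_iff₀ (by positivity)]
      have : ((m:ℝ)/2)^2 ≤ ‖dk m y‖^2 := by gcongr
      linarith
    have : 0 ≤ (33:ℝ)/m := by positivity
    linarith

lemma floorLem (L : ℕ) (y : ℕ → ℝ) (α : ℝ) (hα : |α| ≤ 1/2) (m : ℕ) (hm : 0 < m) (B : ℝ) (hB : 0 ≤ B)
    (h1 : ∀ h : ℤ, |h| < (m^3 : ℕ) → ‖∑ n ∈ range L, ee ((α + h) * y n)‖ ≤ B)
    (h2 : ∀ h : ℤ, h ≠ 0 → |h| < m → ‖∑ n ∈ range L, ee (h * y n)‖ ≤ B) :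
    ‖∑ n ∈ range L, ee (α * ⌊y n⌋)‖ ≤ 41 * L / m + (m^3 + 8) * B := by
  have hmr : (0:ℝ) < m := by exact_mod_cast hm
  have hM : 0 < m^3 := by positivity
  have hMr : ((m^3:ℕ):ℝ) = (m:ℝ)^3 := by push_cast; ring
  set W : ℝ → ℂ := fun t => ∑ j ∈ range (m^3), (ww (m^3) j t : ℂ) * ee (-(α * ((j:ℝ)/(m^3:ℕ)))) with hW
  have e1 : ∀ n, ee (α * ⌊y n⌋) = ee (α * y n) * (ee (-(α * Int.fract (y n))) - W (y n)) + ee (α * y n) * W (y n) := by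
    intro n
    have : α * ⌊y n⌋ = α * y n + -(α * Int.fract (y n)) := by
      rw [← Int.self_sub_floor]; ring
    rw [this, ee_add]; ring
  have e2 : ∑ n ∈ range L, ‖dk m (y n)‖^2 ≤ m * L + m^2 * B := by
    have : ∑ n ∈ range L, ‖dk m (y n)‖^2 = ‖((∑ n ∈ range L, ‖dk m (y n)‖^2 : ℝ) : ℂ)‖ := by
      rw [Complex.norm_real, Real.norm_of_nonneg]; exact sum_nonneg fun _ _ => by positivity
    rw [this, Complex.ofReal_sum]
    simp_rw [dk_sq]
    rw [sum_comm]
    have step : ∀ a ∈ range m, ‖∑ n ∈ range L, ∑ b ∈ range m, ee (((a:ℝ) - b) * y n)‖ ≤ L + m * B := by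
      intro a ha
      rw [sum_comm]
      refine (norm_sum_le _ _).trans ?_
      calc _ ≤ ∑ b ∈ range m, ((if a = b then (L:ℝ) else 0) + B) := by
            apply sum_le_sum; intro b hb
            split_ifs with hab
            · subst hab
              simp only [sub_self, zero_mul, ee_zero, sum_const, card_range, nsmul_eq_mul, mul_one, Complex.norm_natCast]
              linarith
            · rw [zero_add]
              have := h2 ((a:ℤ) - b) (by omega) (by
                have := mem_range.mp ha; have := mem_range.mp hb
                rw [abs_lt]; omega)
              push_cast at this; exact this
        _ = _ := by
            rw [sum_add_distrib, sum_ite_eq, if_pos ha]; simp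
    refine (norm_sum_le _ _).trans ((sum_le_sum step).trans ?_)
    rw [sum_const, card_range, nsmul_eq_mul]; apply le_of_eq; ring
  have e3 : ‖∑ n ∈ range L, ee (α * y n) * (ee (-(α * Int.fract (y n))) - W (y n))‖ ≤ 41 * L / m + 8 * B := by
    refine (norm_sum_le _ _).trans ?_
    calc _ ≤ ∑ n ∈ range L, (33 / m + 8 * ‖dk m (y n)‖^2 / m^2) := by
          apply sum_le_sum; intro n _
          rw [norm_mul, ee_norm, one_mul]
          exact point_err m hm α hα (y n)
      _ = L * (33 / m) + 8 / m^2 * ∑ n ∈ range L, ‖dk m (y n)‖^2 := by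
          rw [sum_add_distrib, sum_const, card_range, nsmul_eq_mul, mul_sum]
          congr 1; apply sum_congr rfl; intros; ring
      _ ≤ L * (33 / m) + 8 / m^2 * (m * L + m^2 * B) := by gcongr
      _ = _ := by field_simp; ring
  have e4 : ‖∑ n ∈ range L, ee (α * y n) * W (y n)‖ ≤ m^3 * B := by
    have : ∑ n ∈ range L, ee (α * y n) * W (y n) = ∑ j ∈ range (m^3), ee (-(α * ((j:ℝ)/(m^3:ℕ)))) *
        ((((m^3:ℕ):ℝ)^2 : ℝ) : ℂ)⁻¹ * ∑ a ∈ range (m^3), ∑ b ∈ range (m^3),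
          ee (((a:ℝ) - b) * (-(j:ℝ)/(m^3:ℕ))) * ∑ n ∈ range L, ee ((α + ((a:ℤ) - b : ℤ)) * y n) := by
      simp only [hW, mul_sum]
      rw [sum_comm]
      refine sum_congr rfl fun j _ => ?_
      have swap : ∀ T : ℕ → ℕ → ℕ → ℂ, ∑ a ∈ range (m^3), ∑ b ∈ range (m^3), ∑ n ∈ range L, T a b n =
          ∑ n ∈ range L, ∑ a ∈ range (m^3), ∑ b ∈ range (m^3), T a b n := by
        intro T
        rw [sum_comm (s := range L)]
        refine sum_congr rfl fun a _ => sum_comm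
      rw [swap]
      refine sum_congr rfl fun n _ => ?_
      unfold ww
      rw [Complex.ofReal_div, dk_sq, div_eq_mul_inv, sum_mul, sum_mul, mul_sum]
      refine sum_congr rfl fun a _ => ?_
      rw [sum_mul, sum_mul, mul_sum]
      refine sum_congr rfl fun b _ => ?_
      rw [mul_add, ee_add]
      have : (α + ((a:ℤ) - b : ℤ)) * y n = α * y n + ((a:ℝ) - b) * y n := by push_cast; ring
      rw [this, ee_add]
      push_cast
      ring
    rw [this]
    refine (norm_sum_le _ _).trans ?_
    calc _ ≤ ∑ j ∈ range (m^3), B := by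
          apply sum_le_sum; intro j _
          rw [norm_mul, norm_mul, ee_norm, one_mul, norm_inv, Complex.norm_real, Real.norm_of_nonneg (by positivity)]
          rw [inv_mul_le_iff₀ (by rw [hMr]; positivity)]
          refine (norm_sum_le _ _).trans ?_
          calc _ ≤ ∑ a ∈ range (m^3), ∑ b ∈ range (m^3), B := by
                apply sum_le_sum; intro a ha
                refine (norm_sum_le _ _).trans (sum_le_sum fun b hb => ?_)
                rw [norm_mul, ee_norm, one_mul]
                apply h1
                have := mem_range.mp ha; have := mem_range.mp hb
                rw [abs_lt]; omega
            _ = _ := by simp; ring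
      _ = _ := by simp
  simp_rw [e1]
  rw [sum_add_distrib]
  refine (norm_add_le _ _).trans ?_
  linarith

set_option maxHeartbeats 800000 in
lemma lemS (c : ℝ) (hc : 1 ≤ c) : ∃ J : ℕ, ∃ η : ℝ, 0 < η ∧ ∀ ε' : ℝ, 0 < ε' →
    ∃ ε : ℝ, 0 < ε ∧ ε ≤ ε' ∧ ∃ Y : ℝ, 1 ≤ Y ∧ ∀ X : ℝ, Y ≤ X → ∀ (L : ℕ) (φ : ℕ → ℝ),
      Dat c J ε X L φ → ∀ r : ℝ, 1 ≤ r → r ≤ 2 * X ^ c →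
        ‖∑ n ∈ range L, ee (r / (4 * X ^ c) * ⌊φ n⌋)‖ ≤ X ^ (1 + ε') * r ^ (-η) := by
  obtain ⟨J, η, hη0, hη1, hT⟩ := lemT c hc
  refine ⟨J, η/(32*c), by positivity, ?_⟩
  set η' := η/(32*c) with hη'
  have hη'0 : 0 < η' := by positivity
  have hη'1 : η' ≤ η := by
    rw [hη', div_le_iff₀ (by positivity)]; nlinarith
  have hη'2 : 2 * c * η' = η/16 := by rw [hη']; field_simp; norm_num
  intro ε' hε'
  obtain ⟨ε, hε0, hε1, Y₁, hY₁, hT⟩ := hT (ε'/4) (by positivity)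
  obtain ⟨Y₂, hY₂, hY₂'⟩ := ev_pow 100 0 (ε'/4) (by positivity)
  obtain ⟨Y₃, hY₃, hY₃'⟩ := ev_pow 6 0 (1/2) (by positivity)
  refine ⟨ε, hε0, by linarith, max Y₁ (max Y₂ Y₃), hY₁.trans (le_max_left _ _), ?_⟩
  intro X hX L φ hD r hr1 hr2
  have hX1 : Y₁ ≤ X := (le_max_left _ _).trans hX
  have hX2 : Y₂ ≤ X := ((le_max_left _ _).trans (le_max_right _ _)).trans hX
  have hX3 : Y₃ ≤ X := ((le_max_right _ _).trans (le_max_right _ _)).trans hX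
  have hXo : 1 ≤ X := hY₁.trans hX1
  have hX0 : 0 < X := by linarith
  have hr0 : 0 < r := by linarith
  have hmon : ∀ {a b : ℝ}, a ≤ b → X ^ a ≤ X ^ b := fun h => Real.rpow_le_rpow_of_exponent_le hXo h
  have hX100 : 100 ≤ X ^ (ε'/4) := by simpa using hY₂' X hX2
  have hX6 : 6 ≤ X ^ (1/2:ℝ) := by simpa using hY₃' X hX3
  have hXc : 0 < X ^ c := by positivity
  have hXc6 : 6 ≤ X ^ c := hX6.trans (hmon (by linarith))
  have hα0 : 0 < r / (4 * X ^ c) := by positivity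
  have hα1 : r / (4 * X ^ c) ≤ 1/2 := by
    rw [div_le_iff₀ (by positivity)]; linarith
  have hL := hD.1
  have hLX : (L:ℝ) ≤ X ^ (1 + ε'/4) := hL.trans (hmon (by linarith))
  have hbig : 100 * X ^ (1 + ε'/4) ≤ X ^ (1 + ε') := by
    calc _ ≤ X ^ (ε'/4) * X ^ (1 + ε'/4) := by gcongr
      _ = X ^ (ε'/4 + (1 + ε'/4)) := by rw [← Real.rpow_add hX0]
      _ ≤ _ := hmon (by linarith)
  rcases le_or_gt r (X ^ (c/2)) with hr | hr
  · have t1 := hT X hX1 L φ hD r hr1 (hr.trans (hmon (by linarith)))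
    have t2 : ‖∑ n ∈ range L, ee (r / (4 * X ^ c) * ⌊φ n⌋) - ∑ n ∈ range L, ee (r / (4 * X ^ c) * φ n)‖ ≤
        L * (8 * (r / (4 * X ^ c))) := by
      rw [← sum_sub_distrib]
      refine (norm_sum_le _ _).trans ?_
      calc _ ≤ ∑ n ∈ range L, (8 * (r / (4 * X ^ c))) := by
            apply sum_le_sum; intro n _
            refine (ee_sub_le _ _).trans ?_
            rw [← mul_sub, abs_mul, abs_of_pos hα0]
            have : |(⌊φ n⌋:ℝ) - φ n| ≤ 1 := by
              rw [abs_le]; constructor <;> linarith [Int.floor_le (φ n), Int.lt_floor_add_one (φ n)]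
            calc _ ≤ 2 * Real.pi * (r / (4 * X ^ c) * 1) := by gcongr
              _ ≤ _ := by nlinarith [Real.pi_lt_four]
        _ = _ := by simp
    have t3 : r / (4 * X ^ c) ≤ r ^ (-η') := by
      have : r * r ≤ X ^ c := by
        calc r * r ≤ X ^ (c/2) * X ^ (c/2) := by gcongr
          _ = X ^ c := by rw [← Real.rpow_add hX0]; congr 1; ring
      calc r / (4 * X ^ c) ≤ r ^ (-1:ℝ) := by
            rw [Real.rpow_neg_one, div_le_iff₀ (by positivity)]
            field_simp; nlinarith
        _ ≤ _ := Real.rpow_le_rpow_of_exponent_le hr1 (by linarith)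
    have t4 : r ^ (-η) ≤ r ^ (-η') := Real.rpow_le_rpow_of_exponent_le hr1 (by linarith)
    have t5 := norm_le_norm_sub_add (∑ n ∈ range L, ee (r / (4 * X ^ c) * ⌊φ n⌋)) (∑ n ∈ range L, ee (r / (4 * X ^ c) * φ n))
    have hrp : 0 < r ^ (-η') := by positivity
    calc _ ≤ L * (8 * (r / (4 * X ^ c))) + X ^ (1 + ε'/4) * r ^ (-η) := by linarith
      _ ≤ X ^ (1 + ε'/4) * (8 * r ^ (-η')) + X ^ (1 + ε'/4) * r ^ (-η') := by gcongr
      _ ≤ 100 * X ^ (1 + ε'/4) * r ^ (-η') := by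
        have : 0 < X ^ (1 + ε'/4) * r ^ (-η') := by positivity
        linarith
      _ ≤ _ := by gcongr
  · set κ := η/16 with hκ
    set m := ⌊X ^ κ⌋₊ with hm
    have a1 : 1 ≤ X ^ κ := Real.one_le_rpow hXo (by positivity)
    have hm1 : 1 ≤ m := Nat.le_floor (by simpa using a1)
    have b1 : (m:ℝ) ≤ X ^ κ := Nat.floor_le (by positivity)
    have hm1r : (1:ℝ) ≤ m := by exact_mod_cast hm1
    have b2 : X ^ κ ≤ 2 * m := by
      have := Nat.lt_floor_add_one (X ^ κ)
      linarith
    have b3 : (m:ℝ)^3 ≤ X ^ (3*η/16) := by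
      calc (m:ℝ)^3 ≤ (X ^ κ)^3 := by gcongr
        _ = X ^ (3*η/16) := by rw [← Real.rpow_natCast, ← Real.rpow_mul hX0.le]; congr 1; rw [hκ]; push_cast; ring
    set B := X ^ (1 + ε'/4) * X ^ (-η/2) with hBdef
    have gen : ∀ β : ℝ, X ^ (c/2) ≤ |β| * (4 * X ^ c) → |β| * (4 * X ^ c) ≤ X ^ (c+1) →
        ‖∑ n ∈ range L, ee (β * φ n)‖ ≤ B := by
      intro β h1 h2
      have e : ‖∑ n ∈ range L, ee (β * φ n)‖ = ‖∑ n ∈ range L, ee (|β| * φ n)‖ := by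
        rcases abs_cases β with ⟨h, _⟩ | ⟨h, _⟩
        · rw [h]
        · rw [h]; simp only [neg_mul]; rw [norm_sum_neg (fun n => β * φ n)]
      rw [e]
      have h3 : 1 ≤ X ^ (c/2) := Real.one_le_rpow hXo (by positivity)
      have := hT X hX1 L φ hD (|β| * (4 * X ^ c)) (h3.trans h1) h2
      rw [mul_div_assoc, div_self (by positivity), mul_one] at this
      refine this.trans ?_
      rw [hBdef]
      gcongr
      calc (|β| * (4 * X ^ c)) ^ (-η) ≤ (X ^ (c/2)) ^ (-η) :=
            Real.rpow_le_rpow_of_nonpos (by positivity) h1 (by linarith)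
        _ = X ^ (-(c*η)/2) := by rw [← Real.rpow_mul hX0.le]; congr 1; ring
        _ ≤ _ := hmon (by nlinarith)
    have up : ∀ t : ℝ, t ≤ 1/2 + (m:ℝ)^3 → t * (4 * X ^ c) ≤ X ^ (c+1) := by
      intro t ht
      have : (1:ℝ) ≤ X ^ (3*η/16) := Real.one_le_rpow hXo (by positivity)
      calc t * (4 * X ^ c) ≤ (1/2 * X ^ (3*η/16) + X ^ (3*η/16)) * (4 * X ^ c) := by gcongr; linarith
        _ = 6 * (X ^ (3*η/16) * X ^ c) := by ring
        _ ≤ X ^ (1/2:ℝ) * (X ^ (3*η/16) * X ^ c) := by gcongr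
        _ = X ^ (1/2 + (3*η/16 + c)) := by rw [← Real.rpow_add hX0, ← Real.rpow_add hX0]
        _ ≤ _ := hmon (by linarith)
    have low : ∀ t : ℝ, 1/2 ≤ t → X ^ (c/2) ≤ t * (4 * X ^ c) := by
      intro t ht
      calc X ^ (c/2) ≤ X ^ c := hmon (by linarith)
        _ ≤ 1/2 * (4 * X ^ c) := by linarith
        _ ≤ _ := by gcongr
    have hB0 : 0 < B := by positivity
    have hfl := floorLem L φ (r / (4 * X ^ c)) (by rw [abs_of_pos hα0]; exact hα1) m hm1 B hB0.le ?_ ?_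
    · refine hfl.trans ?_
      have c1 : 41 * (L:ℝ) / m ≤ 82 * X ^ (1 + ε'/4) * X ^ (-κ) := by
        rw [div_le_iff₀ (by positivity)]
        have : 1 ≤ 2 * (X ^ (-κ) * m) := by
          calc 1 = X ^ (-κ) * X ^ κ := by rw [← Real.rpow_add hX0]; simp
            _ ≤ X ^ (-κ) * (2 * m) := by gcongr
            _ = _ := by ring
        calc 41 * (L:ℝ) ≤ 41 * X ^ (1 + ε'/4) * 1 := by linarith
          _ ≤ 41 * X ^ (1 + ε'/4) * (2 * (X ^ (-κ) * m)) := by gcongr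
          _ = _ := by ring
      have c2 : ((m:ℝ)^3 + 8) * B ≤ 9 * X ^ (1 + ε'/4) * X ^ (-κ) := by
        have h1 : (1:ℝ) ≤ X ^ (3*η/16) := Real.one_le_rpow hXo (by positivity)
        calc ((m:ℝ)^3 + 8) * B ≤ (9 * X ^ (3*η/16)) * B := by gcongr; linarith
          _ = 9 * X ^ (1 + ε'/4) * (X ^ (3*η/16) * X ^ (-η/2)) := by rw [hBdef]; ring
          _ = 9 * X ^ (1 + ε'/4) * (X ^ (3*η/16 + -η/2)) := by rw [← Real.rpow_add hX0]
          _ ≤ _ := by gcongr; rw [hκ]; linarith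
      have c3 : X ^ (-κ) ≤ r ^ (-η') := by
        have : r ≤ X ^ (2*c) := by
          calc r ≤ 2 * X ^ c := hr2
            _ ≤ X ^ c * X ^ c := by gcongr; linarith
            _ = _ := by rw [← Real.rpow_add hX0]; congr 1; ring
        calc X ^ (-κ) = (X ^ (2*c)) ^ (-η') := by
              rw [← Real.rpow_mul hX0.le]; congr 1; rw [hκ]; linarith
          _ ≤ _ := Real.rpow_le_rpow_of_nonpos hr0 this (by linarith)
      calc _ ≤ 100 * X ^ (1 + ε'/4) * X ^ (-κ) := by
            have : 0 < X ^ (1 + ε'/4) * X ^ (-κ) := by positivity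
            linarith
        _ ≤ _ := by gcongr
    · intro h hh
      have hh' : |(h:ℝ)| < (m:ℝ)^3 := by exact_mod_cast hh
      have habs : |r / (4 * X ^ c) + h| ≤ 1/2 + (m:ℝ)^3 := by
        refine (abs_add_le _ _).trans ?_
        rw [abs_of_pos hα0]; linarith
      apply gen _ _ (up _ habs)
      rcases eq_or_ne h 0 with rfl | h0
      · simp only [Int.cast_zero, add_zero]; rw [abs_of_pos hα0]
        rw [div_mul_cancel₀ _ (by positivity)]; exact hr.le
      · apply low
        have : (1:ℝ) ≤ |(h:ℝ)| := by exact_mod_cast Int.one_le_abs h0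
        have h3 := abs_sub_abs_le_abs_sub (h:ℝ) (-(r / (4 * X ^ c)))
        rw [abs_neg, abs_of_pos hα0, sub_neg_eq_add, add_comm (h:ℝ)] at h3
        linarith
    · intro h h0 hh
      have hh' : |(h:ℝ)| < (m:ℝ) := by exact_mod_cast hh
      have : (1:ℝ) ≤ |(h:ℝ)| := by exact_mod_cast Int.one_le_abs h0
      apply gen _ (low _ (by linarith)) (up _ _)
      have : (m:ℝ)^1 ≤ (m:ℝ)^3 := pow_le_pow_right₀ hm1r (by norm_num)
      linarith

lemma F_deriv {f : ℝ → ℝ} {x₀ : ℝ} (hf : ContDiffOn ℝ (⊤ : ℕ∞) f (Set.Ici x₀)) (j : ℕ) {x : ℝ}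
    (hx : x₀ < x) : HasDerivAt (iteratedDerivWithin j f (Set.Ici x₀))
      (iteratedDerivWithin (j+1) f (Set.Ici x₀) x) x := by
  rw [iteratedDerivWithin_succ]
  have h := (hf.differentiableOn_iteratedDerivWithin (m := j) (by exact_mod_cast WithTop.coe_lt_top j)
    (uniqueDiffOn_Ici x₀)) x hx.le
  exact h.hasDerivWithinAt.hasDerivAt (Ici_mem_nhds hx)

lemma DD_mvt (k : ℕ) : ∀ (G : ℕ → ℝ → ℝ) (σ lo hi a : ℝ) (n : ℕ),
    (∀ j < k, ∀ x ∈ Set.Icc (a+n) (a+n+k), HasDerivAt (G j) (G (j+1) x) x) →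
    (∀ x ∈ Set.Icc (a+n) (a+n+k), lo ≤ σ * G k x ∧ σ * G k x ≤ hi) →
    lo ≤ σ * DD^[k] (fun m : ℕ => G 0 (a+m)) n ∧ σ * DD^[k] (fun m : ℕ => G 0 (a+m)) n ≤ hi := by
  induction k with
  | zero => intro G σ lo hi a n _ h; exact h _ (by simp)
  | succ k ih =>
    intro G σ lo hi a n hd hb
    have := ih (fun j x => G j (x+1) - G j x) σ lo hi a n ?_ ?_
    · rw [Function.iterate_succ_apply]
      have e : DD (fun m : ℕ => G 0 (a+m)) = fun m : ℕ => G 0 (a+m+1) - G 0 (a+m) := by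
        funext m; simp only [DD]; push_cast; rw [add_assoc]
      rw [e]; exact this
    · intro j hj x hx
      have h1 := hd j (by omega) (x+1) ⟨by linarith [hx.1], by push_cast; linarith [hx.2]⟩
      have h2 := hd j (by omega) x ⟨by linarith [hx.1], by push_cast; linarith [hx.2]⟩
      exact (h1.comp_add_const x 1).sub h2
    · intro x hx
      have hI : ∀ y ∈ Set.Icc x (x+1), y ∈ Set.Icc (a+n) (a+n+(k+1:ℕ)) := by
        intro y hy
        exact ⟨by linarith [hx.1, hy.1], by push_cast; linarith [hx.2, hy.2]⟩
      obtain ⟨ξ, hξ, e⟩ := exists_hasDerivAt_eq_slope (G k) (G (k+1)) (by linarith : x < x+1)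
        (fun y hy => (hd k (by omega) y (hI y hy)).continuousAt.continuousWithinAt)
        (fun y hy => hd k (by omega) y (hI y ⟨hy.1.le, hy.2.le⟩))
      have e2 : G k (x+1) - G k x = G (k+1) ξ := by rw [e]; simp
      simp only [e2]
      exact hb ξ (hI ξ ⟨hξ.1.le, hξ.2.le⟩)

lemma sign_const {g : ℝ → ℝ} {x₁ : ℝ} (hc : ContinuousOn g (Set.Ici x₁))
    (h0 : ∀ x, x₁ ≤ x → g x ≠ 0) : ∃ σ : ℝ, (σ = 1 ∨ σ = -1) ∧ ∀ x, x₁ ≤ x → |g x| = σ * g x := by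
  rcases lt_or_gt_of_ne (h0 x₁ le_rfl) with h | h
  · refine ⟨-1, Or.inr rfl, fun x hx => ?_⟩
    have : g x < 0 := by
      by_contra hh
      push Not at hh
      obtain ⟨y, hy, e⟩ := intermediate_value_Icc hx (hc.mono Set.Icc_subset_Ici_self) ⟨h.le, hh⟩
      exact h0 y hy.1 e
    rw [abs_of_neg this]; ring
  · refine ⟨1, Or.inl rfl, fun x hx => ?_⟩
    have : 0 < g x := by
      by_contra hh
      push Not at hh
      obtain ⟨y, hy, e⟩ := intermediate_value_Icc' hx (hc.mono Set.Icc_subset_Ici_self) ⟨hh, h.le⟩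
      exact h0 y hy.1 e
    rw [abs_of_pos this]; ring

lemma signs (c : ℝ) (x₀ : ℝ) (hx₀ : 1 ≤ x₀) (f : ℝ → ℝ)
    (hf : ContDiffOn ℝ (⊤ : ℕ∞) f (Set.Ici x₀))
    (htop : Filter.Tendsto f Filter.atTop Filter.atTop)
    (hder : ∀ ε : ℝ, 0 < ε → ∀ j : ℕ, ∃ A B x₁ : ℝ, 0 < A ∧ 0 < B ∧ x₀ ≤ x₁ ∧
      ∀ x : ℝ, x₁ ≤ x →
        A * x ^ (c - j - ε) ≤ |iteratedDerivWithin j f (Set.Ici x₀) x| ∧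
        |iteratedDerivWithin j f (Set.Ici x₀) x| ≤ B * x ^ (c - j + ε)) :
    ∃ σ : ℕ → ℝ, (∀ j, σ j = 1 ∨ σ j = -1) ∧ σ 0 = 1 ∧ σ 1 = 1 ∧
      ∀ ε : ℝ, 0 < ε → ∀ J : ℕ, ∃ x₁, x₀ < x₁ ∧ ∀ j ≤ J, ∀ x, x₁ ≤ x →
        x ^ (c - j - ε) ≤ σ j * iteratedDerivWithin j f (Set.Ici x₀) x ∧
        σ j * iteratedDerivWithin j f (Set.Ici x₀) x ≤ x ^ (c - j + ε) := by
  have h1 : ∀ j : ℕ, ∃ σ : ℝ, (σ = 1 ∨ σ = -1) ∧ ∃ y, x₀ < y ∧ ∀ x, y ≤ x →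
      |iteratedDerivWithin j f (Set.Ici x₀) x| = σ * iteratedDerivWithin j f (Set.Ici x₀) x := by
    intro j
    obtain ⟨A, B, x₁, hA, hB, hx₁, h⟩ := hder 1 one_pos j
    obtain ⟨σ, hσ, h2⟩ := sign_const (g := iteratedDerivWithin j f (Set.Ici x₀)) (x₁ := x₁+1)
      (fun x hx => (F_deriv hf j (by
        have := Set.mem_Ici.1 hx
        linarith)).continuousAt.continuousWithinAt)
      (fun x hx e => by
        have := (h x (by linarith)).1
        rw [e, abs_zero] at this
        have h3 : 0 < x ^ (c - j - 1) := Real.rpow_pos_of_pos (by linarith) _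
        nlinarith [mul_pos hA h3])
    exact ⟨σ, hσ, x₁+1, by linarith, h2⟩
  choose σ hσ y hy hyσ using h1
  have hF0 : ∀ x, iteratedDerivWithin 0 f (Set.Ici x₀) x = f x := fun x => by simp
  have hpos : ∀ x, y 0 ≤ x → 0 ≤ σ 0 * f x := by
    intro x hx; rw [← hF0 x, ← hyσ 0 x hx]; exact abs_nonneg _
  refine ⟨σ, hσ, ?_, ?_, ?_⟩
  · rcases hσ 0 with h | h
    · exact h
    · exfalso
      obtain ⟨x, hx1, hx2⟩ := ((htop.eventually_gt_atTop 0).and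
        (Filter.eventually_ge_atTop (y 0))).exists
      have := hpos x hx2
      rw [h] at this; linarith
  · rcases hσ 1 with h | h
    · exact h
    · exfalso
      obtain ⟨x, hx1, hx2⟩ := ((htop.eventually_gt_atTop (f (y 1))).and
        (Filter.eventually_ge_atTop (y 1 + 1))).exists
      have hd : ∀ z, y 1 ≤ z → HasDerivAt f (iteratedDerivWithin 1 f (Set.Ici x₀) z) z := by
        intro z hz
        have := F_deriv hf 0 (lt_of_lt_of_le (hy 1) hz)
        rwa [iteratedDerivWithin_zero] at this
      obtain ⟨ξ, hξ, e⟩ := exists_hasDerivAt_eq_slope f (iteratedDerivWithin 1 f (Set.Ici x₀))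
        (by linarith : y 1 < x)
        (fun z hz => (hd z hz.1).continuousAt.continuousWithinAt) (fun z hz => hd z hz.1.le)
      have h3 := hyσ 1 ξ hξ.1.le
      rw [h, e] at h3
      have : 0 < (f x - f (y 1)) / (x - y 1) := div_pos (by linarith) (by linarith)
      have := abs_nonneg ((f x - f (y 1)) / (x - y 1))
      linarith
  · intro ε hε J
    have h2 : ∀ j : ℕ, ∃ x₁, x₀ < x₁ ∧ ∀ x, x₁ ≤ x →
        x ^ (c - j - ε) ≤ σ j * iteratedDerivWithin j f (Set.Ici x₀) x ∧
        σ j * iteratedDerivWithin j f (Set.Ici x₀) x ≤ x ^ (c - j + ε) := by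
      intro j
      obtain ⟨A, B, x₁, hA, hB, hx₁, h⟩ := hder (ε/2) (by linarith) j
      obtain ⟨Y1, hY1, e1⟩ := ev_pow (A⁻¹) (c - j - ε) (c-j-ε/2) (by linarith)
      obtain ⟨Y2, hY2, e2⟩ := ev_pow B (c - j + ε/2) (c-j+ε) (by linarith)
      refine ⟨max (max x₁ (y j)) (max Y1 Y2), lt_of_lt_of_le (hy j) (by simp), fun x hx => ?_⟩
      simp only [max_le_iff] at hx
      rw [← hyσ j x hx.1.2]
      have := h x hx.1.1
      refine ⟨le_trans ?_ this.1, this.2.trans (e2 x hx.2.2)⟩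
      have := e1 x hx.2.1
      rw [inv_mul_le_iff₀ hA] at this
      exact this
    choose z hz hz2 using h2
    refine ⟨∑ j ∈ range (J+1), |z j| + x₀ + 1, ?_, ?_⟩
    · have : 0 ≤ ∑ j ∈ range (J+1), |z j| := Finset.sum_nonneg fun _ _ => abs_nonneg _
      linarith
    · intro j hj x hx
      apply hz2 j x
      have : |z j| ≤ ∑ j ∈ range (J+1), |z j| :=
        Finset.single_le_sum (f := fun j => |z j|) (fun _ _ => abs_nonneg _) (by simp; omega)
      have := le_abs_self (z j)
      linarith

lemma pow_cmp {X x e p P : ℝ} (hX : 1 ≤ X) (he : 0 ≤ e) (h1 : X ^ (1-e) ≤ x)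
    (h2 : x ≤ X ^ (1+e)) (hp : |p| ≤ P) : X ^ (p - e*P) ≤ x ^ p ∧ x ^ p ≤ X ^ (p + e*P) := by
  have hX0 : 0 < X := by linarith
  have hx : 0 < x := lt_of_lt_of_le (Real.rpow_pos_of_pos hX0 _) h1
  have hp' := abs_le.1 hp
  rcases le_or_gt 0 p with h | h
  · constructor
    · calc X ^ (p - e*P) ≤ (X ^ (1-e)) ^ p := by
            rw [← Real.rpow_mul hX0.le]; exact Real.rpow_le_rpow_of_exponent_le hX (by nlinarith)
        _ ≤ _ := Real.rpow_le_rpow (Real.rpow_pos_of_pos hX0 _).le h1 h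
    · calc x ^ p ≤ (X ^ (1+e)) ^ p := Real.rpow_le_rpow hx.le h2 h
        _ ≤ _ := by
            rw [← Real.rpow_mul hX0.le]; exact Real.rpow_le_rpow_of_exponent_le hX (by nlinarith)
  · constructor
    · calc X ^ (p - e*P) ≤ (X ^ (1+e)) ^ p := by
            rw [← Real.rpow_mul hX0.le]; exact Real.rpow_le_rpow_of_exponent_le hX (by nlinarith)
        _ ≤ _ := Real.rpow_le_rpow_of_nonpos hx h2 h.le
    · calc x ^ p ≤ (X ^ (1-e)) ^ p :=
            Real.rpow_le_rpow_of_nonpos (Real.rpow_pos_of_pos hX0 _) h1 h.le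
        _ ≤ _ := by
            rw [← Real.rpow_mul hX0.le]; exact Real.rpow_le_rpow_of_exponent_le hX (by nlinarith)

lemma Pre (c : ℝ) (hc : 1 ≤ c) (x₀ : ℝ) (hx₀ : 1 ≤ x₀) (f : ℝ → ℝ)
    (hf : ContDiffOn ℝ (⊤ : ℕ∞) f (Set.Ici x₀)) (σ : ℕ → ℝ) (hσ0 : σ 0 = 1)
    (hσ : ∀ ε : ℝ, 0 < ε → ∀ J : ℕ, ∃ x₁, x₀ < x₁ ∧ ∀ j ≤ J, ∀ x, x₁ ≤ x →
        x ^ (c - j - ε) ≤ σ j * iteratedDerivWithin j f (Set.Ici x₀) x ∧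
        σ j * iteratedDerivWithin j f (Set.Ici x₀) x ≤ x ^ (c - j + ε))
    (J s : ℕ) (ε : ℝ) (hε : 0 < ε) :
    ∃ Y : ℝ, 1 ≤ Y ∧ ∀ X, Y ≤ X → ∀ X₀ X₁ : ℝ, x₀ ≤ X₀ → X₀ < X₁ →
      f X₀ = X ^ c / (s + 1) → f X₁ = 2 * X ^ c / (s + 1) →
      x₀ < X₀ ∧ X₁ + J + 1 ≤ X ^ (1 + ε) ∧
      ∀ j ≤ J, ∀ x ∈ Set.Icc X₀ (X₁ + J + 1),
        X ^ (c - j - ε) ≤ σ j * iteratedDerivWithin j f (Set.Ici x₀) x ∧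
        σ j * iteratedDerivWithin j f (Set.Ici x₀) x ≤ X ^ (c - j + ε) := by
  set P : ℝ := c + J + 1 with hP
  have hJ0 : (0:ℝ) ≤ J := Nat.cast_nonneg J
  have hP0 : 0 < P := by positivity
  obtain ⟨e2, he2, he21, he2P⟩ : ∃ e2 : ℝ, 0 < e2 ∧ e2 ≤ 1/2 ∧ e2 * (P+1) ≤ ε := by
    refine ⟨min (1/2) (ε/(P+1)), by positivity, min_le_left _ _, ?_⟩
    calc _ ≤ ε/(P+1)*(P+1) := by gcongr; exact min_le_right _ _
      _ = ε := by field_simp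
  have he2ε : e2 ≤ ε := by nlinarith
  set e1 := e2/8 with he1
  have he10 : 0 < e1 := by positivity
  obtain ⟨x₁, hx₁, hb⟩ := hσ e1 he10 J
  obtain ⟨M, hM⟩ := (isCompact_Icc (a := x₀) (b := x₁)).bddAbove_image
    (hf.continuousOn.mono Set.Icc_subset_Ici_self)
  have hF0 : ∀ x, iteratedDerivWithin 0 f (Set.Ici x₀) x = f x := fun x => by simp
  have hs : (0:ℝ) < s + 1 := by positivity
  obtain ⟨Y1, hY1, E1⟩ := ev_pow ((|M|+1)*(s+1)) 0 c (by linarith)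
  obtain ⟨Y2, hY2, E2⟩ := ev_pow (s+1) ((1-e2)*(c+e1)) c (by nlinarith)
  obtain ⟨Y3, hY3, E3⟩ := ev_pow 2 c ((1+e2/2)*(c-e1)) (by nlinarith)
  obtain ⟨Y4, hY4, E4⟩ := ev_pow (J+2) (1+e2/2) (1+e2) (by linarith)
  refine ⟨max (max Y1 Y2) (max Y3 Y4), by simp [hY1], fun X hX X₀ X₁ hX0 hX01 hf0 hf1 => ?_⟩
  simp only [max_le_iff] at hX
  obtain ⟨⟨h1, h2⟩, h3, h4⟩ := hX
  have hXo : 1 ≤ X := hY1.trans h1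
  have hXp : 0 < X := by linarith
  have big : x₁ < X₀ := by
    by_contra hh
    push Not at hh
    have := hM ⟨X₀, ⟨hX0, hh⟩, rfl⟩
    rw [hf0, div_le_iff₀ hs] at this
    have h5 := E1 X h1
    rw [Real.rpow_zero, mul_one] at h5
    have := le_abs_self M
    nlinarith
  have b0 : ∀ x, x₁ ≤ x → x ^ (c - e1) ≤ f x ∧ f x ≤ x ^ (c+e1) := by
    intro x hx
    have := hb 0 (Nat.zero_le _) x hx
    rw [hσ0, hF0] at this
    simpa using this
  have L0 : X ^ (1-e2) ≤ X₀ := by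
    by_contra hh
    push Not at hh
    have h5 := (b0 X₀ big.le).2
    have h6 : X₀ ^ (c+e1) < (X ^ (1-e2)) ^ (c+e1) :=
      Real.rpow_lt_rpow (by linarith) hh (by linarith)
    rw [← Real.rpow_mul hXp.le] at h6
    have h7 := E2 X h2
    rw [hf0, div_le_iff₀ hs] at h5
    nlinarith
  have L1 : X₁ ≤ X ^ (1+e2/2) := by
    by_contra hh
    push Not at hh
    have h5 := (b0 X₁ (by linarith)).1
    have h6 : (X ^ (1+e2/2)) ^ (c-e1) < X₁ ^ (c-e1) :=
      Real.rpow_lt_rpow (Real.rpow_pos_of_pos hXp _).le hh (by linarith)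
    rw [← Real.rpow_mul hXp.le] at h6
    have h7 := E3 X h3
    have h8 : f X₁ ≤ 2 * X ^ c := by
      rw [hf1]
      apply div_le_self (by positivity)
      have : (0:ℝ) ≤ s := Nat.cast_nonneg s
      linarith
    linarith
  have L2 : X₁ + J + 1 ≤ X ^ (1+e2) := by
    have h5 := E4 X h4
    have h6 : 1 ≤ X ^ (1+e2/2) := Real.one_le_rpow hXo (by positivity)
    nlinarith
  refine ⟨by linarith, L2.trans (Real.rpow_le_rpow_of_exponent_le hXo (by linarith)), ?_⟩
  intro j hj x hx
  have hjJ : (j:ℝ) ≤ J := by exact_mod_cast hj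
  have hj0 : (0:ℝ) ≤ j := Nat.cast_nonneg j
  have h5 := hb j hj x (big.le.trans hx.1)
  have h6 := (pow_cmp (p := c-j-e1) (P := P) hXo he2.le (L0.trans hx.1) (hx.2.trans L2)
    (by rw [abs_le]; constructor <;> linarith)).1
  have h7 := (pow_cmp (p := c-j+e1) (P := P) hXo he2.le (L0.trans hx.1) (hx.2.trans L2)
    (by rw [abs_le]; constructor <;> linarith)).2
  constructor
  · refine (le_trans ?_ h6).trans h5.1
    exact Real.rpow_le_rpow_of_exponent_le hXo (by nlinarith)
  · refine h5.2.trans (h7.trans ?_)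
    exact Real.rpow_le_rpow_of_exponent_le hXo (by nlinarith)

lemma mkDat (c : ℝ) (x₀ : ℝ) (hx₀ : 1 ≤ x₀) (f : ℝ → ℝ)
    (hf : ContDiffOn ℝ (⊤ : ℕ∞) f (Set.Ici x₀)) (σ : ℕ → ℝ) (hσ1 : ∀ j, σ j = 1 ∨ σ j = -1)
    (J : ℕ) (ε X X₀ X₁ : ℝ) (h0 : x₀ < X₀) (h01 : X₀ < X₁)
    (h1 : X₁ + J + 1 ≤ X ^ (1 + ε))
    (h : ∀ j ≤ J, ∀ x ∈ Set.Icc X₀ (X₁ + J + 1),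
        X ^ (c - j - ε) ≤ σ j * iteratedDerivWithin j f (Set.Ici x₀) x ∧
        σ j * iteratedDerivWithin j f (Set.Ici x₀) x ≤ X ^ (c - j + ε)) :
    Dat c J ε X (⌊X₁⌋ - ⌊X₀⌋).toNat (fun n => f (((⌊X₀⌋:ℝ) + 1) + n)) := by
  have hle : ⌊X₀⌋ ≤ ⌊X₁⌋ := Int.floor_le_floor h01.le
  have hc : (((⌊X₁⌋ - ⌊X₀⌋).toNat : ℕ) : ℝ) = (⌊X₁⌋:ℝ) - ⌊X₀⌋ := by
    have : (((⌊X₁⌋ - ⌊X₀⌋).toNat : ℕ) : ℤ) = ⌊X₁⌋ - ⌊X₀⌋ := Int.toNat_of_nonneg (by omega)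
    exact_mod_cast this
  have f1 := Int.floor_le X₁
  have f0 := Int.lt_floor_add_one X₀
  have hJ0 : (0:ℝ) ≤ J := Nat.cast_nonneg J
  refine ⟨by rw [hc]; linarith, fun k hk => ⟨σ k, hσ1 k, fun n hn => ?_⟩⟩
  have hkJ : (k:ℝ) ≤ J := by exact_mod_cast hk
  have hn' : (n:ℝ) + 1 ≤ ((⌊X₁⌋ - ⌊X₀⌋).toNat : ℕ) := by exact_mod_cast hn
  rw [hc] at hn'
  have hn0 : (0:ℝ) ≤ n := Nat.cast_nonneg n
  have := DD_mvt k (fun j => iteratedDerivWithin j f (Set.Ici x₀)) (σ k) (X ^ (c-k-ε))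
    (X ^ (c-k+ε)) ((⌊X₀⌋:ℝ)+1) n
    (fun j _ x hx => F_deriv hf j (by linarith [hx.1]))
    (fun x hx => h k hk x ⟨by linarith [hx.1], by linarith [hx.2]⟩)
  simpa using this

def RR (s : ℕ) (I : Finset ℤ) (a : ℤ → ℤ) (M : ℤ) : ℕ :=
  ((Fintype.piFinset fun _ : Fin s => I).filter fun n : Fin s → ℤ => ∑ i, a (n i) = M).card

lemma ee_sum {ι : Type*} (t : Finset ι) (g : ι → ℝ) : ∏ i ∈ t, ee (g i) = ee (∑ i ∈ t, g i) := by
  classical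
  induction t using Finset.induction_on with
  | empty => simp [ee_zero]
  | insert b t hb ih => rw [prod_insert hb, sum_insert hb, ih, ee_add]

lemma ee_orth (q : ℕ) (hq : 0 < q) (m : ℤ) (hm : |m| < q) :
    ∑ r ∈ range q, ee ((r:ℝ)/q * m) = if m = 0 then (q:ℂ) else 0 := by
  have hq0 : (q:ℝ) ≠ 0 := by positivity
  split_ifs with h
  · simp [h, ee_zero]
  · have e : ∀ r : ℕ, ee ((r:ℝ)/q * m) = (ee ((m:ℝ)/q))^r := by
      intro r
      induction r with
      | zero => simp [ee_zero]
      | succ r ih => rw [pow_succ, ← ih, ← ee_add]; congr 1; push_cast; ring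
    simp_rw [e]
    have hne : ee ((m:ℝ)/q) ≠ 1 := by
      intro h1
      have h2 : Complex.exp ((2*Real.pi*((m:ℝ)/q):ℝ)*Complex.I) = 1 := h1
      rw [Complex.exp_eq_one_iff] at h2
      obtain ⟨n, hn⟩ := h2
      have hpi : (Real.pi:ℂ) ≠ 0 := by exact_mod_cast Real.pi_ne_zero
      have h3 : (((m:ℝ)/q:ℝ):ℂ) = ((n:ℝ):ℂ) := by
        have hI := Complex.I_ne_zero
        have : (2*(Real.pi:ℂ)*Complex.I) * (((m:ℝ)/q:ℝ):ℂ) = (2*(Real.pi:ℂ)*Complex.I) * ((n:ℝ):ℂ) := by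
          have h4 := hn
          push_cast at h4 ⊢
          linear_combination h4
        exact mul_left_cancel₀ (by simp [hpi, hI]) this
      have h5 : (m:ℝ)/q = n := by exact_mod_cast h3
      rw [div_eq_iff hq0] at h5
      have h6 : m = n * q := by exact_mod_cast h5
      have : n ≠ 0 := by rintro rfl; simp at h6; exact h h6
      have h7 : (1:ℤ) ≤ |n| := Int.one_le_abs this
      rw [h6, abs_mul] at hm
      simp at hm
      nlinarith [show (0:ℤ) < q by exact_mod_cast hq]
    rw [geom_sum_eq hne]
    have : (ee ((m:ℝ)/q))^q = 1 := by
      rw [← e q, div_self hq0, one_mul, ee_int]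
    rw [this]; simp

lemma fourierRR (s : ℕ) (I : Finset ℤ) (a : ℤ → ℤ) (q : ℕ) (hq : 0 < q) (M : ℤ)
    (h : ∀ n ∈ Fintype.piFinset fun _ : Fin s => I, |∑ i, a (n i) - M| < q) :
    (q:ℂ) * (RR s I a M : ℂ) =
      ∑ r ∈ range q, (∑ n ∈ I, ee ((r:ℝ)/q * a n))^s * ee (-((r:ℝ)/q * M)) := by
  have e : ∀ r : ℕ, (∑ n ∈ I, ee ((r:ℝ)/q * a n))^s * ee (-((r:ℝ)/q * M)) =
      ∑ n ∈ Fintype.piFinset fun _ : Fin s => I, ee ((r:ℝ)/q * ((∑ i, a (n i) - M : ℤ):ℝ)) := by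
    intro r
    have : (∑ n ∈ I, ee ((r:ℝ)/q * a n))^s = ∏ _i : Fin s, ∑ n ∈ I, ee ((r:ℝ)/q * a n) := by
      simp
    rw [this, Finset.prod_univ_sum, Finset.sum_mul]
    refine Finset.sum_congr rfl fun n _ => ?_
    rw [ee_sum, ← ee_add]; congr 1; push_cast; rw [← Finset.mul_sum]; ring
  simp_rw [e]
  rw [Finset.sum_comm]
  rw [Finset.sum_congr rfl fun n hn => ee_orth q hq _ (h n hn)]
  simp only [sub_eq_zero]
  rw [← Finset.sum_filter, Finset.sum_const, RR, nsmul_eq_mul, mul_comm]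

lemma sum_inv_sq (n : ℕ) : ∑ r ∈ range (n+1), (1:ℝ)/((r:ℝ)+1)^2 ≤ 2 - 1/((n:ℝ)+1) := by
  induction n with
  | zero => norm_num
  | succ n ih =>
    rw [sum_range_succ]
    have hn : (0:ℝ) ≤ n := Nat.cast_nonneg n
    have : (1:ℝ)/(((n:ℝ)+1)+1)^2 ≤ 1/((n:ℝ)+1) - 1/(((n:ℝ)+1)+1) := by
      rw [div_sub_div _ _ (by positivity) (by positivity),
        div_le_div_iff₀ (by positivity) (by positivity)]
      nlinarith
    push_cast
    linarith

lemma sum_inv_sq2 (n : ℕ) : ∑ r ∈ range n, (1:ℝ)/((r:ℝ)+1)^2 ≤ 2 := by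
  cases n with
  | zero => simp
  | succ n =>
    have h := sum_inv_sq n
    have : (0:ℝ) ≤ 1/((n:ℝ)+1) := by positivity
    linarith

lemma sum_inv_sq3 (q : ℕ) :
    ∑ r ∈ range q, ((1:ℝ)/(r:ℝ)^2 + 1/((q:ℝ)-r)^2) ≤ 4 := by
  rw [sum_add_distrib]
  have h1 : ∑ r ∈ range q, (1:ℝ)/(r:ℝ)^2 ≤ 2 := by
    cases q with
    | zero => simp
    | succ q =>
      rw [sum_range_succ']
      have := sum_inv_sq2 q
      simpa using this
  have h2 : ∑ r ∈ range q, (1:ℝ)/((q:ℝ)-r)^2 ≤ 2 := by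
    rw [← Finset.sum_range_reflect]
    refine le_trans (le_of_eq ?_) (sum_inv_sq2 q)
    refine sum_congr rfl fun r hr => ?_
    have hr' := mem_range.1 hr
    have : ((q - 1 - r : ℕ):ℝ) = q - 1 - r := by
      rw [Nat.sub_sub, Nat.cast_sub (by omega)]; push_cast; ring
    rw [this]; congr 2; ring
  linarith

lemma termb (s : ℕ) (D η W V j q : ℝ) (m : ℕ) (hm : 1 ≤ m) (hW0 : 0 ≤ W) (hj : 0 ≤ j) (hq : 0 < q)
    (hD : 0 ≤ D) (hs : 3 ≤ η * s) (hV0 : 0 ≤ V)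
    (hW : W ≤ D * (m:ℝ) ^ (-η)) (hV : V ≤ 2 * Real.pi * (m/q*j)) :
    W ^ s * V ≤ D ^ s * (2 * Real.pi * j / q) * (1/(m:ℝ)^2) := by
  have hm1 : (1:ℝ) ≤ m := by exact_mod_cast hm
  have hm0 : (0:ℝ) < m := by linarith
  have hp := Real.pi_pos
  have h1 : W ^ s ≤ D ^ s * (1/(m:ℝ)^3) := by
    calc W ^ s ≤ (D * (m:ℝ) ^ (-η)) ^ s := pow_le_pow_left₀ hW0 hW s
      _ = D ^ s * (m:ℝ) ^ (-η * s) := by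
        rw [mul_pow, ← Real.rpow_natCast ((m:ℝ)^(-η)), ← Real.rpow_mul hm0.le]
      _ ≤ D ^ s * (m:ℝ) ^ (-3:ℝ) := by
        gcongr
        linarith
      _ = _ := by
        rw [Real.rpow_neg hm0.le, one_div]
        norm_cast
  calc W ^ s * V ≤ (D ^ s * (1/(m:ℝ)^3)) * (2 * Real.pi * (m/q*j)) := by gcongr
    _ = _ := by field_simp

lemma shift (s : ℕ) (I : Finset ℤ) (a : ℤ → ℤ) (q : ℕ) (hq : 0 < q) (N : ℤ) (j : ℕ) (D η : ℝ)
    (hD : 0 ≤ D) (hs : 3 ≤ η * s)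
    (hS : ∀ r : ℕ, 1 ≤ r → 2 * r ≤ q → ‖∑ n ∈ I, ee ((r:ℝ)/q * a n)‖ ≤ D * (r:ℝ) ^ (-η))
    (h : ∀ n ∈ Fintype.piFinset fun _ : Fin s => I, |∑ i, a (n i) - N| < q)
    (h' : ∀ n ∈ Fintype.piFinset fun _ : Fin s => I, |∑ i, a (n i) - (N - j)| < q) :
    (RR s I a (N - j) : ℝ) - RR s I a N ≤ 32 * j * D ^ s / q ^ 2 := by
  have hq0 : (0:ℝ) < q := by exact_mod_cast hq
  have f1 := fourierRR s I a q hq N h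
  have f2 := fourierRR s I a q hq (N - j) h'
  set S : ℕ → ℂ := fun r => ∑ n ∈ I, ee ((r:ℝ)/q * a n) with hSdef
  have f3 : (q:ℂ) * ((RR s I a (N - j) : ℂ) - RR s I a N) =
      ∑ r ∈ range q, (S r)^s * (ee (-((r:ℝ)/q * ((N - j : ℤ):ℝ))) - ee (-((r:ℝ)/q * N))) := by
    rw [mul_sub, f1, f2, ← sum_sub_distrib]
    exact sum_congr rfl fun r _ => by rw [mul_sub]
  have hb : ∀ r ∈ range q,
      ‖(S r)^s * (ee (-((r:ℝ)/q * ((N - j : ℤ):ℝ))) - ee (-((r:ℝ)/q * N)))‖ ≤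
      D ^ s * (2 * Real.pi * j / q) * ((1:ℝ)/(r:ℝ)^2 + 1/((q:ℝ)-r)^2) := by
    intro r hr
    have hrq := mem_range.1 hr
    have hC : 0 ≤ D ^ s * (2 * Real.pi * j / q) := by
      have := Real.pi_pos
      positivity
    rw [norm_mul, norm_pow]
    rcases Nat.eq_zero_or_pos r with h0 | h0
    · subst h0
      simp only [Nat.cast_zero, zero_div, zero_mul, sub_self, norm_zero, mul_zero]
      positivity
    · rcases le_or_gt (2*r) q with h2 | h2
      · refine (termb s D η _ _ j q r h0 (norm_nonneg _) (Nat.cast_nonneg j) hq0 hD hs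
          (norm_nonneg _) (hS r h0 h2) ?_).trans ?_
        · refine (ee_sub_le _ _).trans (le_of_eq ?_)
          congr 1
          have : -((r:ℝ)/q * ((N - j : ℤ):ℝ)) - -((r:ℝ)/q * N) = (r:ℝ)/q * j := by
            push_cast; ring
          rw [this, abs_of_nonneg (by positivity)]
        · gcongr
          have : (0:ℝ) ≤ 1/((q:ℝ)-r)^2 := by positivity
          linarith
      · set m := q - r with hm
        have hmr : (m:ℝ) = q - r := by rw [hm, Nat.cast_sub hrq.le]
        have key : ∀ b : ℤ, ee ((r:ℝ)/q * b) = ee (-((m:ℝ)/q * b)) := by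
          intro b
          have : (r:ℝ)/q * b = b + -((m:ℝ)/q * b) := by rw [hmr]; field_simp; ring
          rw [this, ee_add, ee_int, one_mul]
        have key2 : ∀ b : ℤ, ee (-((r:ℝ)/q * b)) = ee ((m:ℝ)/q * b) := by
          intro b
          rw [← ee_conj, key, ee_conj, neg_neg]
        have hSm : ‖S r‖ = ‖S m‖ := by
          have : S r = (starRingEnd ℂ) (S m) := by
            simp only [hSdef, map_sum]
            exact sum_congr rfl fun n _ => by rw [key, ee_conj]
          rw [this, RCLike.norm_conj]
        rw [hSm, key2, key2]
        refine (termb s D η _ _ j q m (by omega) (norm_nonneg _) (Nat.cast_nonneg j) hq0 hD hs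
          (norm_nonneg _) (hS m (by omega) (by omega)) ?_).trans ?_
        · refine (ee_sub_le _ _).trans (le_of_eq ?_)
          congr 1
          have : (m:ℝ)/q * ((N - j : ℤ):ℝ) - (m:ℝ)/q * N = -((m:ℝ)/q * j) := by
            push_cast; ring
          rw [this, abs_neg, abs_of_nonneg (by positivity)]
        · rw [hmr]
          gcongr
          have : (0:ℝ) ≤ 1/(r:ℝ)^2 := by positivity
          linarith
  have hn : (q:ℝ) * |(RR s I a (N - j) : ℝ) - RR s I a N| ≤
      D ^ s * (2 * Real.pi * j / q) * 4 := by
    have e : (q:ℝ) * |(RR s I a (N - j) : ℝ) - RR s I a N| =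
        ‖(q:ℂ) * ((RR s I a (N - j) : ℂ) - RR s I a N)‖ := by
      rw [norm_mul, Complex.norm_natCast, ← Real.norm_eq_abs, ← Complex.norm_real]
      push_cast; rfl
    rw [e, f3]
    refine (norm_sum_le _ _).trans ((sum_le_sum hb).trans ?_)
    rw [← mul_sum]
    have hC : 0 ≤ D ^ s * (2 * Real.pi * j / q) := by
      have := Real.pi_pos
      positivity
    exact mul_le_mul_of_nonneg_left (sum_inv_sq3 q) hC
  have h5 := le_abs_self ((RR s I a (N - j) : ℝ) - RR s I a N)
  refine h5.trans ?_
  rw [le_div_iff₀ (by positivity)]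
  have h6 : |(RR s I a (N - j) : ℝ) - RR s I a N| * q^2 ≤ D ^ s * (2 * Real.pi * j / q) * 4 * q := by
    nlinarith
  refine h6.trans ?_
  have : D ^ s * (2 * Real.pi * j / q) * 4 * q = 8 * Real.pi * (j * D ^ s) := by field_simp; ring
  rw [this]
  have h7 : 0 ≤ j * D ^ s := by positivity
  nlinarith [Real.pi_le_four]

lemma pigeon (t : ℕ) (I I' : Finset ℤ) (hI : I' ⊆ I) (a : ℤ → ℤ) (N : ℤ) (H : ℕ) (C : ℝ)
    (hC : ∀ p ∈ Fintype.piFinset fun _ : Fin t => I',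
      C ≤ ((I.filter fun n => N - H < ∑ i, a (p i) + a n ∧ ∑ i, a (p i) + a n ≤ N).card : ℝ)) :
    C * (I'.card : ℝ) ^ t ≤ ∑ j ∈ range H, (RR (t+1) I a (N - j) : ℝ) := by
  classical
  set P := Fintype.piFinset fun _ : Fin t => I' with hP
  set Q : (Fin t → ℤ) → Finset ℤ := fun p =>
    I.filter fun n => N - H < ∑ i, a (p i) + a n ∧ ∑ i, a (p i) + a n ≤ N with hQ
  set T := (Fintype.piFinset fun _ : Fin (t+1) => I).filter
    fun n : Fin (t+1) → ℤ => N - H < ∑ i, a (n i) ∧ ∑ i, a (n i) ≤ N with hT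
  have h1 : C * (I'.card : ℝ) ^ t ≤ ((P.sigma Q).card : ℝ) := by
    rw [card_sigma]; push_cast
    calc C * (I'.card : ℝ) ^ t = ∑ p ∈ P, C := by
          rw [sum_const, nsmul_eq_mul, hP, Fintype.card_piFinset]; simp [mul_comm]
      _ ≤ _ := sum_le_sum hC
  have h2 : (P.sigma Q).card ≤ T.card := by
    refine card_le_card_of_injOn (fun x => (Fin.cons x.2 x.1 : Fin (t+1) → ℤ)) ?_ ?_
    · rintro ⟨p, n⟩ hx
      simp only [coe_sigma, Set.mem_sigma_iff, mem_coe, hP, hQ, Fintype.mem_piFinset, mem_filter] at hx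
      simp only [hT, coe_filter, Set.mem_ofPred_eq, Fintype.mem_piFinset, Fin.sum_univ_succ,
        Fin.cons_zero, Fin.cons_succ]
      refine ⟨fun i => ?_, ?_⟩
      · refine Fin.cases ?_ ?_ i
        · simpa using hx.2.1
        · intro i; simpa using hI (hx.1 i)
      · rw [add_comm]; exact hx.2.2
    · rintro ⟨p, n⟩ _ ⟨p', n'⟩ _ e
      simp only at e
      obtain ⟨e1, e2⟩ := Fin.cons_injective2 e
      subst e1 e2; rfl
  have h3 : T.card ≤ ∑ j ∈ range H, RR (t+1) I a (N - j) := by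
    have : T ⊆ (range H).biUnion fun j => (Fintype.piFinset fun _ : Fin (t+1) => I).filter
        fun n : Fin (t+1) → ℤ => ∑ i, a (n i) = N - j := by
      intro n hn
      rw [hT, mem_filter] at hn
      rw [mem_biUnion]
      refine ⟨(N - ∑ i, a (n i)).toNat, ?_, ?_⟩
      · rw [mem_range]; omega
      · rw [mem_filter]; refine ⟨hn.1, ?_⟩
        rw [Int.toNat_of_nonneg (by omega)]; ring
    exact (card_le_card this).trans card_biUnion_le
  have h4 : ((P.sigma Q).card : ℝ) ≤ ((∑ j ∈ range H, RR (t+1) I a (N - j) : ℕ) : ℝ) := by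
    exact_mod_cast h2.trans h3
  push_cast at h4
  exact h1.trans h4

lemma avg (t : ℕ) (I I' : Finset ℤ) (hI : I' ⊆ I) (a : ℤ → ℤ) (N : ℕ) (hN : 0 < N)
    (H : ℕ) (hH : 0 < H) (hHN : H ≤ N) (C D η : ℝ) (hD : 0 ≤ D) (hs : 3 ≤ η * (t+1:ℕ))
    (hS : ∀ r : ℕ, 1 ≤ r → 2 * r ≤ 4 * N →
      ‖∑ n ∈ I, ee ((r:ℝ)/(4*N:ℕ) * a n)‖ ≤ D * (r:ℝ) ^ (-η))
    (h : ∀ n ∈ Fintype.piFinset fun _ : Fin (t+1) => I, 0 ≤ ∑ i, a (n i) ∧ ∑ i, a (n i) ≤ 2 * N)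
    (hC : ∀ p ∈ Fintype.piFinset fun _ : Fin t => I',
      C ≤ ((I.filter fun n => (N:ℤ) - H < ∑ i, a (p i) + a n ∧ ∑ i, a (p i) + a n ≤ N).card : ℝ)) :
    C * (I'.card : ℝ) ^ t / H - 32 * H * D ^ (t+1) / (4*N:ℕ) ^ 2 ≤ RR (t+1) I a N := by
  have h1 := pigeon t I I' hI a N H C hC
  have hH0 : (0:ℝ) < H := by exact_mod_cast hH
  have h2 : ∑ j ∈ range H, (RR (t+1) I a (N - j) : ℝ) ≤
      ∑ j ∈ range H, ((RR (t+1) I a N : ℝ) + 32 * H * D ^ (t+1) / (4*N:ℕ) ^ 2) := by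
    refine sum_le_sum fun j hj => ?_
    have hj' := mem_range.1 hj
    have h3 := shift (t+1) I a (4*N) (by omega) N j D η hD hs hS
      (fun n hn => by have := h n hn; rw [abs_lt]; push_cast; omega)
      (fun n hn => by have := h n hn; rw [abs_lt]; push_cast; omega)
    have hjH : (j:ℝ) ≤ H := by exact_mod_cast hj'.le
    have h4 : 32 * j * D ^ (t+1) / ((4*N:ℕ):ℝ) ^ 2 ≤ 32 * H * D ^ (t+1) / (4*N:ℕ) ^ 2 := by
      gcongr
    linarith
  rw [sum_const, card_range, nsmul_eq_mul] at h2
  rw [sub_le_iff_le_add, div_le_iff₀ hH0]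
  linarith

lemma countI (f f' : ℝ → ℝ) (X₀ X₁ D A B : ℝ) (h01 : X₀ < X₁) (hD : 0 < D)
    (hd : ∀ x ∈ Set.Icc X₀ X₁, HasDerivAt f (f' x) x)
    (hp : ∀ x ∈ Set.Icc X₀ X₁, 0 < f' x ∧ f' x ≤ D)
    (hA : f X₀ ≤ A) (hAB : A < B) (hB : B ≤ f X₁) :
    (B - A)/D - 1 ≤ (((Ioc ⌊X₀⌋ ⌊X₁⌋).filter fun n : ℤ => A < f n ∧ f n ≤ B).card : ℝ) := by
  have hcont : ContinuousOn f (Set.Icc X₀ X₁) :=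
    fun x hx => (hd x hx).continuousAt.continuousWithinAt
  have hmono : StrictMonoOn f (Set.Icc X₀ X₁) := by
    apply strictMonoOn_of_deriv_pos (convex_Icc _ _) hcont
    intro x hx
    rw [interior_Icc] at hx
    rw [(hd x ⟨hx.1.le, hx.2.le⟩).deriv]
    exact (hp x ⟨hx.1.le, hx.2.le⟩).1
  obtain ⟨u, hu, eu⟩ := intermediate_value_Icc h01.le hcont ⟨hA, hAB.le.trans hB⟩
  obtain ⟨v, hv, ev⟩ := intermediate_value_Icc h01.le hcont ⟨hA.trans hAB.le, hB⟩
  have huv : u < v := (hmono.lt_iff_lt hu hv).1 (by rw [eu, ev]; exact hAB)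
  have hlen : (B - A)/D ≤ v - u := by
    obtain ⟨ξ, hξ, e⟩ := exists_hasDerivAt_eq_slope f f' huv
      (hcont.mono (Set.Icc_subset_Icc hu.1 hv.2))
      (fun x hx => hd x ⟨hu.1.trans hx.1.le, hx.2.le.trans hv.2⟩)
    have h1 := (hp ξ ⟨hu.1.trans hξ.1.le, hξ.2.le.trans hv.2⟩).2
    rw [e, eu, ev, div_le_iff₀ (by linarith)] at h1
    rw [div_le_iff₀ hD]; linarith
  have hsub : Ioc ⌊u⌋ ⌊v⌋ ⊆ (Ioc ⌊X₀⌋ ⌊X₁⌋).filter fun n : ℤ => A < f n ∧ f n ≤ B := by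
    intro n hn
    rw [mem_Ioc] at hn
    have h1 : u < n := Int.floor_lt.1 hn.1
    have h2 : (n:ℝ) ≤ v := Int.le_floor.1 hn.2
    have hnI : (n:ℝ) ∈ Set.Icc X₀ X₁ := ⟨hu.1.trans h1.le, h2.trans hv.2⟩
    rw [mem_filter, mem_Ioc]
    refine ⟨⟨Int.floor_lt.2 (hu.1.trans_lt h1), Int.le_floor.2 (h2.trans hv.2)⟩, ?_, ?_⟩
    · rw [← eu]; exact hmono hu hnI h1
    · rw [← ev]; exact hmono.monotoneOn hnI hv h2
  have hcard := card_le_card hsub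
  rw [Int.card_Ioc] at hcard
  have h3 : (⌊v⌋ - ⌊u⌋ : ℤ) ≤ ((⌊v⌋ - ⌊u⌋).toNat : ℤ) := Int.self_le_toNat _
  have h4 : ((⌊v⌋:ℝ) - ⌊u⌋) ≤ (((⌊v⌋ - ⌊u⌋).toNat : ℕ) : ℝ) := by exact_mod_cast h3
  have h5 : (((⌊v⌋ - ⌊u⌋).toNat : ℕ) : ℝ) ≤
    (((Ioc ⌊X₀⌋ ⌊X₁⌋).filter fun n : ℤ => A < f n ∧ f n ≤ B).card : ℝ) := by exact_mod_cast hcard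
  have := Int.floor_le u
  have := Int.lt_floor_add_one v
  linarith

lemma sum_Ioc_range (u v : ℤ) (g : ℤ → ℂ) :
    ∑ n ∈ Ioc u v, g n = ∑ n ∈ range (v-u).toNat, g (u + 1 + n) := by
  refine Finset.sum_nbij' (fun n => (n - u - 1).toNat) (fun n => u + 1 + n) ?_ ?_ ?_ ?_ ?_
  · intro n hn; rw [mem_Ioc] at hn; rw [mem_range]; omega
  · intro n hn; rw [mem_range] at hn; rw [mem_Ioc]; omega
  · intro n hn; rw [mem_Ioc] at hn; omega
  · intro n hn; omega
  · intro n hn; rw [mem_Ioc] at hn; congr 1; omega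

lemma monoI (f f' : ℝ → ℝ) (X₀ X₁ : ℝ)
    (hd : ∀ x ∈ Set.Icc X₀ X₁, HasDerivAt f (f' x) x)
    (hp : ∀ x ∈ Set.Icc X₀ X₁, 0 < f' x) : StrictMonoOn f (Set.Icc X₀ X₁) := by
  apply strictMonoOn_of_deriv_pos (convex_Icc _ _)
    (fun x hx => (hd x hx).continuousAt.continuousWithinAt)
  intro x hx
  rw [interior_Icc] at hx
  rw [(hd x ⟨hx.1.le, hx.2.le⟩).deriv]
  exact hp x ⟨hx.1.le, hx.2.le⟩

lemma numeric (t : ℕ) (c e e' X H I' V : ℝ) (hX : 1 ≤ X) (hee : e ≤ e') (hV : 0 < V)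
    (hH0 : 0 < H) (hH : H ≤ 2 * X ^ (c - 1/2)) (hI : X ^ (1-e) / V ≤ I') :
    1/(8*V^t) * X ^ ((t+1) - c - (t+1)*e') - 4 * X ^ ((t+1) - c - 1/2 + (t+1)*e') ≤
    (X ^ (1/2-e)/4) * I' ^ t / H - 32 * H * (X ^ (1+e')) ^ (t+1) / (4 * X ^ c) ^ 2 := by
  have hX0 : 0 < X := by linarith
  have a1 : 1/(8*V^t) * X ^ ((t+1) - c - (t+1)*e') ≤ (X ^ (1/2-e)/4) * I' ^ t / H := by
    have h1 : (X ^ (1/2-e)/4) * (X ^ (1-e) / V) ^ t / (2 * X ^ (c - 1/2)) ≤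
        (X ^ (1/2-e)/4) * I' ^ t / H := by
      have : 0 < X ^ (1-e) := Real.rpow_pos_of_pos hX0 _
      have hI0 : 0 ≤ I' := le_trans (by positivity) hI
      have h9 : 0 ≤ X ^ (1 / 2 - e) / 4 * I' ^ t := by positivity
      gcongr
    refine le_trans ?_ h1
    have h2 : (X ^ (1/2-e)/4) * (X ^ (1-e) / V) ^ t / (2 * X ^ (c - 1/2)) =
        1/(8*V^t) * X ^ ((t+1) - c - (t+1)*e) := by
      have : X ^ ((t+1) - c - (t+1)*e) = X ^ (1/2-e) * (X ^ (1-e)) ^ t / X ^ (c-1/2) := by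
        rw [← Real.rpow_natCast (X ^ (1-e)), ← Real.rpow_mul hX0.le, ← Real.rpow_add hX0,
          ← Real.rpow_sub hX0]
        congr 1; ring
      rw [this, div_pow]
      have := (Real.rpow_pos_of_pos hX0 (c-1/2)).ne'
      field_simp; norm_num
    rw [h2]
    have ht : (0:ℝ) ≤ t := Nat.cast_nonneg t
    have : X ^ (((t:ℝ)+1) - c - (t+1)*e') ≤ X ^ (((t:ℝ)+1) - c - (t+1)*e) :=
      Real.rpow_le_rpow_of_exponent_le hX (by nlinarith)
    gcongr
  have a2 : 32 * H * (X ^ (1+e')) ^ (t+1) / (4 * X ^ c) ^ 2 ≤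
      4 * X ^ ((t+1) - c - 1/2 + (t+1)*e') := by
    have : (4:ℝ) * X ^ ((t+1) - c - 1/2 + (t+1)*e') =
        32 * (2 * X ^ (c-1/2)) * (X ^ (1+e')) ^ (t+1) / (4 * X ^ c) ^ 2 := by
      have : X ^ ((t+1) - c - 1/2 + (t+1)*e') =
          X ^ (c-1/2) * (X ^ (1+e')) ^ (t+1) / (X ^ c) ^ 2 := by
        rw [← Real.rpow_natCast (X ^ (1+e')), ← Real.rpow_natCast (X ^ c), ← Real.rpow_mul hX0.le,
          ← Real.rpow_mul hX0.le, ← Real.rpow_add hX0, ← Real.rpow_sub hX0]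
        congr 1; push_cast; ring
      rw [this]
      have := (Real.rpow_pos_of_pos hX0 c).ne'
      field_simp; norm_num
    rw [this]
    have : 0 < X ^ (1+e') := Real.rpow_pos_of_pos hX0 _
    gcongr
  linarith

set_option maxHeartbeats 1000000 in
lemma core (t : ℕ) (ht : 1 ≤ t) (c : ℝ) (f f' : ℝ → ℝ) (X X₀ X₁ e e' η : ℝ) (N : ℕ)
    (hN : (N:ℝ) = X ^ c) (hX : 1 ≤ X) (h01 : X₀ < X₁) (hee : e ≤ e')
    (hf0 : f X₀ = X ^ c / ((t+1:ℕ) + 1)) (hf1 : f X₁ = 2 * X ^ c / ((t+1:ℕ) + 1))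
    (hd : ∀ x ∈ Set.Icc X₀ X₁, HasDerivAt f (f' x) x)
    (hp : ∀ x ∈ Set.Icc X₀ X₁, 0 < f' x ∧ f' x ≤ X ^ (c-1+e))
    (hS : ∀ r : ℝ, 1 ≤ r → r ≤ 2 * X ^ c → 
      ‖∑ n ∈ range (⌊X₁⌋ - ⌊X₀⌋).toNat, ee (r/(4*X^c)*⌊f (((⌊X₀⌋:ℝ) + 1) + n)⌋)‖
        ≤ X^(1+e')*r^(-η))
    (hη : 3 ≤ η * (t+1:ℕ))
    (E1 : 4*((t:ℝ)+1)*((t:ℝ)+2) ≤ X ^ (1-e)) (E2 : 4 ≤ X ^ (1/2-e)) (E3 : 2 ≤ X ^ (c-1/2))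
    (E4 : 4*((t:ℝ)+2) * X ^ (c-1/2) ≤ X ^ c) (E5 : 8*((t:ℝ)+1)*((t:ℝ)+2) ≤ X ^ c) :
    1/(8*(4*((t:ℝ)+1)*((t:ℝ)+2))^t) * X ^ ((t+1) - c - (t+1)*e')
      - 4 * X ^ ((t+1) - c - 1/2 + (t+1)*e') ≤
    RR (t+1) (Ioc ⌊X₀⌋ ⌊X₁⌋) (fun n => ⌊f n⌋) N := by
  have hX0 : 0 < X := by linarith
  have ht1 : (1:ℝ) ≤ t := by exact_mod_cast ht
  set s : ℝ := (t:ℝ)+1 with hs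
  have hs0 : 0 < s := by positivity
  set T : ℝ := X ^ c / (s+1) with hT
  have hXc : X ^ c = (s+1) * T := by rw [hT]; field_simp
  have e12 : (t:ℝ) + 2 = s + 1 := by rw [hs]; ring
  have hcast : (((t+1:ℕ):ℝ) + 1) = s + 1 := by rw [hs]; push_cast; ring
  rw [hcast] at hf0 hf1
  rw [e12] at E1 E4 E5 ⊢
  replace hf0 : f X₀ = T := hf0
  have hf1' : f X₁ = 2 * T := by rw [hf1, hT]; ring
  have hTbig : 8 * s ≤ T := by rw [hT, le_div_iff₀ (by positivity)]; linarith
  have hT0 : 0 < T := by linarith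
  have hmono := monoI f f' X₀ X₁ hd (fun x hx => (hp x hx).1)
  have hX₀I : X₀ ∈ Set.Icc X₀ X₁ := ⟨le_rfl, h01.le⟩
  have hX₁I : X₁ ∈ Set.Icc X₀ X₁ := ⟨h01.le, le_rfl⟩
  set I := Ioc ⌊X₀⌋ ⌊X₁⌋ with hI
  have hfI : ∀ n ∈ I, T ≤ f n ∧ f n ≤ 2 * T := by
    intro n hn
    rw [hI, mem_Ioc] at hn
    have h1 : X₀ < n := Int.floor_lt.1 hn.1
    have h2 : (n:ℝ) ≤ X₁ := Int.le_floor.1 hn.2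
    have hnI : (n:ℝ) ∈ Set.Icc X₀ X₁ := ⟨h1.le, h2⟩
    exact ⟨by rw [← hf0]; exact hmono.monotoneOn hX₀I hnI h1.le,
      by rw [← hf1']; exact hmono.monotoneOn hnI hX₁I h2⟩
  set A : ℝ := T * (1 + 1/(4*s)) with hA
  set B : ℝ := T * (1 + 3/(4*s)) with hB
  set I' := I.filter fun n : ℤ => A < f n ∧ f n ≤ B with hI'
  have hBA : B - A = T/(2*s) := by rw [hA, hB]; field_simp; ring
  set D := X ^ (c-1+e) with hDdef
  have hD0 : 0 < D := Real.rpow_pos_of_pos hX0 _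
  have hcardI' : X ^ (1-e) / (4*s*(s+1)) ≤ (I'.card : ℝ) := by
    have h1 := countI f f' X₀ X₁ D A B h01 hD0 hd hp
      (by rw [hf0, hA]; nlinarith [show 0 < T * (1/(4*s)) by positivity])
      (by have : 0 < T/(2*s) := by positivity
          linarith)
      (by rw [hf1', hB]
          have : 3/(4*s) ≤ 1 := by rw [div_le_one (by positivity)]; linarith
          nlinarith)
    refine le_trans ?_ h1
    rw [hBA]
    have h2 : T/(2*s)/D = X ^ (1-e) / (2*s*(s+1)) := by
      rw [hT, hDdef, show (1-e) = c - (c-1+e) by ring, Real.rpow_sub hX0]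
      field_simp
    rw [h2]
    have h3 : 1 ≤ X ^ (1-e) / (4*s*(s+1)) := by rw [le_div_iff₀ (by positivity)]; linarith
    have h4 : X ^ (1-e) / (2*s*(s+1)) = 2 * (X ^ (1-e) / (4*s*(s+1))) := by field_simp; norm_num
    linarith
  set H : ℕ := ⌈X ^ (c-1/2)⌉₊ with hH
  have hH1 : X ^ (c-1/2) ≤ H := Nat.le_ceil _
  have hH2 : (H:ℝ) ≤ 2 * X ^ (c-1/2) := by
    have := Nat.ceil_lt_add_one (show 0 ≤ X ^ (c-1/2) by linarith)
    linarith
  have hHT : (H:ℝ)/2 ≤ T/4 := by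
    rw [hT, div_div, le_div_iff₀ (by positivity)]
    nlinarith
  have hHr : (2:ℝ) ≤ H := by linarith
  have hHpos : 0 < H := by
    have : (0:ℝ) < H := by linarith
    exact_mod_cast this
  have hHN : H ≤ N := by
    have : (H:ℝ) ≤ N := by rw [hN, hXc]; nlinarith
    exact_mod_cast this
  have hNpos : 0 < N := lt_of_lt_of_le hHpos hHN
  have hq : (((4*N:ℕ):ℝ)) = 4 * X ^ c := by push_cast; rw [hN]
  have main := avg t I I' (filter_subset _ _) (fun n => ⌊f n⌋) N hNpos H hHpos hHN
    (X ^ (1/2-e)/4) (X ^ (1+e')) η (Real.rpow_pos_of_pos hX0 _).le hη ?_ ?_ ?_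
  · rw [hq] at main
    exact (numeric t c e e' X H I'.card (4*s*(s+1)) hX hee (by positivity) (by linarith) hH2
      hcardI').trans main
  · intro r hr1 hr2
    rw [hq, hI, sum_Ioc_range]
    have := hS r (by exact_mod_cast hr1) (by
      have : (2:ℝ) * r ≤ 4 * N := by exact_mod_cast hr2
      rw [hN] at this; linarith)
    push_cast at this ⊢
    exact this
  · intro n hn
    rw [Fintype.mem_piFinset] at hn
    constructor
    · exact sum_nonneg fun i _ => Int.floor_nonneg.2 (by linarith [(hfI _ (hn i)).1])
    · have h1 : ((∑ i, ⌊f (n i)⌋ : ℤ):ℝ) ≤ 2 * N := by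
        push_cast
        calc ∑ i, (⌊f (n i)⌋:ℝ) ≤ ∑ _i : Fin (t+1), 2 * T :=
              sum_le_sum fun i _ => (Int.floor_le _).trans (hfI _ (hn i)).2
          _ = s * (2*T) := by rw [sum_const, card_univ, Fintype.card_fin, nsmul_eq_mul, hs]; push_cast; ring
          _ ≤ 2 * N := by rw [hN, hXc]; nlinarith
      exact_mod_cast h1
  · intro p hpp
    rw [Fintype.mem_piFinset] at hpp
    have hpf : ∀ i, A < f (p i) ∧ f (p i) ≤ B := fun i => (mem_filter.1 (hpp i)).2
    set Z : ℤ := ∑ i, ⌊f (p i)⌋ with hZ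
    have hZ1 : (Z:ℝ) ≤ t * B := by
      rw [hZ]; push_cast
      calc ∑ i, (⌊f (p i)⌋:ℝ) ≤ ∑ _i : Fin t, B :=
            sum_le_sum fun i _ => (Int.floor_le _).trans (hpf i).2
        _ = _ := by rw [sum_const, card_univ, Fintype.card_fin, nsmul_eq_mul]
    have hZ2 : t * (A - 1) ≤ (Z:ℝ) := by
      rw [hZ]; push_cast
      calc (t:ℝ) * (A-1) = ∑ _i : Fin t, (A-1) := by
            rw [sum_const, card_univ, Fintype.card_fin, nsmul_eq_mul]
        _ ≤ _ := sum_le_sum fun i _ => by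
            have := Int.lt_floor_add_one (f (p i))
            linarith [(hpf i).1]
    have hts : (t:ℝ) = s - 1 := by rw [hs]; ring
    have lo : 5/4 * T ≤ N - (Z:ℝ) := by
      have : (t:ℝ) * B ≤ (s+1)*T - 5/4*T := by
        have : (t:ℝ) * B = T * (s - 1) + T * (3/4) - T * (3/(4*s)) := by
          rw [hB, hts]; field_simp; ring
        rw [this]
        have : 0 ≤ T * (3/(4*s)) := by positivity
        linarith
      rw [hN, hXc]; linarith
    have hi : N - (Z:ℝ) ≤ 2 * T := by
      have : (s+1)*T - 2*T ≤ (t:ℝ) * (A-1) := by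
        have e1 : (t:ℝ) * (A-1) = T * (s - 1) + T * (1/4) - T * (1/(4*s)) - (s-1) := by
          rw [hA, hts]; field_simp; ring
        rw [e1]
        have h2 : 1/(4*s) ≤ 1/8 := by
          apply one_div_le_one_div_of_le (by norm_num); linarith
        nlinarith
      rw [hN, hXc]; linarith
    have h1 := countI f f' X₀ X₁ D (N - (Z:ℝ) - H/2) (N - (Z:ℝ)) h01 hD0 hd hp
      (by rw [hf0]; linarith) (by linarith) (by rw [hf1']; exact hi)
    have h2 : X ^ (1/2-e)/4 ≤ (N - (Z:ℝ) - (N - (Z:ℝ) - H/2))/D - 1 := by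
      have h3 : X ^ (1/2-e)/2 ≤ (N - (Z:ℝ) - (N - (Z:ℝ) - H/2))/D := by
        rw [le_div_iff₀ hD0]
        have : X ^ (1/2-e)/2 * D = X ^ (c-1/2)/2 := by
          rw [hDdef, div_mul_eq_mul_div, ← Real.rpow_add hX0]; congr 2; ring
        rw [this]; linarith
      linarith
    refine (h2.trans h1).trans ?_
    have : ((Ioc ⌊X₀⌋ ⌊X₁⌋).filter fun n : ℤ => N - (Z:ℝ) - H/2 < f n ∧ f n ≤ N - (Z:ℝ)) ⊆
        I.filter fun n => (N:ℤ) - H < Z + ⌊f n⌋ ∧ Z + ⌊f n⌋ ≤ N := by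
      intro n hn
      rw [mem_filter] at hn ⊢
      refine ⟨hn.1, ?_, ?_⟩
      · have h3 := Int.lt_floor_add_one (f n)
        have : (N:ℝ) - H < Z + ⌊f n⌋ := by linarith [hn.2.1]
        exact_mod_cast this
      · have h3 := Int.floor_le (f n)
        have : (Z:ℝ) + ⌊f n⌋ ≤ N := by linarith [hn.2.2]
        exact_mod_cast this
    exact_mod_cast card_le_card this

theorem stmt_8 (c : ℝ) (hc : 1 ≤ c) (x₀ : ℝ) (hx₀ : 1 ≤ x₀) (f : ℝ → ℝ)
    (hf : ContDiffOn ℝ (⊤ : ℕ∞) f (Set.Ici x₀))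
    (htop : Filter.Tendsto f Filter.atTop Filter.atTop)
    (hder : ∀ ε : ℝ, 0 < ε → ∀ j : ℕ, ∃ A B x₁ : ℝ, 0 < A ∧ 0 < B ∧ x₀ ≤ x₁ ∧
      ∀ x : ℝ, x₁ ≤ x →
        A * x ^ (c - j - ε) ≤ |iteratedDerivWithin j f (Set.Ici x₀) x| ∧
        |iteratedDerivWithin j f (Set.Ici x₀) x| ≤ B * x ^ (c - j + ε)) :
    ∃ s₀ : ℕ, ∀ s : ℕ, s₀ ≤ s → ∀ ε : ℝ, 0 < ε → ε < 1 / (6 * s) →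
      ∃ K : ℝ, 0 < K ∧ ∃ N₀ : ℕ, ∀ N : ℕ, N₀ ≤ N →
        ∀ X₀ X₁ : ℝ, x₀ ≤ X₀ → X₀ < X₁ →
          f X₀ = N / (s + 1) → f X₁ = 2 * N / (s + 1) →
          K * ((N : ℝ) ^ (1 / c)) ^ ((s : ℝ) - c - 2 * ε) ≤
            (((Fintype.piFinset fun _ : Fin s => Finset.Ioc ⌊X₀⌋ ⌊X₁⌋).filter
              fun n : Fin s → ℤ => ∑ i, ⌊f (n i)⌋ = N).card : ℝ) := by
  obtain ⟨σ, hσ1, hσ0, hσone, hσ⟩ := signs c x₀ hx₀ f hf htop hder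
  obtain ⟨J, η, hη, hlemS⟩ := lemS c hc
  refine ⟨max 2 ⌈3/η⌉₊, fun s hs ε hε hεs => ?_⟩
  obtain ⟨hs2, hs3⟩ := max_le_iff.1 hs
  obtain ⟨t, rfl⟩ : ∃ t, s = t + 1 := ⟨s - 1, by omega⟩
  have ht : 1 ≤ t := by omega
  have ht1 : (1:ℝ) ≤ t := by exact_mod_cast ht
  have hηs : 3 ≤ η * (t+1:ℕ) := by
    have := Nat.ceil_le.1 hs3
    rwa [div_le_iff₀ hη, mul_comm] at this
  have hε12 : ε < 1/12 := by
    refine lt_of_lt_of_le hεs (one_div_le_one_div_of_le (by norm_num) ?_)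
    push_cast; linarith
  set e' : ℝ := ε/((t:ℝ)+1) with he'
  have hse : ((t:ℝ)+1) * e' = ε := by rw [he']; field_simp
  have he'0 : 0 < e' := by positivity
  obtain ⟨e, he0, hee, Y1, hY1, hSum⟩ := hlemS e' he'0
  have he12 : e < 1/12 := by nlinarith
  obtain ⟨Y2, hY2, hPre⟩ := Pre c hc x₀ hx₀ f hf σ hσ0 hσ (J+1) (t+1) e he0
  set V : ℝ := 4*((t:ℝ)+1)*((t:ℝ)+2) with hV
  have hV0 : 0 < V := by positivity
  set κ : ℝ := 1/(8*V^t) with hκ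
  have hκ0 : 0 < κ := by positivity
  obtain ⟨Z1, hZ1, E1⟩ := ev_pow V 0 (1-e) (by linarith)
  obtain ⟨Z2, hZ2, E2⟩ := ev_pow 4 0 (1/2-e) (by linarith)
  obtain ⟨Z3, hZ3, E3⟩ := ev_pow 2 0 (c-1/2) (by linarith)
  obtain ⟨Z4, hZ4, E4⟩ := ev_pow (4*((t:ℝ)+2)) (c-1/2) c (by linarith)
  obtain ⟨Z5, hZ5, E5⟩ := ev_pow (8*((t:ℝ)+1)*((t:ℝ)+2)) 0 c (by linarith)
  obtain ⟨Z6, hZ6, E6⟩ := ev_pow (8/κ) ((t+1) - c - 1/2 + ε) ((t+1) - c - ε) (by linarith)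
  set Y := Y1 + Y2 + Z1 + Z2 + Z3 + Z4 + Z5 + Z6 with hY
  refine ⟨κ/2, by positivity, ⌈Y ^ c⌉₊, fun N hN X₀ X₁ h0 h01 hf0 hf1 => ?_⟩
  have hc0 : 0 < c := by linarith
  have hYN : Y ^ c ≤ N := Nat.ceil_le.1 hN
  have hY0 : 0 < Y := by linarith
  set X : ℝ := (N:ℝ) ^ (1/c) with hXdef
  have hXc : (N:ℝ) = X ^ c := by
    rw [hXdef, ← Real.rpow_mul (Nat.cast_nonneg N), one_div, inv_mul_cancel₀ hc0.ne', Real.rpow_one]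
  have hYX : Y ≤ X := by
    rw [hXdef]
    calc Y = (Y ^ c) ^ (1/c) := by
          rw [← Real.rpow_mul hY0.le, mul_one_div_cancel hc0.ne', Real.rpow_one]
      _ ≤ _ := Real.rpow_le_rpow (Real.rpow_pos_of_pos hY0 _).le hYN (by positivity)
  have hX1 : 1 ≤ X := by linarith
  rw [hXc] at hf0 hf1
  obtain ⟨P1, P2, P3⟩ := hPre X (by linarith) X₀ X₁ h0 h01 hf0 hf1
  have hdat := mkDat c x₀ hx₀ f hf σ hσ1 (J+1) e X X₀ X₁ P1 h01 P2 P3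
  have hdat' : Dat c J e X (⌊X₁⌋ - ⌊X₀⌋).toNat (fun n => f (((⌊X₀⌋:ℝ) + 1) + n)) :=
    ⟨hdat.1, fun k hk => hdat.2 k (by omega)⟩
  have F1 := E1 X (by linarith)
  have F2 := E2 X (by linarith)
  have F3 := E3 X (by linarith)
  have F4 := E4 X (by linarith)
  have F5 := E5 X (by linarith)
  have F6 := E6 X (by linarith)
  rw [Real.rpow_zero, mul_one] at F1 F2 F3 F5
  have hJ0 : (0:ℝ) ≤ ((J+1:ℕ):ℝ) := Nat.cast_nonneg _
  have hcore := core t ht c f (iteratedDerivWithin 1 f (Set.Ici x₀)) X X₀ X₁ e e' η N hXc hX1 h01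
    hee hf0 hf1
    (fun x hx => by
      have := F_deriv hf 0 (lt_of_lt_of_le P1 hx.1)
      rwa [iteratedDerivWithin_zero] at this)
    (fun x hx => by
      have := P3 1 (by omega) x ⟨hx.1, by linarith [hx.2]⟩
      rw [hσone, one_mul, Nat.cast_one] at this
      exact ⟨lt_of_lt_of_le (Real.rpow_pos_of_pos (by linarith) _) this.1, this.2⟩)
    (fun r hr1 hr2 => hSum X (by linarith) _ _ hdat' r hr1 hr2)
    hηs F1 F2 F3 F4 F5
  rw [hse] at hcore
  have hfin : κ/2 * X ^ (((t+1:ℕ):ℝ) - c - 2*ε) ≤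
      1/(8*(4*((t:ℝ)+1)*((t:ℝ)+2))^t) * X ^ ((t+1) - c - ε)
      - 4 * X ^ ((t+1) - c - 1/2 + ε) := by
    rw [← hV, ← hκ]
    have g1 : 8 * X ^ ((t+1) - c - 1/2 + ε) ≤ κ * X ^ ((t+1) - c - ε) := by
      rw [div_mul_eq_mul_div, div_le_iff₀ hκ0] at F6
      linarith
    have g2 : X ^ (((t+1:ℕ):ℝ) - c - 2*ε) ≤ X ^ (((t:ℝ)+1) - c - ε) := by
      apply Real.rpow_le_rpow_of_exponent_le hX1
      push_cast; linarith
    have g3 : κ/2 * X ^ (((t+1:ℕ):ℝ) - c - 2*ε) ≤ κ/2 * X ^ (((t:ℝ)+1) - c - ε) := by gcongr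
    linarith
  exact hfin.trans hcore
end

section
/- Let k ≥ 1 be an integer, let p(x) = α_k x^k + ... + α_1 x be a real polynomial of degree k with α_k > 0, let 0 < δ < 1/2, and let r be a C^k function on [1, ∞) such that |r^{(j)}(x)| ≤ C_j x^{δ−j} for all x ≥ 1 and 0 ≤ j ≤ k, for some constants C_j. Put f = p + r. Then there exist a positive integer s, a constant C_0 > 0 and N_0 such that for every real N ≥ N_0 there exist positive integers x_1, ..., x_s with |f(x_1) + f(x_2) + ... + f(x_s) − N| ≤ C_0. In particular, the s-fold sumset of the sequence (⌊f(n)⌋)_{n∈ℕ} has bounded gaps. -/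
open Finset

/-- Gaussian moments. -/
def gg (j : ℕ) : ℕ := Nat.doubleFactorial (2 * j - 1)

lemma gg_mul (j : ℕ) : gg j * (2 ^ j * Nat.factorial j) = Nat.factorial (2 * j) := by
  unfold gg
  rcases j with _ | j
  · simp
  · rw [← Nat.doubleFactorial_two_mul]
    have h := Nat.factorial_eq_mul_doubleFactorial (2 * j + 1)
    have e1 : 2 * (j + 1) - 1 = 2 * j + 1 := by omega
    have e2 : 2 * (j + 1) = 2 * j + 1 + 1 := by ring
    rw [e1, e2, h, mul_comm]

lemma gg_pos (j : ℕ) : 0 < gg j := by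
  unfold gg
  exact Nat.doubleFactorial_pos _

lemma gg_choose (l m : ℕ) :
    (2 * (l + m)).choose (2 * l) * gg l * gg m = gg (l + m) * (l + m).choose l := by
  have h1 := Nat.add_choose_mul_factorial_mul_factorial (2 * l) (2 * m)
  have h2 := Nat.add_choose_mul_factorial_mul_factorial l m
  have e : 2 * l + 2 * m = 2 * (l + m) := by ring
  rw [e] at h1
  rw [← gg_mul l, ← gg_mul m, ← gg_mul (l + m), ← h2] at h1
  have hpos : 0 < 2 ^ (l + m) * (Nat.factorial l * Nat.factorial m) := by positivity
  apply Nat.eq_of_mul_eq_mul_right hpos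
  rw [pow_add] at *
  have s1 : (2 * (l + m)).choose (2 * l) = (2 * (l + m)).choose (2 * m) := by
    rw [← e]; exact Nat.choose_symm_add
  have s2 : (l + m).choose l = (l + m).choose m := Nat.choose_symm_add
  rw [s1, s2]
  linarith [h1]

/-- Moments of a centered Gaussian of variance `A`. -/
def GG (n : ℕ) (A : ℤ) : ℤ := if Even n then (gg (n / 2) : ℤ) * A ^ (n / 2) else 0

lemma sum_even (F : ℕ → ℤ) (hF : ∀ n, ¬ Even n → F n = 0) (j : ℕ) :
    ∑ i ∈ range (2 * j + 1), F i = ∑ l ∈ range (j + 1), F (2 * l) := by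
  induction j with
  | zero => simp
  | succ j ih =>
    have e : 2 * (j + 1) + 1 = 2 * j + 1 + 1 + 1 := by ring
    rw [e, sum_range_succ, sum_range_succ, ih, sum_range_succ _ (j + 1), hF (2 * j + 1) (by simp)]
    ring_nf

lemma GG_add (n : ℕ) (A B : ℤ) :
    ∑ i ∈ range (n + 1), GG i A * GG (n - i) B * (n.choose i : ℤ) = GG n (A + B) := by
  by_cases hn : Even n
  · obtain ⟨j, rfl⟩ := hn
    rw [← two_mul, sum_even]
    · unfold GG
      simp only [even_two, Even.mul_right, if_true]
      rw [Nat.mul_div_cancel_left j (show 0 < 2 by norm_num), add_pow, mul_sum]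
      apply sum_congr rfl
      intro l hl
      have hl' : l ≤ j := by simpa [Nat.lt_succ_iff] using hl
      obtain ⟨m, rfl⟩ := Nat.exists_eq_add_of_le hl'
      have e : 2 * (l + m) - 2 * l = 2 * m := by omega
      have e2 : l + m - l = m := by omega
      rw [e, if_pos (by simp)]
      have := gg_choose l m
      have h : ((2 * (l + m)).choose (2 * l) : ℤ) * gg l * gg m = gg (l + m) * (l + m).choose l := by
        exact_mod_cast this
      simp only [Nat.mul_div_cancel_left _ (show 0 < 2 by norm_num), e2]
      linear_combination A ^ l * B ^ m * h
    · intro n hn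
      simp [GG, hn]
  · have : GG n (A + B) = 0 := by simp [GG, hn]
    rw [this]
    apply sum_eq_zero
    intro i hi
    have hi' : i ≤ n := by simpa [Nat.lt_succ_iff] using hi
    by_cases h : Even i
    · have : ¬ Even (n - i) := by
        intro h2
        exact hn (by have := h2.add h; rwa [Nat.sub_add_cancel hi'] at this)
      simp [GG, this]
    · simp [GG, h]

lemma GG_scale (n : ℕ) (A x : ℤ) : x ^ n * GG n A = GG n (x ^ 2 * A) := by
  unfold GG
  split_ifs with h
  · obtain ⟨j, rfl⟩ := h
    have : (j + j) / 2 = j := by omega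
    rw [this, mul_pow, ← pow_mul]
    ring_nf
  · simp

/-- `U` has Gaussian moments up to order `m`. -/
def IsGau (m : ℕ) {Ω : Type} [Fintype Ω] (U : Ω → ℤ) (q A : ℤ) : Prop :=
  ∀ n ≤ m, ∑ ω, U ω ^ n = q * GG n A

lemma IsGau.add {m : ℕ} {Ω Ω' : Type} [Fintype Ω] [Fintype Ω'] {U : Ω → ℤ} {V : Ω' → ℤ}
    {q A q' A' : ℤ} (hU : IsGau m U q A) (hV : IsGau m V q' A') :
    IsGau m (fun p : Ω × Ω' => U p.1 + V p.2) (q * q') (A + A') := by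
  intro n hn
  simp only [add_pow]
  rw [sum_comm, ← GG_add, mul_sum]
  apply sum_congr rfl
  intro i hi
  have hi' : i ≤ n := by simpa [Nat.lt_succ_iff] using hi
  rw [Fintype.sum_prod_type]
  simp only
  have h1 := hU i (hi'.trans hn)
  have h2 := hV (n - i) ((Nat.sub_le _ _).trans hn)
  calc _ = (∑ ω, U ω ^ i) * (∑ ω, V ω ^ (n - i)) * (n.choose i : ℤ) := by
        rw [Finset.sum_mul_sum, Finset.sum_mul]
        simp only [Finset.sum_mul]
    _ = _ := by rw [h1, h2]; ring

lemma IsGau.smul {m : ℕ} {Ω : Type} [Fintype Ω] {U : Ω → ℤ}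
    {q A : ℤ} (hU : IsGau m U q A) (x : ℤ) :
    IsGau m (fun p => U p * x) q (x ^ 2 * A) := by
  intro n hn
  simp only [mul_pow]
  rw [← sum_mul, hU n hn, ← GG_scale]; ring

/-- One-dimensional quadrature. -/
def Quad : Prop := ∀ d : ℕ, ∃ (Ω : Type) (_ : Fintype Ω) (U : Ω → ℤ) (q A : ℤ),
  0 < q ∧ 0 < A ∧ IsGau (2 * d) U q A

/-- The basic equal-moments property. -/
def PTE (k : ℕ) : Prop := ∃ (ι : Type) (_ : Fintype ι) (B K : ℕ), 0 < B ∧ ∀ L : ℕ,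
  ∃ c : ℕ → ℤ, ∀ n : ℕ, n ≤ L → ∃ t : ι → ℤ, (∀ i, |t i| ≤ K * (L + 1) ^ K) ∧
    ∀ j ≤ k, ∑ i, t i ^ j = c j + if j = k then (B * n : ℤ) else 0

def PTEpos (k : ℕ) : Prop := ∃ (ι : Type) (_ : Fintype ι) (B K : ℕ), 0 < B ∧ ∀ L : ℕ,
  ∃ c : ℕ → ℤ, ∀ n : ℕ, n ≤ L → ∃ t : ι → ℕ, (∀ i, t i ≤ K * (L + 1) ^ K) ∧
    ∀ j ≤ k, ∑ i, (t i : ℤ) ^ j = c j + if j = k then (B * n : ℤ) else 0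

lemma PTE.pos {k : ℕ} (h : PTE k) : PTEpos k := by
  obtain ⟨ι, _, B, K, hB, h⟩ := h
  refine ⟨ι, inferInstance, B, 2 * K, hB, fun L => ?_⟩
  obtain ⟨c, hc⟩ := h L
  set T : ℕ := K * (L + 1) ^ K with hT
  refine ⟨fun j => ∑ i ∈ range (j + 1), c i * (T : ℤ) ^ (j - i) * (j.choose i : ℤ), fun n hn => ?_⟩
  obtain ⟨t, ht, hj⟩ := hc n hn
  have hb : ∀ i, 0 ≤ t i + T ∧ t i + T ≤ 2 * T := by
    intro i
    have := abs_le.1 (ht i)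
    have e : ((K : ℤ) * (L + 1) ^ K) = T := by rw [hT]; push_cast; rfl
    rw [e] at this
    constructor <;> linarith [this.1, this.2]
  refine ⟨fun i => (t i + T).toNat, fun i => ?_, fun j hjk => ?_⟩
  · have h2 : (t i + T).toNat ≤ 2 * T := by have := hb i; omega
    refine h2.trans ?_
    rw [hT, ← mul_assoc]
    apply Nat.mul_le_mul_left
    apply Nat.pow_le_pow_right <;> omega
  · have e : ∀ i, ((t i + T).toNat : ℤ) = t i + T := fun i => Int.toNat_of_nonneg (hb i).1
    simp only [e, add_pow]
    rw [sum_comm]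
    have : ∀ i ∈ range (j + 1), ∑ y, t y ^ i * (T : ℤ) ^ (j - i) * (j.choose i : ℤ) =
        c i * (T : ℤ) ^ (j - i) * (j.choose i : ℤ) + if i = k then (B * n : ℤ) else 0 := by
      intro i hi
      have hi' : i ≤ j := by simpa [Nat.lt_succ_iff] using hi
      rw [← sum_mul, ← sum_mul, hj i (hi'.trans hjk)]
      split_ifs with hik
      · have : j = k := by omega
        subst this; subst hik
        simp
      · ring
    rw [sum_congr rfl this, sum_add_distrib]
    congr 1
    rw [Finset.sum_ite_eq']
    by_cases hjk' : j = k
    · simp [hjk']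
    · rw [if_neg hjk', if_neg]
      simp; omega

lemma PTE_one : PTE 1 := by
  refine ⟨Unit, inferInstance, 1, 1, one_pos, fun L => ⟨fun j => if j = 0 then 1 else 0,
    fun n hn => ⟨fun _ => n, fun i => ?_, fun j hj => ?_⟩⟩⟩
  · simp; omega
  · interval_cases j <;> simp

lemma PTE_even (hQ : Quad) (d : ℕ) (hd : 1 ≤ d) (h : PTE d) : PTE (2 * d) := by
  obtain ⟨ι, _, B, K, hB, h⟩ := h.pos
  obtain ⟨Ω, _, U, q, A, hq, hA, hG⟩ := hQ d
  set m : ℤ := q * q * (q * q) * (gg d * A ^ d) with hm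
  have hmpos : 0 < m := by have := gg_pos d; positivity
  obtain ⟨W, hW⟩ : ∃ W : ℕ, ∀ ω, |U ω| ≤ W := by
    refine ⟨∑ ω, (U ω).natAbs, fun ω => ?_⟩
    rw [Int.abs_eq_natAbs]
    exact_mod_cast Finset.single_le_sum (f := fun ω => (U ω).natAbs) (fun _ _ => Nat.zero_le _)
      (mem_univ ω)
  refine ⟨ι × ((Ω × Ω) × (Ω × Ω)), inferInstance, B * m.toNat, 4 * W * K + K, ?_, fun L => ?_⟩
  · have : 0 < m.toNat := by omega
    positivity
  obtain ⟨c, hc⟩ := h L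
  refine ⟨fun j => if Even j then q * q * (q * q) * (gg (j / 2) * A ^ (j / 2)) * c (j / 2) else 0,
    fun n hn => ?_⟩
  obtain ⟨t, ht, htj⟩ := hc n hn
  choose a b c' d' hs using fun i => Nat.sum_four_squares (t i)
  refine ⟨fun p => (U p.2.1.1 * a p.1 + U p.2.1.2 * b p.1) + (U p.2.2.1 * c' p.1 + U p.2.2.2 * d' p.1),
    fun p => ?_, fun j hj => ?_⟩
  · obtain ⟨i, ⟨⟨w1, w2⟩, ⟨w3, w4⟩⟩⟩ := p
    simp only
    have sq : ∀ x : ℕ, x ≤ x ^ 2 := fun x => Nat.le_self_pow two_ne_zero x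
    have key : ∀ w, ∀ x : ℕ, x ≤ t i → |U w * (x : ℤ)| ≤ W * t i := by
      intro w x hx
      rw [abs_mul]
      have : |(x : ℤ)| ≤ t i := by rw [abs_of_nonneg (by positivity)]; exact_mod_cast hx
      exact mul_le_mul (hW w) this (abs_nonneg _) (by positivity)
    have k1 := key w1 (a i) (by have := hs i; have := sq (a i); omega)
    have k2 := key w2 (b i) (by have := hs i; have := sq (b i); omega)
    have k3 := key w3 (c' i) (by have := hs i; have := sq (c' i); omega)
    have k4 := key w4 (d' i) (by have := hs i; have := sq (d' i); omega)
    have tt : (t i : ℤ) ≤ K * (L + 1) ^ K := by exact_mod_cast ht i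
    calc _ ≤ 4 * (W * (t i : ℤ)) := by
          rw [abs_le] at *
          constructor <;> linarith [k1.1, k2.1, k3.1, k4.1, k1.2, k2.2, k3.2, k4.2]
      _ ≤ 4 * (W * (K * (L + 1) ^ K)) := by gcongr
      _ = (4 * W * K) * (L + 1) ^ K := by ring
      _ ≤ ((4 * W * K + K : ℕ) : ℤ) * (L + 1) ^ (4 * W * K + K) := by
          push_cast
          apply mul_le_mul
          · have : (0 : ℤ) ≤ K := by positivity
            linarith
          · apply pow_le_pow_right₀ <;> [(have : (0 : ℤ) ≤ L := by positivity); skip]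
            · linarith
            · omega
          · positivity
          · positivity
  · rw [Fintype.sum_prod_type]
    have e : ∀ i, ∑ p : (Ω × Ω) × (Ω × Ω), ((U p.1.1 * a i + U p.1.2 * b i) +
        (U p.2.1 * c' i + U p.2.2 * d' i)) ^ j = q * q * (q * q) * GG j (t i * A) := by
      intro i
      have := (((hG.smul (a i)).add (hG.smul (b i))).add ((hG.smul (c' i)).add (hG.smul (d' i)))) j hj
      rw [this]
      congr 2
      have : (t i : ℤ) = a i ^ 2 + b i ^ 2 + c' i ^ 2 + d' i ^ 2 := by
        exact_mod_cast (hs i).symm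
      rw [this]; ring
    simp only [e]
    rw [← mul_sum]
    unfold GG
    by_cases hev : Even j
    · obtain ⟨l, rfl⟩ := hev
      have hl : (l + l) / 2 = l := by omega
      simp only [hl, Even.add_self, if_true, mul_pow]
      rw [← mul_sum, ← sum_mul, htj l (by omega)]
      by_cases hld : l = d
      · subst hld
        simp only [if_true, if_pos (two_mul l).symm]
        push_cast
        rw [Int.toNat_of_nonneg hmpos.le, hm]
        ring
      · rw [if_neg hld, if_neg (by omega)]
        ring
    · have : j ≠ 2 * d := by rintro rfl; simp at hev
      simp [hev, this]

lemma PTE_odd (d : ℕ) (hd : 1 ≤ d) (h : PTE (2 * d)) : PTE (2 * d + 1) := by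
  obtain ⟨ι, _, B, K, hB, h⟩ := h
  refine ⟨(ι ⊕ ι) ⊕ (ι ⊕ ι), inferInstance, 4 * (2 * d + 1) * B, K + 1, by positivity, fun L => ?_⟩
  obtain ⟨c, hc⟩ := h L
  set E : ℕ → ℤ := fun j => ∑ i ∈ range (j + 1), (if Even i then 2 * c i * (j.choose i : ℤ) else 0)
    with hE
  refine ⟨fun j => if j = 2 * d + 1 then - (2 * (2 * d + 1) * B * L) else if j = 2 * d then
    2 * E j + 2 * B * L else if Even j then 2 * E j else 0, fun n hn => ?_⟩
  obtain ⟨u, hu, huj⟩ := hc n hn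
  obtain ⟨v, hv, hvj⟩ := hc (L - n) (by omega)
  have key : ∀ (w : ι → ℤ) (N : ℤ), (∀ j ≤ 2 * d, ∑ i, w i ^ j = c j + if j = 2 * d then (B * N : ℤ) else 0) →
      ∀ j ≤ 2 * d + 1, ∑ i, (w i + 1) ^ j + ∑ i, (-w i + 1) ^ j = E j + 
        (if j = 2 * d then 2 * B * N else 0) + (if j = 2 * d + 1 then 2 * (2 * d + 1) * B * N else 0) := by
    intro w N hw j hj
    simp only [add_pow, one_pow, mul_one]
    rw [sum_comm, sum_comm (s := univ), ← sum_add_distrib]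
    have : ∀ i ∈ range (j + 1), ∑ y, w y ^ i * (j.choose i : ℤ) + ∑ y, (-w y) ^ i * (j.choose i : ℤ) =
        (if Even i then 2 * c i * (j.choose i : ℤ) else 0) +
          if i = 2 * d then 2 * B * N * (j.choose (2 * d) : ℤ) else 0 := by
      intro i hi
      have hi' : i ≤ j := by simpa [Nat.lt_succ_iff] using hi
      rw [← sum_mul, ← sum_mul]
      by_cases hev : Even i
      · have : i ≤ 2 * d := by
          rcases hev with ⟨l, rfl⟩; omega
        simp only [hev.neg_pow, if_pos hev]
        rw [hw i this]
        split_ifs with hid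
        · subst hid; ring
        · ring
      · have : i ≠ 2 * d := by rintro rfl; simp at hev
        simp only [(Nat.not_even_iff_odd.1 hev).neg_pow, if_neg hev, if_neg this]
        simp
    rw [sum_congr rfl this, sum_add_distrib, add_assoc]
    congr 1
    rw [Finset.sum_ite_eq']
    rcases lt_trichotomy j (2 * d) with h | h | h
    · rw [if_neg (by simp; omega), if_neg (by omega), if_neg (by omega)]; simp
    · subst h; simp
    · have : j = 2 * d + 1 := by omega
      subst this
      simp
      ring
  have ku := key u n huj
  have kv := key v (L - n) (by
    intro j hj; rw [hvj j hj, Nat.cast_sub hn])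
  refine ⟨Sum.elim (Sum.elim (fun i => u i + 1) (fun i => -u i + 1))
    (Sum.elim (fun i => -(v i + 1)) (fun i => -(-v i + 1))), fun i => ?_, fun j hj => ?_⟩
  · have hb : (K : ℤ) * (L + 1) ^ K + 1 ≤ ((K + 1 : ℕ) : ℤ) * (L + 1) ^ (K + 1) := by
      have h1 : (1 : ℤ) ≤ (L + 1) ^ K := one_le_pow₀ (by omega)
      have h2 : ((L : ℤ) + 1) ^ K ≤ (L + 1) ^ (K + 1) := pow_le_pow_right₀ (by omega) (by omega)
      push_cast
      nlinarith [mul_le_mul_of_nonneg_left h2 (show (0 : ℤ) ≤ K by positivity)]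
    refine le_trans ?_ hb
    rcases i with (i | i) | (i | i) <;> simp only [Sum.elim_inl, Sum.elim_inr]
    · have := abs_le.1 (hu i); rw [abs_le]; constructor <;> linarith [this.1, this.2]
    · have := abs_le.1 (hu i); rw [abs_le]; constructor <;> linarith [this.1, this.2]
    · have := abs_le.1 (hv i); rw [abs_le]; constructor <;> linarith [this.1, this.2]
    · have := abs_le.1 (hv i); rw [abs_le]; constructor <;> linarith [this.1, this.2]
  · simp only [Fintype.sum_sum_type, Sum.elim_inl, Sum.elim_inr]
    rw [ku j hj]
    by_cases hev : Even j
    · simp only [hev.neg_pow]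
      rw [kv j hj]
      have : j ≠ 2 * d + 1 := by rintro rfl; simp at hev
      simp only [if_neg this, if_pos hev]
      split_ifs <;> ring
    · have : j ≠ 2 * d := by rintro rfl; simp at hev
      simp only [(Nat.not_even_iff_odd.1 hev).neg_pow, sum_neg_distrib]
      rw [← neg_add, kv j hj]
      simp only [if_neg this, if_neg hev]
      split_ifs <;> push_cast <;> ring

lemma PTE_all (hQ : Quad) (k : ℕ) (hk : 1 ≤ k) : PTE k := by
  induction k using Nat.strong_induction_on with
  | _ k ih =>
    rcases Nat.even_or_odd' k with ⟨d, rfl | rfl⟩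
    · exact PTE_even hQ d (by omega) (ih d (by omega) (by omega))
    · rcases Nat.eq_zero_or_pos d with rfl | hd
      · exact PTE_one
      · exact PTE_odd d hd (ih (2 * d) (by omega) (by omega))
open MeasureTheory in
lemma gauss_moment (j : ℕ) :
    IntegrableOn (fun u : ℝ => u ^ (2 * j) * Real.exp (-u ^ 2)) (Set.Ioi 0) ∧
    ∫ u in Set.Ioi (0 : ℝ), u ^ (2 * j) * Real.exp (-u ^ 2) =
      (√Real.pi / 2) * ((gg j : ℝ) / 2 ^ j) := by
  have hq : (-1 : ℝ) < ((2 * j : ℕ) : ℝ) := by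
    have : (0 : ℝ) ≤ ((2 * j : ℕ) : ℝ) := by positivity
    linarith
  have h1 := integrableOn_rpow_mul_exp_neg_rpow (p := 2) hq (by norm_num)
  have h2 := integral_rpow_mul_exp_neg_rpow (p := 2) (by norm_num) hq
  have e : (fun x : ℝ => x ^ ((2 * j : ℕ) : ℝ) * Real.exp (-x ^ (2 : ℝ))) =
      fun u : ℝ => u ^ (2 * j) * Real.exp (-u ^ 2) := by
    funext x
    rw [Real.rpow_natCast, Real.rpow_two]
  rw [e] at h1 h2
  refine ⟨h1, ?_⟩
  rw [h2]
  have : (((2 * j : ℕ) : ℝ) + 1) / 2 = j + 1 / 2 := by push_cast; ring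
  rw [this, Real.Gamma_nat_add_half]
  unfold gg
  ring

noncomputable def mom (d : ℕ) : Fin d → ℝ := fun j => (gg (j + 1) : ℝ) / 2 ^ ((j : ℕ) + 1)
noncomputable def crv (d : ℕ) (u : ℝ) : Fin d → ℝ := fun j => u ^ (2 * ((j : ℕ) + 1))

lemma dual_eq {d : ℕ} (φ : (Fin d → ℝ) →ₗ[ℝ] ℝ) : ∃ a : Fin d → ℝ, ∀ x, φ x = ∑ j, x j * a j :=
  ⟨fun i => φ fun j => if i = j then 1 else 0, fun x => by
    rw [LinearMap.pi_apply_eq_sum_univ]; simp⟩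

lemma span_crv (d : ℕ) : affineSpan ℝ (Set.range fun u : ℚ => crv d (u : ℝ)) = ⊤ := by
  have h0 : (0 : Fin d → ℝ) ∈ Set.range fun u : ℚ => crv d (u : ℝ) := by
    refine ⟨0, ?_⟩
    funext j
    simp [crv]
  rw [AffineSubspace.affineSpan_eq_top_iff_vectorSpan_eq_top_of_nonempty _ _ _ ⟨0, h0⟩,
    vectorSpan_eq_span_vsub_set_right _ h0]
  by_contra hne
  obtain ⟨φ, hφ, hle⟩ := Submodule.exists_le_ker_of_lt_top _ (lt_top_iff_ne_top.2 hne)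
  obtain ⟨a, ha⟩ := dual_eq φ
  have hz : ∀ u : ℚ, ∑ j, crv d (u : ℝ) j * a j = 0 := by
    intro u
    rw [← ha]
    have : crv d (u : ℝ) ∈ LinearMap.ker φ := by
      apply hle
      apply Submodule.subset_span
      exact ⟨crv d (u : ℝ), ⟨u, rfl⟩, by simp⟩
    simpa using this
  set P : Polynomial ℝ := ∑ j : Fin d, Polynomial.C (a j) * Polynomial.X ^ (2 * ((j : ℕ) + 1)) with hP
  have hP0 : P = 0 := by
    apply Polynomial.eq_zero_of_infinite_isRoot
    apply Set.Infinite.mono (s := Set.range fun u : ℚ => (u : ℝ))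
    · rintro _ ⟨u, rfl⟩
      have := hz u
      simp only [Set.mem_ofPred_eq, Polynomial.IsRoot.def, hP, Polynomial.eval_finsetSum,
        Polynomial.eval_mul, Polynomial.eval_C, Polynomial.eval_pow, Polynomial.eval_X]
      rw [← this]
      apply sum_congr rfl
      intro j _
      simp [crv, mul_comm]
    · exact Set.infinite_range_of_injective Rat.cast_injective
  apply hφ
  apply LinearMap.ext
  intro x
  rw [ha]
  simp only [LinearMap.zero_apply]
  apply sum_eq_zero
  intro j _
  have : P.coeff (2 * ((j : ℕ) + 1)) = a j := by
    rw [hP, Polynomial.finsetSum_coeff]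
    simp only [Polynomial.coeff_C_mul, Polynomial.coeff_X_pow]
    rw [Finset.sum_eq_single j]
    · simp
    · intro b _ hb
      rw [if_neg, mul_zero]
      intro h
      apply hb
      apply Fin.ext
      omega
    · simp
  rw [hP0] at this
  simp at this
  rw [← this, mul_zero]

open MeasureTheory in
lemma mom_mem (d : ℕ) : mom d ∈ convexHull ℝ (Set.range fun u : ℚ => crv d (u : ℝ)) := by
  set S := Set.range fun u : ℚ => crv d (u : ℝ) with hS
  by_contra hg
  have hconv : Convex ℝ (convexHull ℝ S) := convex_convexHull ℝ S
  have hne : (interior (convexHull ℝ S)).Nonempty :=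
    interior_convexHull_nonempty_iff_affineSpan_eq_top.2 (span_crv d)
  obtain ⟨φ, hφ⟩ := geometric_hahn_banach_open_point hconv.interior isOpen_interior
    (fun h => hg (interior_subset h))
  have hle : ∀ x ∈ convexHull ℝ S, φ x ≤ φ (mom d) := by
    intro x hx
    have hx' : x ∈ closure (interior (convexHull ℝ S)) := by
      rw [hconv.closure_interior_eq_closure_of_nonempty_interior hne]
      exact subset_closure hx
    have hcl : IsClosed {y : Fin d → ℝ | φ y ≤ φ (mom d)} :=
      isClosed_le φ.continuous continuous_const
    exact hcl.closure_subset_iff.2 (fun y hy => (hφ y hy).le) hx'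
  obtain ⟨a, ha⟩ := dual_eq φ.toLinearMap
  have ha' : ∀ x, φ x = ∑ j, x j * a j := ha
  set H : ℝ → ℝ := fun u => φ (mom d) - ∑ j, crv d u j * a j with hH
  have hHc : Continuous H := by
    rw [hH]; unfold crv; fun_prop
  have hH0 : ∀ u, 0 ≤ H u := by
    intro u
    have hcl : IsClosed {u | 0 ≤ H u} := isClosed_le continuous_const hHc
    have : closure (Set.range (Rat.cast : ℚ → ℝ)) ⊆ {u | 0 ≤ H u} := by
      apply hcl.closure_subset_iff.2
      rintro _ ⟨v, rfl⟩
      have := hle (crv d v) (subset_convexHull ℝ S ⟨v, rfl⟩)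
      rw [ha' (crv d v)] at this
      simp only [Set.mem_ofPred_eq, hH]
      linarith
    apply this
    rw [Rat.denseRange_cast.closure_range]
    trivial
  have hfun : ∀ u : ℝ, H u * Real.exp (-u ^ 2) = φ (mom d) * (u ^ (2 * 0) * Real.exp (-u ^ 2)) -
      ∑ j : Fin d, a j * (u ^ (2 * ((j : ℕ) + 1)) * Real.exp (-u ^ 2)) := by
    intro u
    simp only [hH, crv]
    rw [sub_mul, Finset.sum_mul]
    congr 1
    · simp
    · apply sum_congr rfl; intro j _; ring
  have hi1 : IntegrableOn (fun u : ℝ => φ (mom d) * (u ^ (2 * 0) * Real.exp (-u ^ 2))) (Set.Ioi 0) :=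
    ((gauss_moment 0).1).const_mul _
  have hi2 : ∀ j ∈ (univ : Finset (Fin d)), IntegrableOn (fun u : ℝ =>
      a j * (u ^ (2 * ((j : ℕ) + 1)) * Real.exp (-u ^ 2))) (Set.Ioi 0) :=
    fun j _ => ((gauss_moment (j + 1)).1).const_mul _
  have hi : IntegrableOn (fun u : ℝ => H u * Real.exp (-u ^ 2)) (Set.Ioi 0) := by
    simp only [hfun]
    exact hi1.sub (integrable_finsetSum _ hi2)
  have hzero_int : ∫ u in Set.Ioi (0 : ℝ), H u * Real.exp (-u ^ 2) = 0 := by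
    simp only [hfun]
    rw [integral_sub hi1 (integrable_finsetSum _ hi2), integral_finsetSum _ hi2]
    simp only [integral_const_mul, (gauss_moment _).2]
    rw [ha']
    simp only [mom]
    have : gg 0 = 1 := rfl
    rw [this]
    simp only [Nat.cast_one, pow_zero, div_one, mul_one, Finset.sum_mul]
    rw [← Finset.sum_sub_distrib]
    apply sum_eq_zero
    intro j _
    ring
  rw [setIntegral_eq_zero_iff_of_nonneg_ae
    (Filter.Eventually.of_forall fun u => mul_nonneg (hH0 u) (Real.exp_pos _).le) hi] at hzero_int
  have hz := Measure.eqOn_open_of_ae_eq hzero_int isOpen_Ioi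
    (by fun_prop) (by fun_prop)
  have hz1 : ∀ u ∈ Set.Ioi (0 : ℝ), H u = 0 := by
    intro u hu
    have := hz hu
    simpa using this
  have hz2 : ∀ u ∈ Set.Ici (0 : ℝ), H u = 0 := by
    have hcl : IsClosed {u | H u = 0} := isClosed_eq hHc continuous_const
    intro u hu
    rw [← closure_Ioi] at hu
    exact hcl.closure_subset_iff.2 hz1 hu
  have hgz : φ (mom d) = 0 := by
    have := hz2 0 (by simp)
    simp only [hH, crv] at this
    simpa using this
  have hall : ∀ x ∈ convexHull ℝ S, φ x = 0 := by
    have hsub : convexHull ℝ S ⊆ {x | φ x = 0} := by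
      apply convexHull_min
      · rintro _ ⟨v, rfl⟩
        have := hz2 |(v : ℝ)| (Set.mem_Ici.2 (abs_nonneg _))
        simp only [hH, hgz, crv, pow_mul, sq_abs] at this
        simp only [Set.mem_ofPred_eq, ha', crv, pow_mul]
        linarith
      · exact convex_hyperplane (f := φ) ⟨map_add φ, map_smul φ⟩ 0
    exact hsub
  obtain ⟨y, hy⟩ := hne
  have h1 := hφ y hy
  rw [hgz, hall y (interior_subset hy)] at h1
  exact lt_irrefl _ h1

lemma common_den {ι : Type} [Fintype ι] (u : ι → ℚ) :
    ∃ D : ℕ, 0 < D ∧ ∃ a : ι → ℤ, ∀ i, u i * D = a i := by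
  refine ⟨∏ i, (u i).den, Finset.prod_pos fun i _ => (u i).den_pos, ?_⟩
  have : ∀ i, ∃ a : ℤ, u i * ((∏ i, (u i).den : ℕ) : ℚ) = a := by
    intro i
    obtain ⟨m, hm⟩ := Finset.dvd_prod_of_mem (fun i => (u i).den) (mem_univ i)
    refine ⟨(u i).num * m, ?_⟩
    rw [hm]
    push_cast
    rw [← mul_assoc, Rat.mul_den_eq_num]
  choose a ha using this
  exact ⟨a, ha⟩

lemma rat_quad (d : ℕ) : ∃ (ι : Type) (_ : Fintype ι) (u w : ι → ℚ), (∀ i, 0 < w i) ∧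
    ∀ j ≤ d, ∑ i, w i * u i ^ (2 * j) = (gg j : ℚ) / 2 ^ j := by
  obtain ⟨ι, _, z, w, hz, hind, hw, hw1, hsum⟩ := eq_pos_convex_span_of_mem_convexHull (mom_mem d)
  have : ∀ i, ∃ u : ℚ, crv d (u : ℝ) = z i := fun i => hz ⟨i, rfl⟩
  choose u hu using this
  obtain ⟨π, hπ⟩ := LinearMap.exists_leftInverse_of_injective (Algebra.linearMap ℚ ℝ)
    (LinearMap.ker_eq_bot.2 (by intro a b h; simpa using h))
  have hπr : ∀ x : ℚ, π (x : ℝ) = x := by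
    intro x
    have := LinearMap.congr_fun hπ x
    simpa using this
  have hπm : ∀ (x : ℚ) (y : ℝ), π (y * x) = π y * x := by
    intro x y
    have := π.map_smul x y
    rw [Rat.smul_def, mul_comm] at this
    rw [this, smul_eq_mul, mul_comm]
  have s0 : ∑ i, π (w i) = 1 := by
    rw [← map_sum, hw1]
    exact_mod_cast hπr 1
  have sj : ∀ j : Fin d, ∑ i, w i * ((u i ^ (2 * ((j : ℕ) + 1)) : ℚ) : ℝ) =
      (((gg (j + 1) : ℚ) / 2 ^ ((j : ℕ) + 1) : ℚ) : ℝ) := by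
    intro j
    have := congrFun hsum j
    simp only [← hu, Finset.sum_apply, Pi.smul_apply, smul_eq_mul, crv, mom] at this
    push_cast
    exact this
  have sj' : ∀ j : Fin d, ∑ i, π (w i) * u i ^ (2 * ((j : ℕ) + 1)) =
      (gg (j + 1) : ℚ) / 2 ^ ((j : ℕ) + 1) := by
    intro j
    have := congrArg π (sj j)
    rw [hπr, map_sum] at this
    simpa only [hπm] using this
  have heq : ∀ i, w i = (π (w i) : ℝ) := by
    have := (affineIndependent_iff.1 hind) univ (fun i => w i - (π (w i) : ℝ)) (by
      rw [Finset.sum_sub_distrib, hw1, ← Rat.cast_sum, s0]; simp) (by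
      funext j
      have h1 := sj j
      rw [← sj' j] at h1
      push_cast at h1
      simp only [← hu, Finset.sum_apply, Pi.smul_apply, smul_eq_mul, crv, sub_mul,
        Finset.sum_sub_distrib, Pi.zero_apply]
      rw [h1, sub_self])
    intro i
    linarith [this i (mem_univ i)]
  refine ⟨ι, inferInstance, u, fun i => π (w i), fun i => ?_, fun j hj => ?_⟩
  · have := hw i
    rw [heq i] at this
    exact_mod_cast this
  · rcases j with _ | j
    · simp only [mul_zero, pow_zero, mul_one, s0]
      simp [gg]
    · exact sj' ⟨j, by omega⟩

lemma quad : Quad := by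
  intro d
  obtain ⟨ι, _, u, w, hw, h⟩ := rat_quad d
  obtain ⟨D, hD, a, ha⟩ := common_den u
  obtain ⟨P, hP, p, hp⟩ := common_den w
  have hp0 : ∀ i, 0 ≤ p i := by
    intro i
    have h1 : (0 : ℚ) ≤ p i := by
      rw [← hp i]; have := hw i; positivity
    exact_mod_cast h1
  refine ⟨(Σ i, Fin (p i).toNat) × Bool, inferInstance,
    fun x => if x.2 then 2 * a x.1.1 else -(2 * a x.1.1), 2 * P, 2 * D ^ 2, by positivity,
    by positivity, ?_⟩
  intro n hn
  rw [Fintype.sum_prod_type]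
  simp only [Fintype.sum_bool, if_true, Bool.false_eq_true, if_false]
  unfold GG
  by_cases hev : Even n
  · simp only [hev.neg_pow, if_pos hev]
    obtain ⟨j, rfl⟩ := hev
    have hj : (j + j) / 2 = j := by omega
    rw [hj, ← two_mul, Fintype.sum_sigma]
    simp only [Finset.sum_const, Finset.card_univ, Fintype.card_fin, nsmul_eq_mul]
    have e : ∀ i, ((p i).toNat : ℤ) = p i := fun i => Int.toNat_of_nonneg (hp0 i)
    have hh := h j (by omega)
    have : ((∑ i, ((p i).toNat : ℤ) * ((2 * a i) ^ (2 * j) + (2 * a i) ^ (2 * j)) : ℤ) : ℚ) =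
        ((2 * P * (gg j * (2 * D ^ 2) ^ j) : ℤ) : ℚ) := by
      simp only [e]
      push_cast
      simp only [← hp, ← ha]
      have h2 : ∀ i, w i * P * ((2 * (u i * D)) ^ (2 * j) + (2 * (u i * D)) ^ (2 * j)) =
          (2 * P * (4 * D ^ 2) ^ j) * (w i * u i ^ (2 * j)) := by
        intro i
        rw [pow_mul, pow_mul]
        have : (2 * (u i * D)) ^ 2 = (4 * (D : ℚ) ^ 2) * u i ^ 2 := by ring
        rw [this, mul_pow (4 * (D : ℚ) ^ 2)]
        ring
      simp only [h2]
      rw [← mul_sum, hh]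
      have : (4 * (D : ℚ) ^ 2) = 2 * (2 * D ^ 2) := by ring
      rw [this, mul_pow 2 (2 * (D : ℚ) ^ 2)]
      field_simp
    exact_mod_cast this
  · simp only [(Nat.not_even_iff_odd.1 hev).neg_pow, if_neg hev]
    simp
lemma r_local (k : ℕ) (hk : 1 ≤ k) (δ : ℝ) (hδ : δ < 1 / 2)
    (r : ℝ → ℝ) (hr : ContDiffOn ℝ k r (Set.Ici 1))
    (hbound : ∀ j : ℕ, j ≤ k → ∃ Cj : ℝ, ∀ x : ℝ, 1 ≤ x →
      |iteratedDerivWithin j r (Set.Ici 1) x| ≤ Cj * x ^ (δ - j)) :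
    ∃ C : ℝ, 0 ≤ C ∧ ∀ x t : ℝ, 1 ≤ x → 0 ≤ t → t ^ 2 ≤ x → |r (x + t) - r x| ≤ C := by
  obtain ⟨C, hC⟩ := hbound 1 hk
  refine ⟨|C|, abs_nonneg _, fun x t hx ht htx => ?_⟩
  have hdiff : DifferentiableOn ℝ r (Set.Ici 1) := hr.differentiableOn (by
    simp; omega)
  have hsub : Set.Ici x ⊆ Set.Ici (1 : ℝ) := Set.Ici_subset_Ici.2 hx
  have h1 : ∀ z ∈ Set.Ici x, HasDerivWithinAt r (derivWithin r (Set.Ici 1) z) (Set.Ici x) z :=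
    fun z hz => (hdiff z (hsub hz)).hasDerivWithinAt.mono hsub
  have h2 : ∀ z ∈ Set.Ici x, ‖derivWithin r (Set.Ici 1) z‖ ≤ |C| * x ^ (δ - 1) := by
    intro z hz
    have h := hC z (hsub hz)
    rw [iteratedDerivWithin_one] at h
    rw [Real.norm_eq_abs]
    refine h.trans ?_
    have hz' : x ≤ z := hz
    have hz0 : 0 < z := by linarith
    calc C * z ^ (δ - (1 : ℕ)) ≤ |C| * z ^ (δ - (1 : ℕ)) := by
          gcongr; exact le_abs_self C
      _ ≤ |C| * x ^ (δ - 1) := by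
          rw [Nat.cast_one]
          exact mul_le_mul_of_nonneg_left
            (Real.rpow_le_rpow_of_nonpos (show 0 < x by linarith) hz' (by linarith)) (abs_nonneg C)
  have h3 := Convex.norm_image_sub_le_of_norm_hasDerivWithin_le h1 h2 (convex_Ici x)
    (Set.mem_Ici.2 le_rfl) (show x + t ∈ Set.Ici x by simpa using ht)
  rw [Real.norm_eq_abs, Real.norm_eq_abs, add_sub_cancel_left, abs_of_nonneg ht] at h3
  refine h3.trans ?_
  have hx0 : 0 < x := by linarith
  have h4 : t ≤ x ^ (1 / 2 : ℝ) := by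
    rw [← Real.sqrt_eq_rpow]
    exact Real.le_sqrt_of_sq_le htx
  have h5 : x ^ (δ - 1) * x ^ (1 / 2 : ℝ) ≤ 1 := by
    rw [← Real.rpow_add hx0]
    exact Real.rpow_le_one_of_one_le_of_nonpos hx (by linarith)
  calc |C| * x ^ (δ - 1) * t ≤ |C| * x ^ (δ - 1) * x ^ (1 / 2 : ℝ) := by gcongr
    _ = |C| * (x ^ (δ - 1) * x ^ (1 / 2 : ℝ)) := by ring
    _ ≤ |C| * 1 := by gcongr
    _ = |C| := mul_one _

lemma f_growth (k : ℕ) (hk : 1 ≤ k) (α : ℕ → ℝ) (hα : 0 < α k)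
    (δ : ℝ) (hδ : δ < 1 / 2)
    (r : ℝ → ℝ)
    (hbound : ∀ j : ℕ, j ≤ k → ∃ Cj : ℝ, ∀ x : ℝ, 1 ≤ x →
      |iteratedDerivWithin j r (Set.Ici 1) x| ≤ Cj * x ^ (δ - j))
    (f : ℝ → ℝ) (hf : ∀ x : ℝ, f x = (∑ i ∈ Finset.Icc 1 k, α i * x ^ i) + r x) :
    ∃ x0 : ℕ, 1 ≤ x0 ∧ ∀ x : ℝ, x0 ≤ x → α k / 2 * x ^ k ≤ f x ∧ f x ≤ 2 * α k * x ^ k := by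
  obtain ⟨C, hC⟩ := hbound 0 (by omega)
  have hr0 : Filter.Tendsto (fun x : ℝ => r x / x ^ k) Filter.atTop (nhds 0) := by
    have h1 : Filter.Tendsto (fun x : ℝ => |C| * x ^ (-(1 - δ))) Filter.atTop (nhds 0) := by
      have := (tendsto_rpow_neg_atTop (y := 1 - δ) (by linarith)).const_mul |C|
      simpa using this
    apply squeeze_zero_norm' _ h1
    filter_upwards [Filter.eventually_ge_atTop 1] with x hx
    have hx0 : 0 < x := by linarith
    have h := hC x hx
    rw [iteratedDerivWithin_zero] at h
    rw [Real.norm_eq_abs, abs_div, abs_of_pos (pow_pos hx0 k), div_le_iff₀ (pow_pos hx0 k)]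
    calc |r x| ≤ C * x ^ (δ - (0 : ℕ)) := h
      _ ≤ |C| * x ^ (δ - (0 : ℕ)) := by gcongr; exact le_abs_self C
      _ = |C| * x ^ (-(1 - δ)) * x ^ 1 := by
          rw [mul_assoc, ← Real.rpow_natCast x 1, ← Real.rpow_add hx0]
          congr 2
          push_cast
          ring
      _ ≤ |C| * x ^ (-(1 - δ)) * x ^ k := by
          gcongr
  have hp : Filter.Tendsto (fun x : ℝ => ∑ i ∈ Finset.Icc 1 k, α i * (x ^ i / x ^ k)) Filter.atTop
      (nhds (∑ i ∈ Finset.Icc 1 k, if i = k then α k else 0)) := by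
    apply tendsto_finsetSum
    intro i hi
    rw [Finset.mem_Icc] at hi
    split_ifs with hik
    · subst hik
      apply Filter.Tendsto.congr' _ tendsto_const_nhds
      filter_upwards [Filter.eventually_gt_atTop 0] with x hx
      rw [div_self (pow_pos hx _).ne', mul_one]
    · have := (tendsto_pow_div_pow_atTop_zero (𝕜 := ℝ) (p := i) (q := k) (by omega)).const_mul (α i)
      simpa using this
  rw [Finset.sum_ite_eq', if_pos (by simp [hk])] at hp
  have hsum := hp.add hr0
  rw [add_zero] at hsum
  have hev := hsum.eventually (Icc_mem_nhds (show α k / 2 < α k by linarith)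
    (show α k < 2 * α k by linarith))
  obtain ⟨a, ha⟩ := Filter.eventually_atTop.1 hev
  refine ⟨max 1 ⌈a⌉₊, le_max_left _ _, fun x hx => ?_⟩
  have hx1 : (1 : ℝ) ≤ x := le_trans (by exact_mod_cast le_max_left 1 ⌈a⌉₊) hx
  have hxa : a ≤ x := (Nat.le_ceil a).trans (le_trans (by exact_mod_cast le_max_right 1 ⌈a⌉₊) hx)
  have hxk : 0 < x ^ k := by positivity
  have e : (∑ i ∈ Finset.Icc 1 k, α i * (x ^ i / x ^ k)) + r x / x ^ k = f x / x ^ k := by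
    rw [hf, add_div, Finset.sum_div]
    congr 1
    apply Finset.sum_congr rfl
    intro i _
    ring
  have := ha x hxa
  simp only [e] at this
  rw [le_div_iff₀ hxk, div_le_iff₀ hxk] at this
  exact this

lemma pow_step (i : ℕ) (x : ℝ) (hx : 1 ≤ x) : x * ((x + 1) ^ i - x ^ i) ≤ 3 ^ i * x ^ i := by
  induction i with
  | zero => simp
  | succ i ih =>
    have hp : 0 < x ^ i := by positivity
    have h3 : (1 : ℝ) ≤ 3 ^ i := one_le_pow₀ (by norm_num)
    calc x * ((x + 1) ^ (i + 1) - x ^ (i + 1))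
        = (x + 1) * (x * ((x + 1) ^ i - x ^ i)) + x ^ i * x := by ring
      _ ≤ (x + 1) * (3 ^ i * x ^ i) + x ^ i * x := by gcongr
      _ ≤ (2 * x) * (3 ^ i * x ^ i) + 3 ^ i * (x ^ i * x) := by
          have h5 : x ^ i * x ≤ 3 ^ i * (x ^ i * x) := le_mul_of_one_le_left (by positivity) h3
          have h6 : (x + 1) * (3 ^ i * x ^ i) ≤ (2 * x) * (3 ^ i * x ^ i) := by
            gcongr; linarith
          linarith
      _ = 3 ^ (i + 1) * x ^ (i + 1) := by ring

lemma f_step (k : ℕ) (hk : 1 ≤ k) (α : ℕ → ℝ)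
    (r : ℝ → ℝ) (C1 : ℝ) (hC0 : 0 ≤ C1)
    (hloc : ∀ x t : ℝ, 1 ≤ x → 0 ≤ t → t ^ 2 ≤ x → |r (x + t) - r x| ≤ C1)
    (f : ℝ → ℝ) (hf : ∀ x : ℝ, f x = (∑ i ∈ Finset.Icc 1 k, α i * x ^ i) + r x) :
    ∃ C : ℝ, 0 ≤ C ∧ ∀ x : ℝ, 1 ≤ x → f (x + 1) - f x ≤ C * x ^ (k - 1) := by
  refine ⟨(∑ i ∈ Finset.Icc 1 k, |α i| * 3 ^ i) + C1, by positivity, fun x hx => ?_⟩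
  have hx0 : 0 < x := by linarith
  have h1 := hloc x 1 hx zero_le_one (by linarith)
  rw [hf, hf]
  have h2 : ∀ i ∈ Finset.Icc 1 k, α i * (x + 1) ^ i - α i * x ^ i ≤ |α i| * 3 ^ i * x ^ (k - 1) := by
    intro i hi
    rw [Finset.mem_Icc] at hi
    have hmono : 0 ≤ (x + 1) ^ i - x ^ i := by
      have : x ^ i ≤ (x + 1) ^ i := by gcongr; linarith
      linarith
    have h3 : (x + 1) ^ i - x ^ i ≤ 3 ^ i * x ^ (k - 1) := by
      have h4 := pow_step i x hx
      have h5 : x ^ i ≤ x * x ^ (k - 1) := by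
        rw [← pow_succ']
        exact pow_le_pow_right₀ hx (by omega)
      have h6 : x * ((x + 1) ^ i - x ^ i) ≤ x * (3 ^ i * x ^ (k - 1)) := by
        calc _ ≤ 3 ^ i * x ^ i := h4
          _ ≤ 3 ^ i * (x * x ^ (k - 1)) := by gcongr
          _ = _ := by ring
      exact le_of_mul_le_mul_left h6 hx0
    calc α i * (x + 1) ^ i - α i * x ^ i = α i * ((x + 1) ^ i - x ^ i) := by ring
      _ ≤ |α i| * ((x + 1) ^ i - x ^ i) := by gcongr; exact le_abs_self _
      _ ≤ |α i| * (3 ^ i * x ^ (k - 1)) := by gcongr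
      _ = _ := by ring
  have h3 := Finset.sum_le_sum h2
  rw [Finset.sum_sub_distrib, ← Finset.sum_mul] at h3
  have h4 : C1 ≤ C1 * x ^ (k - 1) := le_mul_of_one_le_right hC0 (one_le_pow₀ hx)
  have h5 := (abs_le.1 h1).2
  rw [add_mul]
  linarith

lemma greedy_one (k : ℕ) (hk : 1 ≤ k) (a : ℝ) (ha : 0 < a) (f : ℝ → ℝ) (x0 : ℕ) (hx0 : 1 ≤ x0)
    (hgr : ∀ x : ℝ, x0 ≤ x → a * x ^ k ≤ f x)
    (C : ℝ) (hC : 0 ≤ C) (hstep : ∀ x : ℝ, 1 ≤ x → f (x + 1) - f x ≤ C * x ^ (k - 1)) :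
    ∃ C' y0 : ℝ, 0 ≤ C' ∧ 0 ≤ y0 ∧ ∀ y, y0 ≤ y → ∃ x : ℕ, 0 < x ∧ 0 ≤ y - f x ∧
      y - f x ≤ C' * (1 + y) ^ (1 - 1 / (k : ℝ)) := by
  have hk0 : (0 : ℝ) < k := by exact_mod_cast hk
  set θ : ℝ := 1 - 1 / (k : ℝ) with hθ
  have hθ0 : 0 ≤ θ := by
    rw [hθ, sub_nonneg, div_le_one hk0]; exact_mod_cast hk
  refine ⟨C * (1 / a) ^ θ, |f x0|, by positivity, abs_nonneg _, fun y hy => ?_⟩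
  have hy0 : f x0 ≤ y := (le_abs_self _).trans hy
  have hyn : 0 ≤ y := (abs_nonneg _).trans hy
  have hex : ∃ m : ℕ, y < f ((x0 + m + 1 : ℕ) : ℝ) := by
    obtain ⟨m, hm⟩ := exists_nat_gt (y / a)
    refine ⟨m, ?_⟩
    have h1 : y < a * m := by rw [div_lt_iff₀ ha] at hm; linarith
    have h2 := hgr ((x0 + m + 1 : ℕ) : ℝ) (by exact_mod_cast (by omega : x0 ≤ x0 + m + 1))
    have h3 : (m : ℝ) ≤ ((x0 + m + 1 : ℕ) : ℝ) ^ k := by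
      have : m ≤ (x0 + m + 1) ^ k := by
        calc m ≤ x0 + m + 1 := by omega
          _ ≤ (x0 + m + 1) ^ k := Nat.le_self_pow (by omega) _
      exact_mod_cast this
    have h4 : a * m ≤ a * ((x0 + m + 1 : ℕ) : ℝ) ^ k := by gcongr
    linarith
  classical
  have hm := Nat.find_spec hex
  set m := Nat.find hex with hmdef
  have hlow : f ((x0 + m : ℕ) : ℝ) ≤ y := by
    rcases Nat.eq_zero_or_pos m with h | h
    · rw [h]; simpa using hy0
    · have := Nat.find_min hex (show m - 1 < m by omega)
      have e : x0 + (m - 1) + 1 = x0 + m := by omega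
      rw [e] at this
      exact not_lt.1 this
  set x := x0 + m with hx
  have hx1 : (1 : ℝ) ≤ x := by exact_mod_cast (by omega : 1 ≤ x)
  refine ⟨x, by omega, by linarith, ?_⟩
  have h1 := hstep x hx1
  push_cast at hm
  have h2 : y - f x ≤ C * (x : ℝ) ^ (k - 1) := by linarith
  refine h2.trans ?_
  have h3 := hgr x (by exact_mod_cast (by omega : x0 ≤ x))
  have h4 : (x : ℝ) ^ k ≤ (1 / a) * (1 + y) := by
    rw [one_div, ← div_eq_inv_mul, le_div_iff₀ ha]
    linarith
  have h5 : (x : ℝ) ^ (k - 1) = ((x : ℝ) ^ k) ^ θ := by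
    rw [← Real.rpow_natCast, ← Real.rpow_natCast, ← Real.rpow_mul (by positivity)]
    congr 1
    rw [hθ, Nat.cast_sub hk]
    field_simp
    simp
  calc C * (x : ℝ) ^ (k - 1) ≤ C * ((1 / a) * (1 + y)) ^ θ := by
        rw [h5]; gcongr
    _ = C * (1 / a) ^ θ * (1 + y) ^ θ := by
        rw [Real.mul_rpow (by positivity) (by linarith)]; ring

lemma greedy_iter (f : ℝ → ℝ) (θ : ℝ) (hθ0 : 0 ≤ θ) (C' y0 : ℝ) (hC' : 0 ≤ C') (hy0 : 0 ≤ y0)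
    (h : ∀ y, y0 ≤ y → ∃ x : ℕ, 0 < x ∧ 0 ≤ y - f x ∧ y - f x ≤ C' * (1 + y) ^ θ) (m : ℕ) :
    ∃ C : ℝ, 0 ≤ C ∧ ∀ y, 0 ≤ y → ∃ x : Fin m → ℕ, (∀ i, 0 < x i) ∧
      -C ≤ y - ∑ i, f (x i) ∧ y - ∑ i, f (x i) ≤ C * (1 + y) ^ (θ ^ m) := by
  induction m with
  | zero =>
    refine ⟨1, zero_le_one, fun y hy => ⟨fun _ => 1, fun _ => one_pos, ?_, ?_⟩⟩
    · simp; linarith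
    · simp
  | succ m ih =>
    obtain ⟨C, hC, ih⟩ := ih
    set C2 : ℝ := C + |f 1| + y0 + C' * (1 + C) ^ θ with hC2
    have hC2n : 0 ≤ C2 := by positivity
    refine ⟨C2, hC2n, fun y hy => ?_⟩
    obtain ⟨x, hx, h1, h2⟩ := ih y hy
    set R := y - ∑ i, f (x i) with hR
    have hone : 1 ≤ (1 + y) ^ (θ ^ (m + 1)) := Real.one_le_rpow (by linarith) (by positivity)
    have key : ∃ z : ℕ, 0 < z ∧ -C2 ≤ R - f z ∧ R - f z ≤ C2 * (1 + y) ^ (θ ^ (m + 1)) := by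
      have habs := abs_nonneg (f 1)
      have hpos : 0 ≤ C' * (1 + C) ^ θ := by positivity
      by_cases hRy : y0 ≤ R
      · obtain ⟨z, hz, hz1, hz2⟩ := h R hRy
        refine ⟨z, hz, by linarith, hz2.trans ?_⟩
        have hb : 1 + R ≤ (1 + C) * (1 + y) ^ (θ ^ m) := by
          have : 1 ≤ (1 + y) ^ (θ ^ m) := Real.one_le_rpow (by linarith) (by positivity)
          linarith
        calc C' * (1 + R) ^ θ ≤ C' * ((1 + C) * (1 + y) ^ (θ ^ m)) ^ θ := by
              gcongr
              linarith
          _ = C' * (1 + C) ^ θ * (1 + y) ^ (θ ^ (m + 1)) := by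
              rw [Real.mul_rpow (by positivity) (by positivity), ← Real.rpow_mul (by linarith),
                pow_succ]
              ring
          _ ≤ C2 * (1 + y) ^ (θ ^ (m + 1)) := by
              gcongr
              linarith
      · refine ⟨1, one_pos, ?_, ?_⟩
        · have := le_abs_self (f 1)
          rw [Nat.cast_one]
          linarith
        · have := neg_abs_le (f 1)
          rw [Nat.cast_one]
          have h3 : C2 ≤ C2 * (1 + y) ^ (θ ^ (m + 1)) := le_mul_of_one_le_right hC2n hone
          linarith
    obtain ⟨z, hz, hz1, hz2⟩ := key
    refine ⟨Fin.cons z x, ?_, ?_⟩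
    · intro i
      refine Fin.cases ?_ (fun i => ?_) i
      · simpa using hz
      · simpa using hx i
    · have e : y - ∑ i, f ((Fin.cons z x : Fin (m + 1) → ℕ) i) = R - f z := by
        rw [Fin.sum_univ_succ]
        simp only [Fin.cons_zero, Fin.cons_succ]
        rw [hR]; ring
      rw [e]
      exact ⟨hz1, hz2⟩

lemma local_sum (k : ℕ) (hk : 1 ≤ k) (α : ℕ → ℝ) (hα : 0 < α k)
    (r : ℝ → ℝ) (C1 : ℝ) (hC0 : 0 ≤ C1)
    (hloc : ∀ x t : ℝ, 1 ≤ x → 0 ≤ t → t ^ 2 ≤ x → |r (x + t) - r x| ≤ C1)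
    (f : ℝ → ℝ) (hf : ∀ x : ℝ, f x = (∑ i ∈ Finset.Icc 1 k, α i * x ^ i) + r x)
    (x0 : ℕ) (hx0 : 1 ≤ x0)
    (hgr : ∀ x : ℝ, x0 ≤ x → α k / 2 * x ^ k ≤ f x ∧ f x ≤ 2 * α k * x ^ k) :
    ∃ (ι : Type) (_ : Fintype ι) (b C : ℝ) (K : ℕ), 0 < b ∧ 0 ≤ C ∧ 1 ≤ K ∧ ∀ X L : ℕ, x0 ≤ X →
      (K * (L + 1) ^ K) ^ 2 ≤ X → ∃ Φ : ℝ, |Φ| ≤ C * (X : ℝ) ^ k ∧ ∀ n : ℕ, n ≤ L →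
        ∃ t : ι → ℕ, (∀ i, 0 < t i) ∧ |∑ i, f (t i) - (Φ + b * n)| ≤ C := by
  obtain ⟨ι, _, B, K, hB, h⟩ := (PTE_all quad k hk).pos
  set s : ℝ := (Fintype.card ι : ℝ) with hs
  have hs0 : 0 ≤ s := by positivity
  refine ⟨ι, inferInstance, α k * B, s * C1 + s * (2 * α k * 2 ^ k), K + 1, by positivity,
    by positivity, by omega, fun X L hX hL => ?_⟩
  obtain ⟨c, hc⟩ := h L
  set Φ : ℝ := (∑ a ∈ Finset.Icc 1 k, α a * ∑ j ∈ range (a + 1),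
    (c j : ℝ) * (X : ℝ) ^ (a - j) * (a.choose j : ℝ)) + s * r X with hΦ
  have hX1 : (1 : ℝ) ≤ X := by exact_mod_cast hx0.trans hX
  have hmain : ∀ n : ℕ, n ≤ L → ∃ t : ι → ℕ, (∀ i, t i ≤ X) ∧
      |∑ i, f ((t i + X : ℕ) : ℝ) - (Φ + α k * B * n)| ≤ s * C1 := by
    intro n hn
    obtain ⟨t, ht, hj⟩ := hc n hn
    have hsq : ∀ i, t i ^ 2 ≤ X := by
      intro i
      refine le_trans (Nat.pow_le_pow_left ((ht i).trans ?_) 2) hL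
      apply Nat.mul_le_mul (by omega)
      apply Nat.pow_le_pow_right <;> omega
    refine ⟨t, fun i => (Nat.le_self_pow two_ne_zero _).trans (hsq i), ?_⟩
    have hj' : ∀ j ≤ k, ∑ i, (t i : ℝ) ^ j = (c j : ℝ) + if j = k then (B * n : ℝ) else 0 := by
      intro j hjk
      have := congrArg (Int.cast : ℤ → ℝ) (hj j hjk)
      push_cast at this
      rw [this]
    have hpoly : ∑ i, ∑ a ∈ Finset.Icc 1 k, α a * ((t i : ℝ) + X) ^ a =
        (∑ a ∈ Finset.Icc 1 k, α a * ∑ j ∈ range (a + 1),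
          (c j : ℝ) * (X : ℝ) ^ (a - j) * (a.choose j : ℝ)) + α k * B * n := by
      rw [sum_comm]
      have : ∀ a ∈ Finset.Icc 1 k, ∑ i, α a * ((t i : ℝ) + X) ^ a =
          α a * ∑ j ∈ range (a + 1), (c j : ℝ) * (X : ℝ) ^ (a - j) * (a.choose j : ℝ) +
            if a = k then α k * B * n else 0 := by
        intro a ha
        rw [Finset.mem_Icc] at ha
        rw [← mul_sum]
        simp only [add_pow]
        rw [sum_comm]
        have h1 : ∀ j ∈ range (a + 1), ∑ i, (t i : ℝ) ^ j * (X : ℝ) ^ (a - j) * (a.choose j : ℝ) =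
            (c j : ℝ) * (X : ℝ) ^ (a - j) * (a.choose j : ℝ) + if j = k then (B * n : ℝ) else 0 := by
          intro j hj2
          have hja : j ≤ a := by simpa [Nat.lt_succ_iff] using hj2
          rw [← sum_mul, ← sum_mul, hj' j (hja.trans ha.2)]
          split_ifs with hjk
          · have : a = k := by omega
            subst this; subst hjk; simp
          · ring
        rw [sum_congr rfl h1, sum_add_distrib, mul_add]
        congr 1
        rw [Finset.sum_ite_eq']
        by_cases hak : a = k
        · subst hak; simp; ring
        · rw [if_neg hak, if_neg, mul_zero]
          simp; omega
      rw [sum_congr rfl this, sum_add_distrib, Finset.sum_ite_eq', if_pos (by simp [hk])]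
    have hrr : |∑ i, (r ((X : ℝ) + t i) - r X)| ≤ s * C1 := by
      refine (Finset.abs_sum_le_sum_abs _ _).trans ?_
      calc _ ≤ ∑ _i : ι, C1 := by
            apply Finset.sum_le_sum
            intro i _
            exact hloc X (t i) hX1 (by positivity) (by exact_mod_cast hsq i)
        _ = s * C1 := by simp [hs]
    have e : ∑ i, f ((t i + X : ℕ) : ℝ) - (Φ + α k * B * n) = ∑ i, (r ((X : ℝ) + t i) - r X) := by
      push_cast
      simp only [hf]
      rw [sum_add_distrib, hpoly, hΦ, sum_sub_distrib]
      simp only [Finset.sum_const, Finset.card_univ, nsmul_eq_mul, ← hs, add_comm (X : ℝ)]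
      ring
    rw [e]
    exact hrr
  refine ⟨Φ, ?_, fun n hn => ?_⟩
  · obtain ⟨t, ht, h1⟩ := hmain 0 (Nat.zero_le _)
    have h2 : |∑ i, f ((t i + X : ℕ) : ℝ)| ≤ s * (2 * α k * 2 ^ k) * (X : ℝ) ^ k := by
      refine (Finset.abs_sum_le_sum_abs _ _).trans ?_
      calc _ ≤ ∑ _i : ι, (2 * α k * 2 ^ k) * (X : ℝ) ^ k := by
            apply Finset.sum_le_sum
            intro i _
            have h3 := hgr ((t i + X : ℕ) : ℝ) (by exact_mod_cast (by omega : x0 ≤ t i + X))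
            have h4 : (0 : ℝ) ≤ f ((t i + X : ℕ) : ℝ) := le_trans (by positivity) h3.1
            rw [abs_of_nonneg h4]
            refine h3.2.trans ?_
            have h5 : ((t i + X : ℕ) : ℝ) ≤ 2 * X := by
              have := ht i
              exact_mod_cast (by omega : t i + X ≤ 2 * X)
            calc 2 * α k * ((t i + X : ℕ) : ℝ) ^ k ≤ 2 * α k * (2 * X) ^ k := by gcongr
              _ = _ := by rw [mul_pow]; ring
        _ = _ := by simp [hs]; ring
    have h3 : s * C1 ≤ s * C1 * (X : ℝ) ^ k :=
      le_mul_of_one_le_right (by positivity) (one_le_pow₀ hX1)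
    rw [add_mul]
    simp only [Nat.cast_zero, mul_zero, add_zero] at h1
    rw [abs_le] at *
    constructor <;> linarith [h1.1, h1.2, h2.1, h2.2]
  · obtain ⟨t, ht, h1⟩ := hmain n hn
    refine ⟨fun i => t i + X, fun i => show 0 < t i + X by omega, h1.trans ?_⟩
    have : 0 ≤ s * (2 * α k * 2 ^ k) := by positivity
    linarith
lemma main_real (k : ℕ) (hk : 1 ≤ k) (f : ℝ → ℝ) (x0 : ℕ) (θ : ℝ) (hθ0 : 0 ≤ θ) (hθ1 : θ < 1)
    (hgreedy : ∀ m : ℕ, ∃ C : ℝ, 0 ≤ C ∧ ∀ y, 0 ≤ y → ∃ x : Fin m → ℕ, (∀ i, 0 < x i) ∧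
      -C ≤ y - ∑ i, f (x i) ∧ y - ∑ i, f (x i) ≤ C * (1 + y) ^ (θ ^ m))
    (ι : Type) [Fintype ι] (b C : ℝ) (K : ℕ) (hb : 0 < b) (hC : 0 ≤ C) (hK : 1 ≤ K)
    (hlocal : ∀ X L : ℕ, x0 ≤ X →
      (K * (L + 1) ^ K) ^ 2 ≤ X → ∃ Φ : ℝ, |Φ| ≤ C * (X : ℝ) ^ k ∧ ∀ n : ℕ, n ≤ L →
        ∃ t : ι → ℕ, (∀ i, 0 < t i) ∧ |∑ i, f (t i) - (Φ + b * n)| ≤ C) :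
    ∃ s : ℕ, 0 < s ∧ ∃ C₀ : ℝ, 0 < C₀ ∧ ∃ N₀ : ℝ, ∀ N : ℝ, N₀ ≤ N →
        ∃ x : Fin s → ℕ, (∀ i, 0 < x i) ∧ |(∑ i, f (x i)) - N| ≤ C₀ := by
  set E : ℕ := 2 * K * k with hE
  have he : (0 : ℝ) < E + 1 := by positivity
  obtain ⟨m0, hm0⟩ := exists_pow_lt_of_lt_one (show (0 : ℝ) < 1 / (2 * (E + 1)) by positivity) hθ1
  set m := m0 + 1 with hm
  have hme : θ ^ m * (E + 1) ≤ 1 / 2 := by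
    have h1 : θ ^ m ≤ θ ^ m0 := pow_le_pow_of_le_one hθ0 hθ1.le (by omega)
    have h2 : θ ^ m ≤ 1 / (2 * (E + 1)) := h1.trans hm0.le
    calc θ ^ m * (E + 1) ≤ 1 / (2 * (E + 1)) * (E + 1) := by gcongr
      _ = 1 / 2 := by field_simp
  obtain ⟨D, hD, hgr⟩ := hgreedy m
  -- size conditions on the scale
  have hev : ∀ᶠ L : ℕ in Filter.atTop, (x0 ≤ L ∧ 1 ≤ L) ∧
      2 * (C * (K ^ 2) ^ k * 2 ^ E) ≤ L ∧ D ^ 2 * 8 ≤ b ^ 2 * L := by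
    refine ((Filter.eventually_ge_atTop x0).and (Filter.eventually_ge_atTop 1)).and (Filter.Eventually.and ?_ ?_)
    · exact tendsto_natCast_atTop_atTop.eventually_ge_atTop _
    · exact (tendsto_natCast_atTop_atTop.const_mul_atTop (show 0 < b ^ 2 by positivity)).eventually_ge_atTop _
  obtain ⟨L0, hL0⟩ := Filter.eventually_atTop.1 hev
  refine ⟨m + Fintype.card ι, by omega, D + b + C + 1, by positivity, ((L0 : ℝ)) ^ (E + 1), fun N hN => ?_⟩
  -- choose the scale
  have hN0 : 0 ≤ N := le_trans (by positivity) hN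
  obtain ⟨L, hLL, hLN, hNL⟩ : ∃ L : ℕ, L0 ≤ L ∧ (L : ℝ) ^ (E + 1) ≤ N ∧ N < ((L : ℝ) + 1) ^ (E + 1) := by
    classical
    have hex : ∃ j : ℕ, N < (((L0 + j + 1 : ℕ)) : ℝ) ^ (E + 1) := by
      obtain ⟨j, hj⟩ := exists_nat_gt N
      refine ⟨j, hj.trans_le ?_⟩
      have : j ≤ (L0 + j + 1) ^ (E + 1) := by
        calc j ≤ L0 + j + 1 := by omega
          _ ≤ _ := Nat.le_self_pow (by omega) _
      exact_mod_cast this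
    refine ⟨L0 + Nat.find hex, by omega, ?_, ?_⟩
    · rcases Nat.eq_zero_or_pos (Nat.find hex) with h | h
      · rw [h]; simpa using hN
      · have := Nat.find_min hex (show Nat.find hex - 1 < Nat.find hex by omega)
        have e : L0 + (Nat.find hex - 1) + 1 = L0 + Nat.find hex := by omega
        rw [e] at this
        exact not_lt.1 this
    · have := Nat.find_spec hex
      push_cast at this ⊢
      exact this
  obtain ⟨⟨hLx, hL1⟩, hL2, hL3⟩ := hL0 L hLL
  have hL1' : (1 : ℝ) ≤ L := by exact_mod_cast hL1
  have hX : x0 ≤ (K * (L + 1) ^ K) ^ 2 := by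
    calc x0 ≤ L + 1 := by omega
      _ ≤ (L + 1) ^ K := Nat.le_self_pow (by omega) _
      _ ≤ K * (L + 1) ^ K := Nat.le_mul_of_pos_left _ (by omega)
      _ ≤ _ := Nat.le_self_pow two_ne_zero _
  obtain ⟨Φ, hΦ, hn⟩ := hlocal _ L hX le_rfl
  have hΦN : |Φ| ≤ N / 2 := by
    refine hΦ.trans ?_
    have e : ((((K * (L + 1) ^ K) ^ 2 : ℕ)) : ℝ) ^ k = (K ^ 2) ^ k * ((L : ℝ) + 1) ^ E := by
      push_cast
      have h2 : E = K * 2 * k := by rw [hE]; ring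
      rw [h2, mul_pow, mul_pow, pow_mul, pow_mul]
    rw [e]
    calc C * ((K ^ 2) ^ k * ((L : ℝ) + 1) ^ E) ≤ C * ((K ^ 2) ^ k * (2 * (L : ℝ)) ^ E) := by
          gcongr; linarith
      _ = (C * (K ^ 2) ^ k * 2 ^ E) * (L : ℝ) ^ E := by rw [mul_pow]; ring
      _ ≤ (L / 2 : ℝ) * (L : ℝ) ^ E := by gcongr; linarith
      _ = (L : ℝ) ^ (E + 1) / 2 := by rw [pow_succ]; ring
      _ ≤ N / 2 := by linarith
  have hΦ2 := abs_le.1 hΦN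
  obtain ⟨x, hx, hx1, hx2⟩ := hgr (N - Φ) (by linarith [hΦ2.2])
  set R := N - Φ - ∑ i, f (x i) with hR
  have hRL : R ≤ b * L := by
    refine hx2.trans ?_
    have h1 : 1 + (N - Φ) ≤ (8 * (L : ℝ)) ^ (E + 1) := by
      have h2 : N ≤ (2 * (L : ℝ)) ^ (E + 1) := hNL.le.trans (by gcongr; linarith)
      have h3 : (1 : ℝ) ≤ (2 * (L : ℝ)) ^ (E + 1) := one_le_pow₀ (by linarith)
      have h4 : (8 * (L : ℝ)) ^ (E + 1) = 4 ^ (E + 1) * (2 * (L : ℝ)) ^ (E + 1) := by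
        rw [← mul_pow]; ring_nf
      have h5 : (4 : ℝ) ≤ 4 ^ (E + 1) := by
        rw [pow_succ]
        have : (1 : ℝ) ≤ 4 ^ E := one_le_pow₀ (by norm_num)
        linarith
      rw [h4]
      nlinarith [hΦ2.1]
    have h2 : (1 + (N - Φ)) ^ (θ ^ m) ≤ √(8 * L) := by
      calc (1 + (N - Φ)) ^ (θ ^ m) ≤ ((8 * (L : ℝ)) ^ (E + 1)) ^ (θ ^ m) := by
            apply Real.rpow_le_rpow _ h1 (by positivity)
            linarith [hΦ2.2]
        _ = (8 * (L : ℝ)) ^ (θ ^ m * (E + 1)) := by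
            rw [← Real.rpow_natCast, ← Real.rpow_mul (by positivity)]
            congr 1
            push_cast
            ring
        _ ≤ (8 * (L : ℝ)) ^ (1 / 2 : ℝ) := by
            apply Real.rpow_le_rpow_of_exponent_le (by linarith) hme
        _ = √(8 * L) := by rw [Real.sqrt_eq_rpow]
    calc D * (1 + (N - Φ)) ^ (θ ^ m) ≤ D * √(8 * L) := by gcongr
      _ ≤ b * L := by
        refine (sq_le_sq₀ (by positivity) (by positivity)).1 ?_
        rw [mul_pow, Real.sq_sqrt (by positivity)]
        calc D ^ 2 * (8 * (L : ℝ)) = (D ^ 2 * 8) * L := by ring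
          _ ≤ (b ^ 2 * L) * L := by gcongr
          _ = (b * L) ^ 2 := by ring
  obtain ⟨n, hnL, hnR⟩ : ∃ n : ℕ, n ≤ L ∧ |R - b * n| ≤ D + b := by
    by_cases hR0 : 0 ≤ R
    · refine ⟨⌊R / b⌋₊, ?_, ?_⟩
      · apply Nat.floor_le_of_le
        rw [div_le_iff₀ hb]
        linarith
      · have h1 := Nat.floor_le (show 0 ≤ R / b by positivity)
        have h2 := Nat.lt_floor_add_one (R / b)
        rw [le_div_iff₀ hb] at h1
        rw [div_lt_iff₀ hb] at h2
        rw [abs_le]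
        constructor <;> nlinarith
    · refine ⟨0, Nat.zero_le _, ?_⟩
      rw [abs_le]
      rw [not_le] at hR0
      constructor <;> simp <;> linarith
  obtain ⟨t, ht, htt⟩ := hn n hnL
  refine ⟨Fin.append x (t ∘ (Fintype.equivFin ι).symm), ?_, ?_⟩
  · intro i
    refine Fin.addCases (fun i => ?_) (fun i => ?_) i
    · simpa using hx i
    · simpa using ht _
  · rw [Fin.sum_univ_add]
    simp only [Fin.append_left, Fin.append_right, Function.comp]
    rw [Equiv.sum_comp (Fintype.equivFin ι).symm (fun i => f (t i))]
    rw [abs_le] at *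
    constructor <;> linarith [hnR.1, hnR.2, htt.1, htt.2]

/-- If `f = p + r` with `p` a degree-`k` real polynomial with positive leading
coefficient and zero constant term, and `r` a small perturbation
(`|r^{(j)}(x)| ≤ C_j x^{δ-j}` with `δ < 1/2`), then for some `s` every large
real `N` is within a bounded distance of a sum `f(x₁) + ⋯ + f(x_s)`; in
particular, the `s`-fold sumset of `(⌊f(n)⌋)` has bounded gaps. -/
theorem stmt_9 (k : ℕ) (hk : 1 ≤ k) (α : ℕ → ℝ) (hα : 0 < α k)
    (δ : ℝ) (hδ0 : 0 < δ) (hδ : δ < 1 / 2)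
    (r : ℝ → ℝ) (hr : ContDiffOn ℝ k r (Set.Ici 1))
    (hbound : ∀ j : ℕ, j ≤ k → ∃ Cj : ℝ, ∀ x : ℝ, 1 ≤ x →
      |iteratedDerivWithin j r (Set.Ici 1) x| ≤ Cj * x ^ (δ - j))
    (f : ℝ → ℝ) (hf : ∀ x : ℝ, f x = (∑ i ∈ Finset.Icc 1 k, α i * x ^ i) + r x) :
    ∃ s : ℕ, 0 < s ∧
      (∃ C₀ : ℝ, 0 < C₀ ∧ ∃ N₀ : ℝ, ∀ N : ℝ, N₀ ≤ N →
        ∃ x : Fin s → ℕ, (∀ i, 0 < x i) ∧ |(∑ i, f (x i)) - N| ≤ C₀) ∧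
      (∃ g : ℕ, ∃ m₀ : ℤ, ∀ m : ℤ, m₀ ≤ m →
        ∃ x : Fin s → ℕ, (∀ i, 0 < x i) ∧
          m ≤ ∑ i, ⌊f (x i)⌋ ∧ ∑ i, ⌊f (x i)⌋ ≤ m + g) := by
  obtain ⟨C1, hC1, hloc⟩ := r_local k hk δ hδ r hr hbound
  obtain ⟨x0, hx0, hgr⟩ := f_growth k hk α hα δ hδ r hbound f hf
  obtain ⟨C2, hC2, hstep⟩ := f_step k hk α r C1 hC1 hloc f hf
  obtain ⟨C3, y0, hC3, hy0, hg1⟩ := greedy_one k hk (α k / 2) (by positivity) f x0 hx0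
    (fun x hx => (hgr x hx).1) C2 hC2 hstep
  have hk0 : (0 : ℝ) < k := by exact_mod_cast hk
  have hθ0 : 0 ≤ 1 - 1 / (k : ℝ) := by
    rw [sub_nonneg, div_le_one hk0]; exact_mod_cast hk
  have hθ1 : 1 - 1 / (k : ℝ) < 1 := by
    have : 0 < 1 / (k : ℝ) := by positivity
    linarith
  obtain ⟨ι, _, b, C, K, hb, hC, hK, hlocal⟩ := local_sum k hk α hα r C1 hC1 hloc f hf x0 hx0 hgr
  obtain ⟨s, hs, C₀, hC₀, N₀, hmain⟩ := main_real k hk f x0 _ hθ0 hθ1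
    (greedy_iter f _ hθ0 C3 y0 hC3 hy0 hg1) ι b C K hb hC hK hlocal
  refine ⟨s, hs, ⟨C₀, hC₀, N₀, hmain⟩, ⌈2 * C₀ + s⌉₊, ⌈N₀⌉, fun m hm => ?_⟩
  have hmN : N₀ ≤ m := Int.ceil_le.1 hm
  obtain ⟨x, hx, hxN⟩ := hmain (m + C₀ + s) (by
    have : (0 : ℝ) ≤ s := by positivity
    linarith)
  have h := abs_le.1 hxN
  have hfl1 : ∑ i, (⌊f (x i)⌋ : ℝ) ≤ ∑ i, f (x i) := Finset.sum_le_sum fun i _ => Int.floor_le _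
  have hfl2 : ∑ i, f (x i) ≤ ∑ i, ((⌊f (x i)⌋ : ℝ) + 1) :=
    Finset.sum_le_sum fun i _ => (Int.lt_floor_add_one _).le
  rw [Finset.sum_add_distrib] at hfl2
  simp only [Finset.sum_const, Finset.card_univ, Fintype.card_fin, nsmul_eq_mul, mul_one] at hfl2
  refine ⟨x, hx, ?_, ?_⟩
  · have : (m : ℝ) ≤ ((∑ i, ⌊f (x i)⌋ : ℤ) : ℝ) := by
      push_cast
      linarith [h.1]
    exact_mod_cast this
  · have : ((∑ i, ⌊f (x i)⌋ : ℤ) : ℝ) ≤ ((m + (⌈2 * C₀ + s⌉₊ : ℤ) : ℤ) : ℝ) := by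
      push_cast
      have := Nat.le_ceil (2 * C₀ + (s : ℝ))
      linarith [h.2]
    exact_mod_cast this
end
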